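/- Let Ω ⊂ ℝ³ be a bounded convex polyhedral domain, and let u ∈ H₀(grad curl, Ω) solve the quad-curl singular perturbation problem with data f ∈ H(div,Ω), div f = 0. Then for every v_h ∈ W_{h0} the consistency error satisfies both ε² a_h(u, v_h) + (curl u, curl v_h) − (f, v_h) ≤ C h ε² |curl u|₂ |curl v_h|_{1,h} and ε² a_h(u, v_h) + (curl u, curl v_h) − (f, v_h) ≤ C h^{1/2} ε² |curl u|₁^{1/2} |curl u|₂^{1/2} |curl v_h|_{1,h}, with C independent of h, ε, u, v_h. -/

import Mathlib

open MeasureTheory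
open scoped Classical

noncomputable section

/-! ### Basic vector calculus on ℝ³ -/

abbrev Vec : Type := Fin 3 → ℝ
abbrev Mat : Type := Fin 3 → Fin 3 → ℝ

/-- Euclidean dot product on ℝ³. -/
def dot3 (v w : Vec) : ℝ := ∑ i, v i * w i
/-- squared Euclidean norm. -/
def nsq3 (v : Vec) : ℝ := dot3 v v
/-- Euclidean norm. -/
def enorm3 (v : Vec) : ℝ := Real.sqrt (dot3 v v)
/-- normalization to a unit vector. -/
def normalize3 (v : Vec) : Vec := (enorm3 v)⁻¹ • v
/-- cross product on ℝ³. -/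
def cross3 (v w : Vec) : Vec :=
  ![v 1 * w 2 - v 2 * w 1, v 2 * w 0 - v 0 * w 2, v 0 * w 1 - v 1 * w 0]
/-- Frobenius inner product of 3×3 matrices. -/
def dotM (A B : Mat) : ℝ := ∑ i, ∑ j, A i j * B i j
/-- squared Frobenius norm. -/
def nsqM (A : Mat) : ℝ := dotM A A

/-- partial derivative ∂ᵢ of a scalar field. -/
def pd (i : Fin 3) (f : Vec → ℝ) (x : Vec) : ℝ := fderiv ℝ f x (Pi.single i 1)
/-- gradient of a scalar field. -/
def grad3 (f : Vec → ℝ) (x : Vec) : Vec := fun i => pd i f x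
/-- curl of a vector field. -/
def curl3 (v : Vec → Vec) (x : Vec) : Vec :=
  ![pd 1 (fun y => v y 2) x - pd 2 (fun y => v y 1) x,
    pd 2 (fun y => v y 0) x - pd 0 (fun y => v y 2) x,
    pd 0 (fun y => v y 1) x - pd 1 (fun y => v y 0) x]
/-- divergence of a vector field. -/
def div3 (v : Vec → Vec) (x : Vec) : ℝ := ∑ i, pd i (fun y => v y i) x
/-- Jacobian matrix of a vector field. -/
def jac3 (v : Vec → Vec) (x : Vec) : Mat := fun i j => pd j (fun y => v y i) x
/-- application of a matrix to a vector (e.g. normal derivative ∂ₙ). -/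
def japply (J : Mat) (n : Vec) : Vec := fun i => ∑ j, J i j * n j

/-- iterated partial derivatives along a list of directions. -/
def pdIter : List (Fin 3) → (Vec → ℝ) → Vec → ℝ
  | [], f => f
  | i :: l, f => pd i (pdIter l f)

/-- `f` is (the function of) a polynomial of total degree at most `k`. -/
def PolyDeg (k : ℕ) (f : Vec → ℝ) : Prop :=
  ∃ p : MvPolynomial (Fin 3) ℝ, p.totalDegree ≤ k ∧ ∀ x, f x = MvPolynomial.eval x p
/-- vector-valued polynomial of total degree at most `k`. -/
def VPolyDeg (k : ℕ) (v : Vec → Vec) : Prop := ∀ i, PolyDeg k fun x => v x i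

/-! ### Tetrahedra -/

/-- A (nondegenerate) tetrahedron in ℝ³, given by its four vertices. -/
structure Tetra where
  vtx : Fin 4 → Vec
  indep : AffineIndependent ℝ vtx

namespace Tetra

/-- the tetrahedron as a closed subset of ℝ³. -/
def K (T : Tetra) : Set Vec := convexHull ℝ (Set.range T.vtx)
/-- the edge joining vertices `i`, `j`. -/
def edge (T : Tetra) (i j : Fin 4) : Set Vec := segment ℝ (T.vtx i) (T.vtx j)
/-- a unit tangent vector of the edge joining vertices `i`, `j`. -/
def tangent (T : Tetra) (i j : Fin 4) : Vec := normalize3 (T.vtx j - T.vtx i)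
/-- the face opposite to vertex `i`. -/
def face (T : Tetra) (i : Fin 4) : Set Vec := convexHull ℝ (T.vtx '' {j | j ≠ i})
/-- unit outward normal of the face opposite to vertex `i`. -/
def outNormal (T : Tetra) (i : Fin 4) : Vec :=
  let a := T.vtx (i.succAbove 0)
  let u := cross3 (T.vtx (i.succAbove 1) - a) (T.vtx (i.succAbove 2) - a)
  (if 0 < dot3 u (T.vtx i - a) then (-1 : ℝ) else 1) • normalize3 u

/-- `lam` is the family of barycentric coordinates of `T`. -/
def IsBary (T : Tetra) (lam : Fin 4 → Vec → ℝ) : Prop :=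
  (∀ i, PolyDeg 1 (lam i)) ∧ ∀ i j, lam i (T.vtx j) = if i = j then (1 : ℝ) else 0
/-- `b` is the (quartic) bubble function of `T`. -/
def IsBubble (T : Tetra) (b : Vec → ℝ) : Prop :=
  ∃ lam, T.IsBary lam ∧ ∀ x, b x = ∏ i, lam i x

end Tetra

/-! ### Local shape function spaces -/

/-- the local space `W_k(K) = ∇P_{k+1}(K) ⊕ x × P₁(K;ℝ³) ⊕ b_K P₁(K;ℝ³)`. -/
def MemW (k : ℕ) (T : Tetra) (v : Vec → Vec) : Prop :=
  ∃ (q : Vec → ℝ) (p r : Vec → Vec) (b : Vec → ℝ), T.IsBubble b ∧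
    PolyDeg (k + 1) q ∧ VPolyDeg 1 p ∧ VPolyDeg 1 r ∧
    ∀ x, v x = grad3 q x + cross3 x (p x) + b x • r x

/-- the local Tai–Winther space `V^d(K) = P₁(K;ℝ³) ⊕ curl(b_K P₁(K;ℝ³))`. -/
def MemVd (T : Tetra) (v : Vec → Vec) : Prop :=
  ∃ (p r : Vec → Vec) (b : Vec → ℝ), T.IsBubble b ∧ VPolyDeg 1 p ∧ VPolyDeg 1 r ∧
    ∀ x, v x = p x + curl3 (fun y => b y • r y) x

/-- the local Nédélec space `V_k^{ND}(K) = ∇P_{k+1}(K) ⊕ x × P₁(K;ℝ³)`, `k = 1,2`. -/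
def MemND (k : ℕ) (v : Vec → Vec) : Prop :=
  ∃ (q : Vec → ℝ) (p : Vec → Vec), PolyDeg (k + 1) q ∧ VPolyDeg 1 p ∧
    ∀ x, v x = grad3 q x + cross3 x (p x)

/-- the face test space `RM_{k-2}(F) = P₀(F;ℝ²) ⊕ x^⊥ P_{k-2}(F)` on the face with
unit normal `n`; for `k = 1` this is just `P₀(F;ℝ²)`. -/
def MemRM (k : ℕ) (n : Vec) (q : Vec → Vec) : Prop :=
  ∃ (a : Vec) (c : ℝ), dot3 a n = 0 ∧ (k ≤ 1 → c = 0) ∧ ∀ x, q x = a + c • cross3 n x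

/-- the face test space `RT(F) = P₀(F;ℝ²) ⊕ x P₀(F)` on the face with unit normal `n`. -/
def MemRT (n : Vec) (q : Vec → Vec) : Prop :=
  ∃ (a : Vec) (c : ℝ), dot3 a n = 0 ∧ ∀ x, q x = a + c • (x - dot3 x n • n)

/-! ### Degrees of freedom -/

/-- edge moment `∫_e (v⋅t) q ds`. -/
def edgeMoment (T : Tetra) (a b : Fin 4) (v : Vec → Vec) (q : Vec → ℝ) : ℝ :=
  ∫ x in T.edge a b, dot3 (v x) (T.tangent a b) * q x ∂μH[1]
/-- tangential face moment `∫_F (v × n)⋅q dS`. -/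
def faceTanMoment (T : Tetra) (a : Fin 4) (v : Vec → Vec) (q : Vec → Vec) : ℝ :=
  ∫ x in T.face a, dot3 (cross3 (v x) (T.outNormal a)) (q x) ∂μH[2]
/-- normal face moment `∫_F (v⋅n) q dS`. -/
def faceNorMoment (T : Tetra) (a : Fin 4) (v : Vec → Vec) (q : Vec → ℝ) : ℝ :=
  ∫ x in T.face a, dot3 (v x) (T.outNormal a) * q x ∂μH[2]
/-- surface integral over a face. -/
def faceInt2 (T : Tetra) (a : Fin 4) (g : Vec → ℝ) : ℝ := ∫ x in T.face a, g x ∂μH[2]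
/-- diameter of a face. -/
def hF (T : Tetra) (a : Fin 4) : ℝ := Metric.diam (T.face a)

/-! ### Meshes -/

/-- A face-to-face tetrahedral mesh. -/
structure Mesh where
  n : ℕ
  npos : 0 < n
  el : Fin n → Tetra
  disj : ∀ i j, i ≠ j → interior (el i).K ∩ interior (el j).K = ∅
  conform : ∀ i j, i ≠ j → ∃ s e : Set (Fin 4),
    (el i).vtx '' s = (el j).vtx '' e ∧ (el i).K ∩ (el j).K = convexHull ℝ ((el i).vtx '' s)

namespace Mesh
/-- the open domain triangulated by the mesh. -/
def domain (M : Mesh) : Set Vec := interior (⋃ i, (M.el i).K)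
/-- the mesh triangulates the (connected, polyhedral) domain `Ω`. -/
def Covers (M : Mesh) (Ω : Set Vec) : Prop :=
  Ω = M.domain ∧ closure Ω = (⋃ i, (M.el i).K) ∧ IsConnected Ω
/-- the mesh size `h`. -/
def hsize (M : Mesh) : ℝ := ⨆ i, Metric.diam (M.el i).K
/-- shape regularity with constant `ρ`. -/
def ShapeReg (ρ : ℝ) (M : Mesh) : Prop :=
  ∀ i, ∃ x, Metric.ball x (ρ * Metric.diam (M.el i).K) ⊆ (M.el i).K
end Mesh

/-- A bounded polyhedral domain: a connected open set triangulated by some tetrahedral mesh. -/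
def PolyhedralDomain (Ω : Set Vec) : Prop := ∃ M : Mesh, M.Covers Ω

/-- piecewise vector fields on a mesh (one smooth representative per element). -/
abbrev DiscVF (M : Mesh) := Fin M.n → Vec → Vec
/-- piecewise scalar fields on a mesh. -/
abbrev DiscSF (M : Mesh) := Fin M.n → Vec → ℝ

/-- elementwise average (the `L²`-projection onto piecewise constants). -/
def avg (M : Mesh) (g : Vec → ℝ) (i : Fin M.n) : ℝ :=
  (∫ x in (M.el i).K, g x) / (volume (M.el i).K).toReal

/-! ### Global finite element spaces -/

/-- the `H(grad curl)`-nonconforming space `W_h`: piecewise `W_k(K)`, all DoFs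
single-valued, and the edge DoFs and `RM`-face DoFs vanishing on `∂Ω`. -/
def MemWh (k : ℕ) (M : Mesh) (Ω : Set Vec) (u : DiscVF M) : Prop :=
  (∀ i, MemW k (M.el i) (u i)) ∧
  (∀ i j a b c d, i ≠ j → (M.el i).edge a b = (M.el j).edge c d →
     ∀ q, PolyDeg k q → edgeMoment (M.el i) a b (u i) q = edgeMoment (M.el i) a b (u j) q) ∧
  (∀ i j a b, i ≠ j → (M.el i).face a = (M.el j).face b →
     ∀ q, MemRM k ((M.el i).outNormal a) q →
       faceTanMoment (M.el i) a (u i) q = faceTanMoment (M.el i) a (u j) q) ∧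
  (∀ i j a b, i ≠ j → (M.el i).face a = (M.el j).face b →
     ∀ q, MemRT ((M.el i).outNormal a) q →
       faceTanMoment (M.el i) a (curl3 (u i)) q = faceTanMoment (M.el i) a (curl3 (u j)) q) ∧
  (∀ i a b, (M.el i).edge a b ⊆ frontier Ω →
     ∀ q, PolyDeg k q → edgeMoment (M.el i) a b (u i) q = 0) ∧
  (∀ i a, (M.el i).face a ⊆ frontier Ω →
     ∀ q, MemRM k ((M.el i).outNormal a) q → faceTanMoment (M.el i) a (u i) q = 0)

/-- the space `W_{h0}`: all DoFs, including the curl-trace face DoFs, vanish on `∂Ω`. -/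
def MemWh0 (k : ℕ) (M : Mesh) (Ω : Set Vec) (u : DiscVF M) : Prop :=
  MemWh k M Ω u ∧
  ∀ i a, (M.el i).face a ⊆ frontier Ω →
    ∀ q, MemRT ((M.el i).outNormal a) q → faceTanMoment (M.el i) a (curl3 (u i)) q = 0

/-- the degree-`(k+1)` Lagrange space with zero boundary trace. -/
def MemVhg (k : ℕ) (M : Mesh) (Ω : Set Vec) (u : DiscSF M) : Prop :=
  (∀ i, PolyDeg (k + 1) (u i)) ∧
  (∀ i j, ∀ x ∈ (M.el i).K ∩ (M.el j).K, u i x = u j x) ∧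
  (∀ i, ∀ x ∈ (M.el i).K ∩ frontier Ω, u i x = 0)

/-- the Tai–Winther space `V_h^d`: normal components continuous, tangential `RT`-moments
single-valued, normal DoFs vanishing on `∂Ω`. -/
def MemVhd (M : Mesh) (Ω : Set Vec) (u : DiscVF M) : Prop :=
  (∀ i, MemVd (M.el i) (u i)) ∧
  (∀ i j a b, i ≠ j → (M.el i).face a = (M.el j).face b →
     (∀ q, PolyDeg 1 q → faceNorMoment (M.el i) a (u i) q = faceNorMoment (M.el i) a (u j) q) ∧
     (∀ q, MemRT ((M.el i).outNormal a) q →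
       faceTanMoment (M.el i) a (u i) q = faceTanMoment (M.el i) a (u j) q)) ∧
  (∀ i a, (M.el i).face a ⊆ frontier Ω →
     ∀ q, PolyDeg 1 q → faceNorMoment (M.el i) a (u i) q = 0)

/-- the Tai–Winther space `V_{h0}^d` with all DoFs vanishing on `∂Ω`. -/
def MemVh0d (M : Mesh) (Ω : Set Vec) (u : DiscVF M) : Prop :=
  MemVhd M Ω u ∧
  ∀ i a, (M.el i).face a ⊆ frontier Ω →
    ∀ q, MemRT ((M.el i).outNormal a) q → faceTanMoment (M.el i) a (u i) q = 0

/-- the piecewise-constant space `𝒬_h` with zero mean. -/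
def MemQh (M : Mesh) (q : Fin M.n → ℝ) : Prop :=
  ∑ i, q i * (volume (M.el i).K).toReal = 0

/-- the Nédélec space with vanishing tangential boundary DoFs. -/
def MemVND (k : ℕ) (M : Mesh) (Ω : Set Vec) (u : DiscVF M) : Prop :=
  (∀ i, MemND k (u i)) ∧
  (∀ i j a b c d, i ≠ j → (M.el i).edge a b = (M.el j).edge c d →
     ∀ q, PolyDeg k q → edgeMoment (M.el i) a b (u i) q = edgeMoment (M.el i) a b (u j) q) ∧
  (∀ i j a b, i ≠ j → (M.el i).face a = (M.el j).face b →
     ∀ q, MemRM k ((M.el i).outNormal a) q →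
       faceTanMoment (M.el i) a (u i) q = faceTanMoment (M.el i) a (u j) q) ∧
  (∀ i a b, (M.el i).edge a b ⊆ frontier Ω →
     ∀ q, PolyDeg k q → edgeMoment (M.el i) a b (u i) q = 0) ∧
  (∀ i a, (M.el i).face a ⊆ frontier Ω →
     ∀ q, MemRM k ((M.el i).outNormal a) q → faceTanMoment (M.el i) a (u i) q = 0)

/-- the lowest-order BDM space with vanishing normal boundary trace. -/
def MemVBDM (M : Mesh) (Ω : Set Vec) (u : DiscVF M) : Prop :=
  (∀ i, VPolyDeg 1 (u i)) ∧
  (∀ i j a b, i ≠ j → (M.el i).face a = (M.el j).face b →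
     ∀ x ∈ (M.el i).face a, dot3 (u i x) ((M.el i).outNormal a) = dot3 (u j x) ((M.el i).outNormal a)) ∧
  (∀ i a, (M.el i).face a ⊆ frontier Ω →
     ∀ x ∈ (M.el i).face a, dot3 (u i x) ((M.el i).outNormal a) = 0)

/-! ### Discrete norms and bilinear forms -/

/-- broken `L²` norm of a piecewise vector field. -/
def L2d (M : Mesh) (w : DiscVF M) : ℝ :=
  Real.sqrt (∑ i, ∫ x in (M.el i).K, nsq3 (w i x))
/-- `L²` norm of the (elementwise) curl. -/
def L2curl (M : Mesh) (w : DiscVF M) : ℝ :=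
  Real.sqrt (∑ i, ∫ x in (M.el i).K, nsq3 (curl3 (w i) x))
/-- broken `H¹` seminorm of the curl, `|curl v|_{1,h}`. -/
def semiCurl (M : Mesh) (w : DiscVF M) : ℝ :=
  Real.sqrt (∑ i, ∫ x in (M.el i).K, nsqM (jac3 (curl3 (w i)) x))
/-- the norm `‖v‖_{ε,h}`. -/
def epsNorm (ε : ℝ) (M : Mesh) (w : DiscVF M) : ℝ :=
  Real.sqrt ((L2d M w) ^ 2 + (L2curl M w) ^ 2 + ε ^ 2 * (semiCurl M w) ^ 2)
/-- broken `H¹` seminorm of a piecewise scalar field. -/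
def semiGrad (M : Mesh) (μ : DiscSF M) : ℝ :=
  Real.sqrt (∑ i, ∫ x in (M.el i).K, nsq3 (grad3 (μ i) x))

/-- `a_h(w,v) = Σ_K (∇curl w, ∇curl v)_K`. -/
def ah (M : Mesh) (w v : DiscVF M) : ℝ :=
  ∑ i, ∫ x in (M.el i).K, dotM (jac3 (curl3 (w i)) x) (jac3 (curl3 (v i)) x)
/-- `b(w,v) = (curl w, curl v)`. -/
def bh (M : Mesh) (w v : DiscVF M) : ℝ :=
  ∑ i, ∫ x in (M.el i).K, dot3 (curl3 (w i) x) (curl3 (v i) x)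
/-- `c(v,μ) = (v, ∇μ)`. -/
def ch (M : Mesh) (v : DiscVF M) (μ : DiscSF M) : ℝ :=
  ∑ i, ∫ x in (M.el i).K, dot3 (v i x) (grad3 (μ i) x)
/-- load functional `(f, v)`. -/
def fpair (M : Mesh) (f : Vec → Vec) (v : DiscVF M) : ℝ :=
  ∑ i, ∫ x in (M.el i).K, dot3 (f x) (v i x)

/-- `a_h(u, v_h)` with a continuous first argument, given by `J = ∇curl u`. -/
def ahC (M : Mesh) (J : Vec → Mat) (v : DiscVF M) : ℝ :=
  ∑ i, ∫ x in (M.el i).K, dotM (J x) (jac3 (curl3 (v i)) x)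
/-- `b(u, v_h)` with a continuous first argument, given by `cu = curl u`. -/
def bhC (M : Mesh) (cu : Vec → Vec) (v : DiscVF M) : ℝ :=
  ∑ i, ∫ x in (M.el i).K, dot3 (cu x) (curl3 (v i) x)

/-- broken `L²` distance between a function and a piecewise field. -/
def errL2 (M : Mesh) (v : Vec → Vec) (w : DiscVF M) : ℝ :=
  Real.sqrt (∑ i, ∫ x in (M.el i).K, nsq3 (v x - w i x))
/-- broken `L²` distance of curls, the first argument given by `cu = curl u`. -/
def errCurl (M : Mesh) (cu : Vec → Vec) (w : DiscVF M) : ℝ :=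
  Real.sqrt (∑ i, ∫ x in (M.el i).K, nsq3 (cu x - curl3 (w i) x))
/-- broken `H¹` distance of curls, the first argument given by `J = ∇curl u`. -/
def errSemi (M : Mesh) (J : Vec → Mat) (w : DiscVF M) : ℝ :=
  Real.sqrt (∑ i, ∫ x in (M.el i).K, nsqM (J x - jac3 (curl3 (w i)) x))
/-- error in the `‖·‖_{ε,h}` norm between `u` (with `curl u = cu`, `∇curl u = J`)
and a piecewise field `w`. -/
def errNorm (ε : ℝ) (M : Mesh) (u cu : Vec → Vec) (J : Vec → Mat) (w : DiscVF M) : ℝ :=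
  Real.sqrt ((errL2 M u w) ^ 2 + (errCurl M cu w) ^ 2 + ε ^ 2 * (errSemi M J w) ^ 2)
/-- broken `H¹` distance between a function with Jacobian `J` and a piecewise field. -/
def errJac (M : Mesh) (J : Vec → Mat) (w : DiscVF M) : ℝ :=
  Real.sqrt (∑ i, ∫ x in (M.el i).K, nsqM (J x - jac3 (w i) x))

/-- sum of a quantity over the boundary faces of the mesh. -/
def bdrySum (M : Mesh) (Ω : Set Vec) (g : Fin M.n → Fin 4 → ℝ) : ℝ :=
  ∑ i, ∑ a, if (M.el i).face a ⊆ frontier Ω then g i a else 0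

/-- the boundary part `ε² Σ_{F⊆∂Ω} h_F⁻¹ ‖curl v‖²_F` of the Nitsche norm. -/
def tripExtra (ε : ℝ) (M : Mesh) (Ω : Set Vec) (v : DiscVF M) : ℝ :=
  ε ^ 2 * bdrySum M Ω fun i a =>
    (hF (M.el i) a)⁻¹ * faceInt2 (M.el i) a fun x => nsq3 (curl3 (v i) x)
/-- the Nitsche norm `|||v|||_{ε,h}`. -/
def tripNorm (ε : ℝ) (M : Mesh) (Ω : Set Vec) (v : DiscVF M) : ℝ :=
  Real.sqrt ((epsNorm ε M v) ^ 2 + tripExtra ε M Ω v)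
/-- error in the Nitsche norm `|||·|||_{ε,h}`. -/
def errTrip (ε : ℝ) (M : Mesh) (Ω : Set Vec) (u cu : Vec → Vec) (J : Vec → Mat)
    (w : DiscVF M) : ℝ :=
  Real.sqrt ((errNorm ε M u cu J w) ^ 2 + ε ^ 2 * bdrySum M Ω fun i a =>
    (hF (M.el i) a)⁻¹ * faceInt2 (M.el i) a fun x => nsq3 (cu x - curl3 (w i) x))

/-- the Nitsche bilinear form `ã_h` on discrete functions. -/
def atildeD (σ : ℝ) (M : Mesh) (Ω : Set Vec) (w v : DiscVF M) : ℝ :=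
  ah M w v
  - bdrySum M Ω (fun i a => faceInt2 (M.el i) a fun x =>
      dot3 (japply (jac3 (curl3 (w i)) x) ((M.el i).outNormal a)) (curl3 (v i) x))
  - bdrySum M Ω (fun i a => faceInt2 (M.el i) a fun x =>
      dot3 (curl3 (w i) x) (japply (jac3 (curl3 (v i)) x) ((M.el i).outNormal a)))
  + bdrySum M Ω (fun i a => (σ / hF (M.el i) a) * faceInt2 (M.el i) a fun x =>
      dot3 (curl3 (w i) x) (curl3 (v i) x))

/-- the Nitsche form `ã_h(u, v_h)` with continuous first argument `u`
(`cu = curl u`, `J = ∇curl u`). -/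
def atildeC (σ : ℝ) (M : Mesh) (Ω : Set Vec) (cu : Vec → Vec) (J : Vec → Mat)
    (v : DiscVF M) : ℝ :=
  ahC M J v
  - bdrySum M Ω (fun i a => faceInt2 (M.el i) a fun x =>
      dot3 (japply (J x) ((M.el i).outNormal a)) (curl3 (v i) x))
  - bdrySum M Ω (fun i a => faceInt2 (M.el i) a fun x =>
      dot3 (cu x) (japply (jac3 (curl3 (v i)) x) ((M.el i).outNormal a)))
  + bdrySum M Ω (fun i a => (σ / hF (M.el i) a) * faceInt2 (M.el i) a fun x =>
      dot3 (cu x) (curl3 (v i) x))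
/-! ### Sobolev spaces via weak (distributional) derivatives -/

/-- smooth compactly supported scalar test functions on ℝ³. -/
def TestS (φ : Vec → ℝ) : Prop := ContDiff ℝ (⊤ : ℕ∞) φ ∧ HasCompactSupport φ
/-- smooth compactly supported vector test functions on ℝ³. -/
def TestV (φ : Vec → Vec) : Prop := ContDiff ℝ (⊤ : ℕ∞) φ ∧ HasCompactSupport φ

/-- extension by zero outside `Ω`. -/
def zextS (Ω : Set Vec) (f : Vec → ℝ) : Vec → ℝ := Ω.indicator f
/-- extension by zero outside `Ω` (vector-valued). -/
def zextV (Ω : Set Vec) (v : Vec → Vec) : Vec → Vec := Ω.indicator v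

/-- membership in `L²(Ω)`. -/
def MemL2S (Ω : Set Vec) (f : Vec → ℝ) : Prop := MemLp f 2 (volume.restrict Ω)
/-- membership in `L²(Ω;ℝ³)`. -/
def MemL2V (Ω : Set Vec) (v : Vec → Vec) : Prop := MemLp v 2 (volume.restrict Ω)

/-- `L²(Ω)` norm. -/
def L2SΩ (Ω : Set Vec) (f : Vec → ℝ) : ℝ := Real.sqrt (∫ x in Ω, (f x) ^ 2)
/-- `L²(Ω;ℝ³)` norm. -/
def L2VΩ (Ω : Set Vec) (v : Vec → Vec) : ℝ := Real.sqrt (∫ x in Ω, nsq3 (v x))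

/-- `g = ∂ᵢ f` in the sense of distributions on all of ℝ³. -/
def WkPD (i : Fin 3) (f g : Vec → ℝ) : Prop :=
  ∀ φ, TestS φ → ∫ x, g x * φ x = -∫ x, f x * pd i φ x
/-- `w = curl v` in the sense of distributions on all of ℝ³. -/
def WkCurlAll (v w : Vec → Vec) : Prop :=
  ∀ φ, TestV φ → ∫ x, dot3 (w x) (φ x) = ∫ x, dot3 (v x) (curl3 φ x)
/-- `d = div v` in the sense of distributions on all of ℝ³. -/
def WkDivAll (v : Vec → Vec) (d : Vec → ℝ) : Prop :=
  ∀ φ, TestS φ → ∫ x, d x * φ x = -∫ x, dot3 (v x) (grad3 φ x)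

/-- `g = ∂ᵢ f` in the sense of distributions on `Ω`. -/
def WkPDIn (Ω : Set Vec) (i : Fin 3) (f g : Vec → ℝ) : Prop :=
  ∀ φ, TestS φ → tsupport φ ⊆ Ω → ∫ x in Ω, g x * φ x = -∫ x in Ω, f x * pd i φ x
/-- `J` is the distributional Jacobian of `v` on `Ω`. -/
def WkJacIn (Ω : Set Vec) (v : Vec → Vec) (J : Vec → Mat) : Prop :=
  ∀ a b, WkPDIn Ω b (fun x => v x a) fun x => J x a b
/-- `g = ∂^α f` (`α` a list of directions) in the sense of distributions on `Ω`. -/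
def WkIterIn (Ω : Set Vec) (l : List (Fin 3)) (f g : Vec → ℝ) : Prop :=
  ∀ φ, TestS φ → tsupport φ ⊆ Ω →
    ∫ x in Ω, g x * φ x = (-1 : ℝ) ^ l.length * ∫ x in Ω, f x * pdIter l φ x
/-- `div v = 0` in the sense of distributions on `Ω`. -/
def WkDivFree (Ω : Set Vec) (v : Vec → Vec) : Prop :=
  ∀ φ, TestS φ → tsupport φ ⊆ Ω → ∫ x in Ω, dot3 (v x) (grad3 φ x) = 0

/-- scalar `H₀¹(Ω)` (via zero extension), with weak gradient `g`. -/
def MemH01S (Ω : Set Vec) (f : Vec → ℝ) (g : Vec → Vec) : Prop :=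
  MemL2S Ω f ∧ MemL2V Ω g ∧ ∀ i, WkPD i (zextS Ω f) fun x => zextV Ω g x i
/-- `H₀(curl,Ω)` (via zero extension), with weak curl `cv`. -/
def MemH0Curl (Ω : Set Vec) (v cv : Vec → Vec) : Prop :=
  MemL2V Ω v ∧ MemL2V Ω cv ∧ WkCurlAll (zextV Ω v) (zextV Ω cv)
/-- `H₀(div,Ω)` (via zero extension), with weak divergence `d`. -/
def MemH0Div (Ω : Set Vec) (v : Vec → Vec) (d : Vec → ℝ) : Prop :=
  MemL2V Ω v ∧ MemL2S Ω d ∧ WkDivAll (zextV Ω v) (zextS Ω d)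
/-- vector `H₀¹(Ω;ℝ³)` (via zero extension), with weak Jacobian `J`. -/
def MemH01V (Ω : Set Vec) (v : Vec → Vec) (J : Vec → Mat) : Prop :=
  MemL2V Ω v ∧ (∀ a b, MemL2S Ω fun x => J x a b) ∧
    ∀ a b, WkPD b (zextS Ω fun x => v x a) (zextS Ω fun x => J x a b)
/-- `H₀(grad curl, Ω)`: `u ∈ H₀(curl)` with `curl u = cu ∈ H₀¹(Ω;ℝ³)`, `J = ∇cu`. -/
def MemH0GC (Ω : Set Vec) (u cu : Vec → Vec) (J : Vec → Mat) : Prop :=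
  MemH0Curl Ω u cu ∧ MemH01V Ω cu J

/-- membership in `H^j(Ω)` componentwise via iterated distributional derivatives `D`,
indexed by multi-indices `α : Fin j → Fin 3` and components `c : Fin 3`. -/
def MemHiter (Ω : Set Vec) (j : ℕ) (v : Vec → Vec)
    (D : (Fin j → Fin 3) → Fin 3 → Vec → ℝ) : Prop :=
  ∀ α c, WkIterIn Ω (List.ofFn α) (fun x => v x c) (D α c) ∧ MemL2S Ω (D α c)
/-- the `H^j(Ω)` seminorm built from the iterated derivatives `D`. -/
def semiIter (Ω : Set Vec) (j : ℕ) (D : (Fin j → Fin 3) → Fin 3 → Vec → ℝ) : ℝ :=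
  Real.sqrt (∑ α : Fin j → Fin 3, ∑ c : Fin 3, ∫ x in Ω, (D α c x) ^ 2)
/-- the `H¹(Ω)` seminorm of a vector field with Jacobian `J`. -/
def semiJ (Ω : Set Vec) (J : Vec → Mat) : ℝ := Real.sqrt (∫ x in Ω, nsqM (J x))

/-- the `H^s(Ω)` seminorm, `1 ≤ s ≤ 2`, of a vector field with Jacobian `J` and second
derivatives `D2`; for `1 < s < 2` the Sobolev–Slobodeckij seminorm of the gradient. -/
def semiHsVec (Ω : Set Vec) (s : ℝ) (J : Vec → Mat)
    (D2 : (Fin 2 → Fin 3) → Fin 3 → Vec → ℝ) : ℝ :=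
  if s = 1 then semiJ Ω J
  else if s = 2 then semiIter Ω 2 D2
  else Real.sqrt (∑ a : Fin 3, ∑ b : Fin 3,
    ∫ x in Ω, ∫ y in Ω, (J x a b - J y a b) ^ 2 / dist x y ^ (3 + 2 * (s - 1)))
/-- membership in `H^s(Ω;ℝ³)`, `1 ≤ s ≤ 2`, with data `(J, D2)`. -/
def MemHsVec (Ω : Set Vec) (s : ℝ) (v : Vec → Vec) (J : Vec → Mat)
    (D2 : (Fin 2 → Fin 3) → Fin 3 → Vec → ℝ) : Prop :=
  WkJacIn Ω v J ∧ (∀ a b, MemL2S Ω fun x => J x a b) ∧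
  (s = 2 → MemHiter Ω 2 v D2) ∧
  (1 < s → s < 2 → ∀ a b, Integrable
    (fun p : Vec × Vec => (J p.1 a b - J p.2 a b) ^ 2 / dist p.1 p.2 ^ (3 + 2 * (s - 1)))
    ((volume.restrict Ω).prod (volume.restrict Ω)))

/-! ### The continuous problems -/

/-- weak solution of the quad-curl singular perturbation problem
`ε² curl⁴u + curl²u = f`, `div u = 0`, `u × n = curl u = 0` on `∂Ω`
(mixed formulation with multiplier `λ = 0`): here `cu = curl u`, `J = ∇curl u`. -/
def IsQuadCurlSol (Ω : Set Vec) (ε : ℝ) (f u cu : Vec → Vec) (J : Vec → Mat) : Prop :=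
  MemH0GC Ω u cu J ∧ WkDivFree Ω u ∧
  ∀ v cv Jv, MemH0GC Ω v cv Jv →
    ε ^ 2 * (∫ x in Ω, dotM (J x) (Jv x)) + (∫ x in Ω, dot3 (cu x) (cv x))
      = ∫ x in Ω, dot3 (f x) (v x)

/-- weak solution of the reduced double curl problem
`curl²u₀ = f`, `div u₀ = 0`, `u₀ × n = 0` on `∂Ω`; here `cu0 = curl u₀`. -/
def IsReducedSol (Ω : Set Vec) (f u0 cu0 : Vec → Vec) : Prop :=
  MemH0Curl Ω u0 cu0 ∧ WkDivFree Ω u0 ∧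
  ∀ v cv, MemH0Curl Ω v cv →
    (∫ x in Ω, dot3 (cu0 x) (cv x)) = ∫ x in Ω, dot3 (f x) (v x)

/-- the continuous mixed formulation: `u ∈ H₀(grad curl)`, `λ ∈ H₀¹`,
`ε²a(u,v) + b(u,v) + c(v,λ) = (f,v)` and `c(u,μ) = 0`. -/
def MixedSol (Ω : Set Vec) (ε : ℝ) (f u cu : Vec → Vec) (J : Vec → Mat)
    (lam : Vec → ℝ) (glam : Vec → Vec) : Prop :=
  MemH0GC Ω u cu J ∧ MemH01S Ω lam glam ∧
  (∀ v cv Jv, MemH0GC Ω v cv Jv →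
    ε ^ 2 * (∫ x in Ω, dotM (J x) (Jv x)) + (∫ x in Ω, dot3 (cu x) (cv x))
      + (∫ x in Ω, dot3 (v x) (glam x)) = ∫ x in Ω, dot3 (f x) (v x)) ∧
  (∀ μ gμ, MemH01S Ω μ gμ → ∫ x in Ω, dot3 (u x) (gμ x) = 0)

/-! ### Discrete methods -/

/-- the mixed finite element method (4.1)-(4.2). -/
def DiscMixedSol (k : ℕ) (M : Mesh) (Ω : Set Vec) (ε : ℝ) (f : Vec → Vec)
    (u : DiscVF M) (lam : DiscSF M) : Prop :=
  MemWh0 k M Ω u ∧ MemVhg k M Ω lam ∧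
  (∀ v, MemWh0 k M Ω v → ε ^ 2 * ah M u v + bh M u v + ch M v lam = fpair M f v) ∧
  (∀ μ, MemVhg k M Ω μ → ch M u μ = 0)

/-- the Nitsche-modified mixed finite element method (5.1)-(5.2). -/
def DiscNitscheSol (k : ℕ) (M : Mesh) (Ω : Set Vec) (σ ε : ℝ) (f : Vec → Vec)
    (u : DiscVF M) (lam : DiscSF M) : Prop :=
  MemWh k M Ω u ∧ MemVhg k M Ω lam ∧
  (∀ v, MemWh k M Ω v →
    ε ^ 2 * atildeD σ M Ω u v + bh M u v + ch M v lam = fpair M f v) ∧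
  (∀ μ, MemVhg k M Ω μ → ch M u μ = 0)

/-! ### Falk–Winther projections and derived interpolation operators -/

/-- The Falk–Winther local bounded commuting projections onto the Lagrange, Nédélec and
BDM spaces, together with the properties used in the paper. `avg` plays the role of the
projection `Q_h` onto piecewise constants. -/
structure FW (k : ℕ) (M : Mesh) (Ω : Set Vec) where
  Ig : (Vec → ℝ) → DiscSF M
  IND : (Vec → Vec) → DiscVF M
  IBDM : (Vec → Vec) → DiscVF M
  mapsIg : ∀ v gv, MemH01S Ω v gv → MemVhg k M Ω (Ig v)
  mapsIND : ∀ v cv, MemH0Curl Ω v cv → MemVND k M Ω (IND v)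
  mapsIBDM : ∀ v dv, MemH0Div Ω v dv → MemVBDM M Ω (IBDM v)
  zeroIBDM : ∀ i x, IBDM (fun _ => (0 : Vec)) i x = 0
  comm_grad : ∀ v gv, MemH01S Ω v gv → ∀ i, ∀ x ∈ (M.el i).K, IND gv i x = grad3 (Ig v i) x
  comm_curl : ∀ v cv, MemH0Curl Ω v cv → ∀ i, ∀ x ∈ (M.el i).K, IBDM cv i x = curl3 (IND v i) x
  comm_div : ∀ v dv, MemH0Div Ω v dv → ∀ i, ∀ x ∈ (M.el i).K, div3 (IBDM v i) x = avg M dv i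

/-- DoF-matching conditions defining the interpolations `I_{h0}^d`, `I_h^d` into the
Tai–Winther spaces relative to a given piecewise field `B` (namely `I_h^{BDM}v`): the
normal face DoFs match, and on interior faces the tangential DoFs match the face average. -/
def MatchIdInt (M : Mesh) (B w : DiscVF M) : Prop :=
  (∀ i a, ∀ q, PolyDeg 1 q → faceNorMoment (M.el i) a (w i) q = faceNorMoment (M.el i) a (B i) q) ∧
  (∀ i j a b, i ≠ j → (M.el i).face a = (M.el j).face b →
    ∀ q, MemRT ((M.el i).outNormal a) q →
      faceTanMoment (M.el i) a (w i) q
        = (faceTanMoment (M.el i) a (B i) q + faceTanMoment (M.el i) a (B j) q) / 2)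

/-- `w = I_{h0}^d v` where `B = I_h^{BDM} v`. -/
def IsId0 (M : Mesh) (Ω : Set Vec) (B w : DiscVF M) : Prop :=
  MemVh0d M Ω w ∧ MatchIdInt M B w

/-- `w = I_h^d v` where `B = I_h^{BDM} v`: additionally the tangential DoFs on boundary
faces match those of `B`. -/
def IsId (M : Mesh) (Ω : Set Vec) (B w : DiscVF M) : Prop :=
  MemVhd M Ω w ∧ MatchIdInt M B w ∧
  ∀ i a, (M.el i).face a ⊆ frontier Ω →
    ∀ q, MemRT ((M.el i).outNormal a) q →
      faceTanMoment (M.el i) a (w i) q = faceTanMoment (M.el i) a (B i) q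

/-- DoF-matching conditions defining `I_{h0}^{gc}`, `I_h^{gc}` relative to a given
piecewise field `N` (namely `I_h^{ND}v`). -/
def MatchIgcInt (k : ℕ) (M : Mesh) (N w : DiscVF M) : Prop :=
  (∀ i a b, a ≠ b → ∀ q, PolyDeg k q →
     edgeMoment (M.el i) a b (w i) q = edgeMoment (M.el i) a b (N i) q) ∧
  (∀ i a, ∀ q, MemRM k ((M.el i).outNormal a) q →
     faceTanMoment (M.el i) a (w i) q = faceTanMoment (M.el i) a (N i) q) ∧
  (∀ i j a b, i ≠ j → (M.el i).face a = (M.el j).face b →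
    ∀ q, MemRT ((M.el i).outNormal a) q →
      faceTanMoment (M.el i) a (curl3 (w i)) q
        = (faceTanMoment (M.el i) a (curl3 (N i)) q + faceTanMoment (M.el i) a (curl3 (N j)) q) / 2)

/-- `w = I_{h0}^{gc} v` where `N = I_h^{ND} v`. -/
def IsIgc0 (k : ℕ) (M : Mesh) (Ω : Set Vec) (N w : DiscVF M) : Prop :=
  MemWh0 k M Ω w ∧ MatchIgcInt k M N w

/-- `w = I_h^{gc} v` where `N = I_h^{ND} v`. -/
def IsIgc (k : ℕ) (M : Mesh) (Ω : Set Vec) (N w : DiscVF M) : Prop :=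
  MemWh k M Ω w ∧ MatchIgcInt k M N w ∧
  ∀ i a, (M.el i).face a ⊆ frontier Ω →
    ∀ q, MemRT ((M.el i).outNormal a) q →
      faceTanMoment (M.el i) a (curl3 (w i)) q = faceTanMoment (M.el i) a (curl3 (N i)) q

/-- `B` maps `H₀(div,Ω)` into the BDM space. -/
def BDMmaps (M : Mesh) (Ω : Set Vec) (B : (Vec → Vec) → DiscVF M) : Prop :=
  ∀ v dv, MemH0Div Ω v dv → MemVBDM M Ω (B v)
/-- the Falk–Winther `L²`-bound `‖I_h^{BDM}v‖₀ ≲ ‖v‖₀ + h‖div v‖₀`. -/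
def BDMbound (M : Mesh) (Ω : Set Vec) (B : (Vec → Vec) → DiscVF M) (C₀ : ℝ) : Prop :=
  ∀ v dv, MemH0Div Ω v dv → L2d M (B v) ≤ C₀ * (L2VΩ Ω v + M.hsize * L2SΩ Ω dv)
/-- the elementwise Falk–Winther error estimates
`Σ_K h_K^{2(i-j)} |v - I_h^{BDM}v|²_{i,K} ≲ |v|_j²` for `i = 0,1`, `j = 1,2`. -/
def BDMest (M : Mesh) (Ω : Set Vec) (B : (Vec → Vec) → DiscVF M) (C₀ : ℝ) : Prop :=
  (∀ v dv Jv, MemH0Div Ω v dv → WkJacIn Ω v Jv →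
     (∑ i, (Metric.diam (M.el i).K) ^ (-2 : ℝ) * ∫ x in (M.el i).K, nsq3 (v x - B v i x))
       + (∑ i, ∫ x in (M.el i).K, nsqM (Jv x - jac3 (B v i) x)) ≤ C₀ * (semiJ Ω Jv) ^ 2) ∧
  (∀ v dv Jv D2, MemH0Div Ω v dv → WkJacIn Ω v Jv → MemHiter Ω 2 v D2 →
     (∑ i, (Metric.diam (M.el i).K) ^ (-4 : ℝ) * ∫ x in (M.el i).K, nsq3 (v x - B v i x))
       + (∑ i, (Metric.diam (M.el i).K) ^ (-2 : ℝ) * ∫ x in (M.el i).K, nsqM (Jv x - jac3 (B v i) x))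
       ≤ C₀ * (semiIter Ω 2 D2) ^ 2)

/-! ### Subspaces for the dimension count -/

/-- the subspace `∇P_{k+1}` of vector fields. -/
def gradSpace (k : ℕ) : Submodule ℝ (Vec → Vec) :=
  Submodule.span ℝ {v | ∃ q, PolyDeg (k + 1) q ∧ v = fun x => grad3 q x}
/-- the subspace `x × P₁(ℝ³;ℝ³)`. -/
def crossSpace : Submodule ℝ (Vec → Vec) :=
  Submodule.span ℝ {v | ∃ p, VPolyDeg 1 p ∧ v = fun x => cross3 x (p x)}
/-- the subspace `b_K P₁(ℝ³;ℝ³)`. -/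
def bubbleSpace (T : Tetra) : Submodule ℝ (Vec → Vec) :=
  Submodule.span ℝ {v | ∃ b r, T.IsBubble b ∧ VPolyDeg 1 r ∧ v = fun x => b x • r x}

lemma param_int {E : Type*} [NormedAddCommGroup E] [NormedSpace ℝ E] [FiniteDimensional ℝ E]
    [MeasurableSpace E] [BorelSpace E] (vol : Measure E) [vol.IsAddHaarMeasure]
    (A : E →L[ℝ] Vec) (hA : Function.Injective A) (x0 : Vec) (d : ℝ)
    (hd : d = Module.finrank ℝ E) :
    ∃ c : ℝ, 0 < c ∧ ∀ (S : Set E) (g : Vec → ℝ),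
      ∫ x in (fun y => x0 + A y) '' S, g x ∂μH[d] = c * ∫ y in S, g (x0 + A y) ∂vol := by
  subst hd
  have hd0 : (0 : ℝ) ≤ Module.finrank ℝ E := Nat.cast_nonneg _
  set Ψ : E → Vec := fun y => x0 + A y with hΨ
  have hcl : Topology.IsClosedEmbedding A := by
    have := LinearMap.isClosedEmbedding_of_injective (f := A.toLinearMap) (LinearMap.ker_eq_bot.2 hA)
    exact this
  have hme : MeasurableEmbedding Ψ :=
    ((Homeomorph.addLeft x0).isClosedEmbedding.comp hcl).measurableEmbedding
  obtain ⟨K, hK0, hK⟩ := A.toLinearMap.exists_antilipschitzWith (LinearMap.ker_eq_bot.2 hA)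
  set ν : Measure E := Measure.comap Ψ μH[Module.finrank ℝ E] with hν
  have hνap : ∀ s : Set E, ν s = μH[Module.finrank ℝ E] (Ψ '' s) := fun s => hme.comap_apply _ _
  have hanti : AntilipschitzWith K Ψ := by
    intro x y
    have := hK x y
    simpa [hΨ] using this
  have hlip : LipschitzWith ‖A‖₊ Ψ := by
    intro x y
    have := A.lipschitz x y
    simpa [hΨ] using this
  have hinv : ν.IsAddLeftInvariant := by
    refine ⟨fun z => ?_⟩
    ext s hs
    rw [Measure.map_apply (measurable_const_add z) hs, hνap, hνap]
    have : Ψ '' s = (fun w => A z + w) '' (Ψ '' ((fun y => z + y) ⁻¹' s)) := by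
      ext w
      simp only [Set.mem_image, Set.mem_preimage, hΨ]
      constructor
      · rintro ⟨y, hy, rfl⟩
        refine ⟨_, ⟨y - z, by simpa using hy, rfl⟩, ?_⟩
        simp [map_sub]; abel
      · rintro ⟨_, ⟨y, hy, rfl⟩, rfl⟩
        exact ⟨z + y, hy, by simp [map_add]; abel⟩
    rw [this, Set.image_add_left, measure_preimage_add]
  have hhaar : ν.IsAddHaarMeasure := by
    haveI := hinv
    refine Measure.isAddHaarMeasure_of_isCompact_nonempty_interior ν (Metric.closedBall (0:E) 1)
      (isCompact_closedBall _ _) ?_ ?_ ?_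
    · refine ⟨0, ?_⟩
      exact interior_mono Metric.ball_subset_closedBall
        (by rw [Metric.isOpen_ball.interior_eq]; simp)
    · rw [hνap]
      have h1 := hanti.le_hausdorffMeasure_image hd0 (Metric.closedBall (0:E) 1)
      have h2 : 0 < μH[Module.finrank ℝ E] (Metric.closedBall (0:E) 1) :=
        Metric.measure_closedBall_pos _ _ one_pos
      intro h3
      rw [h3, mul_zero] at h1
      exact absurd h1 (not_le.2 h2)
    · rw [hνap]
      have h1 := hlip.hausdorffMeasure_image_le hd0 (Metric.closedBall (0:E) 1)
      have h2 : μH[Module.finrank ℝ E] (Metric.closedBall (0:E) 1) < ⊤ :=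
        (isCompact_closedBall _ _).measure_lt_top
      refine ne_of_lt (lt_of_le_of_lt h1 (ENNReal.mul_lt_top ?_ h2))
      exact ENNReal.rpow_lt_top_of_nonneg hd0 ENNReal.coe_ne_top
  have heq := Measure.isAddLeftInvariant_eq_smul ν vol
  set c := Measure.addHaarScalarFactor ν vol with hc
  have hcpos : 0 < c := Measure.addHaarScalarFactor_pos_of_isAddHaarMeasure ν vol
  refine ⟨c, by exact_mod_cast hcpos, fun S g => ?_⟩
  have h1 : ∫ x in Ψ '' S, g x ∂μH[Module.finrank ℝ E] = ∫ y in S, g (Ψ y) ∂ν := by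
    have h2 := hme.setIntegral_map (μ := ν) g (Ψ '' S)
    rw [hν, hme.map_comap, Set.preimage_image_eq _ hme.injective] at h2
    rw [← h2, Measure.restrict_restrict_of_subset (Set.image_subset_range _ _)]
  rw [h1, heq, Measure.restrict_smul, integral_smul_nnreal_measure]
  rfl

def Tetra.bas (T : Tetra) : AffineBasis (Fin 4) ℝ Vec :=
  ⟨T.vtx, T.indep, by
    rw [T.indep.affineSpan_eq_top_iff_card_eq_finrank_add_one]; simp⟩

def Tetra.lam (T : Tetra) (a : Fin 4) : Vec → ℝ := T.bas.coord a
def Tetra.gl (T : Tetra) (a : Fin 4) : Vec := fun i => (T.bas.coord a).linear (Pi.single i 1)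

lemma Tetra.bas_apply (T : Tetra) (a : Fin 4) : T.bas a = T.vtx a := rfl

lemma Tetra.lam_vtx (T : Tetra) (a b : Fin 4) : T.lam a (T.vtx b) = if a = b then 1 else 0 := by
  rw [← T.bas_apply, Tetra.lam, AffineBasis.coord_apply]

lemma Tetra.sum_lam (T : Tetra) (x : Vec) : ∑ a, T.lam a x = 1 := T.bas.sum_coord_apply_eq_one x

lemma Tetra.sum_lam_smul (T : Tetra) (x : Vec) : ∑ a, T.lam a x • T.vtx a = x :=
  T.bas.linear_combination_coord_eq_self x

lemma Tetra.lin_eq (T : Tetra) (a : Fin 4) (y : Vec) :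
    (T.bas.coord a).linear y = dot3 (T.gl a) y := by
  have : y = ∑ i, y i • (Pi.single i (1:ℝ) : Vec) := by
    ext j; simp [Finset.sum_apply, Pi.single_apply]
  conv_lhs => rw [this]
  simp [dot3, Tetra.gl, mul_comm]

lemma Tetra.lam_add (T : Tetra) (a : Fin 4) (x y : Vec) :
    T.lam a (x + y) = T.lam a x + dot3 (T.gl a) y := by
  have := (T.bas.coord a).map_vadd x y
  rw [T.lin_eq] at this
  rw [Tetra.lam, add_comm x y, ← vadd_eq_add, this, vadd_eq_add, add_comm]

lemma dot3_smul (v : Vec) (c : ℝ) (w : Vec) : dot3 v (c • w) = c * dot3 v w := by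
  simp [dot3, Finset.mul_sum, mul_left_comm]
lemma dot3_add (v w z : Vec) : dot3 v (w + z) = dot3 v w + dot3 v z := by
  simp [dot3, mul_add, Finset.sum_add_distrib]
lemma dot3_sub (v w z : Vec) : dot3 v (w - z) = dot3 v w - dot3 v z := by
  simp [dot3, mul_sub, Finset.sum_sub_distrib]
lemma dot3_comm (v w : Vec) : dot3 v w = dot3 w v := by simp [dot3, mul_comm]

lemma Tetra.gl_sub (T : Tetra) (a : Fin 4) (x y : Vec) :
    dot3 (T.gl a) (x - y) = T.lam a x - T.lam a y := by
  have := T.lam_add a y (x - y)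
  rw [add_sub_cancel] at this
  linarith

lemma Tetra.lam_eq (T : Tetra) (a : Fin 4) (x : Vec) :
    T.lam a x = T.lam a 0 + dot3 (T.gl a) x := by
  simpa using T.lam_add a 0 x

lemma Tetra.mem_K (T : Tetra) (x : Vec) : x ∈ T.K ↔ ∀ a, 0 ≤ T.lam a x := by
  have := T.bas.convexHull_eq_nonneg_coord
  have h2 : T.K = {x | ∀ i, 0 ≤ T.bas.coord i x} := this
  rw [h2]; rfl

lemma Tetra.mem_interior (T : Tetra) (x : Vec) : x ∈ interior T.K ↔ ∀ a, 0 < T.lam a x := by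
  have := T.bas.interior_convexHull
  have h2 : interior T.K = {x | ∀ i, 0 < T.bas.coord i x} := this
  rw [h2]; rfl

lemma fin4_univ : ∀ a b c d : Fin 4, a ≠ b → a ≠ c → a ≠ d → b ≠ c → b ≠ d → c ≠ d →
    (Finset.univ : Finset (Fin 4)) = {a, b, c, d} := by decide

lemma fin4_sum {M : Type*} [AddCommMonoid M] (f : Fin 4 → M) (a b c d : Fin 4)
    (hab : a ≠ b) (hac : a ≠ c) (had : a ≠ d) (hbc : b ≠ c) (hbd : b ≠ d) (hcd : c ≠ d) :
    ∑ i, f i = f a + (f b + (f c + f d)) := by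
  rw [fin4_univ a b c d hab hac had hbc hbd hcd]
  rw [Finset.sum_insert (by simp [hab, hac, had]), Finset.sum_insert (by simp [hbc, hbd]),
    Finset.sum_insert (by simp [hcd]), Finset.sum_singleton]

lemma fin4_all (a b c d : Fin 4)
    (hab : a ≠ b) (hac : a ≠ c) (had : a ≠ d) (hbc : b ≠ c) (hbd : b ≠ d) (hcd : c ≠ d)
    (i : Fin 4) : i = a ∨ i = b ∨ i = c ∨ i = d := by
  have : i ∈ (Finset.univ : Finset (Fin 4)) := Finset.mem_univ _
  rw [fin4_univ a b c d hab hac had hbc hbd hcd] at this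
  simpa using this

lemma fin4_others : ∀ a b : Fin 4, a ≠ b → ∃ c d : Fin 4, a ≠ c ∧ a ≠ d ∧ b ≠ c ∧ b ≠ d ∧ c ≠ d := by
  decide

def T2 : Set (ℝ × ℝ) := {y | 0 ≤ y.1 ∧ 0 ≤ y.2 ∧ y.1 + y.2 ≤ 1}
def S3 : Set ((ℝ × ℝ) × ℝ) := {y | 0 ≤ y.1.1 ∧ 0 ≤ y.1.2 ∧ 0 ≤ y.2 ∧ y.1.1 + y.1.2 + y.2 ≤ 1}

lemma T2_closed : IsClosed T2 := by
  have : T2 = {y : ℝ × ℝ | 0 ≤ y.1} ∩ ({y | 0 ≤ y.2} ∩ {y | y.1 + y.2 ≤ 1}) := rfl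
  rw [this]
  apply IsClosed.inter (isClosed_le (by fun_prop) (by fun_prop))
  exact IsClosed.inter (isClosed_le (by fun_prop) (by fun_prop)) (isClosed_le (by fun_prop) (by fun_prop))
lemma S3_closed : IsClosed S3 := by
  have : S3 = {y : (ℝ × ℝ) × ℝ | 0 ≤ y.1.1} ∩ ({y | 0 ≤ y.1.2} ∩ ({y | 0 ≤ y.2} ∩ {y | y.1.1 + y.1.2 + y.2 ≤ 1})) := rfl
  rw [this]
  apply IsClosed.inter (isClosed_le (by fun_prop) (by fun_prop))
  apply IsClosed.inter (isClosed_le (by fun_prop) (by fun_prop))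
  exact IsClosed.inter (isClosed_le (by fun_prop) (by fun_prop)) (isClosed_le (by fun_prop) (by fun_prop))
lemma T2_compact : IsCompact T2 := by
  refine (isCompact_Icc.prod isCompact_Icc : IsCompact (Set.Icc (0:ℝ) 1 ×ˢ Set.Icc (0:ℝ) 1)).of_isClosed_subset T2_closed ?_
  rintro ⟨s, t⟩ ⟨h1, h2, h3⟩
  simp only at h1 h2 h3
  exact ⟨⟨h1, by simp only; linarith⟩, ⟨h2, by simp only; linarith⟩⟩
lemma S3_compact : IsCompact S3 := by
  refine ((isCompact_Icc.prod isCompact_Icc).prod isCompact_Icc : IsCompact ((Set.Icc (0:ℝ) 1 ×ˢ Set.Icc (0:ℝ) 1) ×ˢ Set.Icc (0:ℝ) 1)).of_isClosed_subset S3_closed ?_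
  rintro ⟨⟨s, t⟩, z⟩ ⟨h1, h2, h3, h4⟩
  simp only at h1 h2 h3 h4
  exact ⟨⟨⟨h1, by simp only; linarith⟩, ⟨h2, by simp only; linarith⟩⟩, ⟨h3, by simp only; linarith⟩⟩

def tau2 : ℝ := ∫ _ in T2, (1:ℝ)
def sig3 : ℝ := ∫ _ in S3, (1:ℝ)

lemma tau2_pos : 0 < tau2 := by
  simp only [tau2, integral_const, smul_eq_mul, mul_one, Measure.real, Measure.restrict_apply_univ]
  refine ENNReal.toReal_pos ?_ T2_compact.measure_lt_top.ne
  refine (Measure.measure_pos_of_nonempty_interior _ ⟨(1/4, 1/4), ?_⟩).ne'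
  refine mem_interior.2 ⟨Set.Ioo 0 (1/2) ×ˢ Set.Ioo 0 (1/2), ?_, isOpen_Ioo.prod isOpen_Ioo, ?_⟩
  · rintro ⟨s, t⟩ ⟨⟨h1, h2⟩, ⟨h3, h4⟩⟩
    simp only at h1 h2 h3 h4
    exact ⟨h1.le, h3.le, by simp only; linarith⟩
  · constructor <;> constructor <;> norm_num
lemma sig3_pos : 0 < sig3 := by
  simp only [sig3, integral_const, smul_eq_mul, mul_one, Measure.real, Measure.restrict_apply_univ]
  refine ENNReal.toReal_pos ?_ S3_compact.measure_lt_top.ne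
  refine (Measure.measure_pos_of_nonempty_interior _ ⟨((1/4, 1/4), 1/4), ?_⟩).ne'
  refine mem_interior.2 ⟨(Set.Ioo 0 (1/3) ×ˢ Set.Ioo 0 (1/3)) ×ˢ Set.Ioo 0 (1/3), ?_, (isOpen_Ioo.prod isOpen_Ioo).prod isOpen_Ioo, ?_⟩
  · rintro ⟨⟨s, t⟩, z⟩ ⟨⟨⟨h1, h2⟩, ⟨h3, h4⟩⟩, h5, h6⟩
    simp only at h1 h2 h3 h4 h5 h6
    exact ⟨h1.le, h3.le, h5.le, by simp only; linarith⟩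
  · refine ⟨⟨⟨?_, ?_⟩, ⟨?_, ?_⟩⟩, ⟨?_, ?_⟩⟩ <;> norm_num

/-- linear parts -/
def lin2 (e1 e2 : Vec) : ℝ × ℝ →L[ℝ] Vec :=
  (ContinuousLinearMap.fst ℝ ℝ ℝ).smulRight e1 + (ContinuousLinearMap.snd ℝ ℝ ℝ).smulRight e2
def lin3 (e1 e2 e3 : Vec) : (ℝ × ℝ) × ℝ →L[ℝ] Vec :=
  (lin2 e1 e2).comp (ContinuousLinearMap.fst ℝ (ℝ × ℝ) ℝ) +
    (ContinuousLinearMap.snd ℝ (ℝ × ℝ) ℝ).smulRight e3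
lemma lin2_apply (e1 e2 : Vec) (y : ℝ × ℝ) : lin2 e1 e2 y = y.1 • e1 + y.2 • e2 := rfl
lemma lin3_apply (e1 e2 e3 : Vec) (y : (ℝ × ℝ) × ℝ) :
    lin3 e1 e2 e3 y = y.1.1 • e1 + y.1.2 • e2 + y.2 • e3 := rfl

section four
variable (T : Tetra) (a b c d : Fin 4)
    (hab : a ≠ b) (hac : a ≠ c) (had : a ≠ d) (hbc : b ≠ c) (hbd : b ≠ d) (hcd : c ≠ d)

lemma lam_p3 (hab : a ≠ b) (hac : a ≠ c) (had : a ≠ d) (hbc : b ≠ c) (hbd : b ≠ d) (hcd : c ≠ d)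
    (y : (ℝ × ℝ) × ℝ) :
    let x := T.vtx b + lin3 (T.vtx c - T.vtx b) (T.vtx d - T.vtx b) (T.vtx a - T.vtx b) y
    T.lam a x = y.2 ∧ T.lam b x = 1 - y.1.1 - y.1.2 - y.2 ∧ T.lam c x = y.1.1 ∧ T.lam d x = y.1.2 := by
  intro x
  simp only [x, Tetra.lam_add, lin3_apply, dot3_add, dot3_smul, Tetra.gl_sub, Tetra.lam_vtx]
  simp [hab, hac, had, hbc, hbd, hcd, hab.symm, hac.symm, had.symm, hbc.symm, hbd.symm, hcd.symm]
  ring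

lemma eq_p3 (hab : a ≠ b) (hac : a ≠ c) (had : a ≠ d) (hbc : b ≠ c) (hbd : b ≠ d) (hcd : c ≠ d)
    (x : Vec) : x = T.vtx b + lin3 (T.vtx c - T.vtx b) (T.vtx d - T.vtx b) (T.vtx a - T.vtx b)
      ((T.lam c x, T.lam d x), T.lam a x) := by
  have h1 := T.sum_lam_smul x
  have h2 := T.sum_lam x
  rw [fin4_sum _ a b c d hab hac had hbc hbd hcd] at h1 h2
  have h3 : T.lam b x = 1 - T.lam a x - T.lam c x - T.lam d x := by linarith
  rw [lin3_apply]
  conv_lhs => rw [← h1, h3]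
  module

lemma K_p3 (hab : a ≠ b) (hac : a ≠ c) (had : a ≠ d) (hbc : b ≠ c) (hbd : b ≠ d) (hcd : c ≠ d) :
    T.K = (fun y => T.vtx b + lin3 (T.vtx c - T.vtx b) (T.vtx d - T.vtx b) (T.vtx a - T.vtx b) y) '' S3 := by
  ext x
  rw [T.mem_K]
  constructor
  · intro h
    refine ⟨_, ⟨h c, h d, h a, ?_⟩, (eq_p3 T a b c d hab hac had hbc hbd hcd x).symm⟩
    have h2 := T.sum_lam x
    rw [fin4_sum _ a b c d hab hac had hbc hbd hcd] at h2
    have := h b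
    simp only; linarith
  · rintro ⟨y, ⟨h1, h2, h3, h4⟩, rfl⟩ i
    obtain ⟨g1, g2, g3, g4⟩ := lam_p3 T a b c d hab hac had hbc hbd hcd y
    rcases fin4_all a b c d hab hac had hbc hbd hcd i with h | h | h | h <;> subst h
    · rw [g1]; exact h3
    · rw [g2]; linarith
    · rw [g3]; exact h1
    · rw [g4]; exact h2

lemma mem_face (x : Vec) : x ∈ T.face a ↔ x ∈ T.K ∧ T.lam a x = 0 := by
  constructor
  · intro h
    refine ⟨convexHull_mono (Set.image_subset_range _ _) h, ?_⟩
    have hc : Convex ℝ {x | T.lam a x = 0} :=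
      (convex_singleton (0:ℝ)).affine_preimage (T.bas.coord a)
    refine convexHull_min ?_ hc h
    rintro _ ⟨j, hj, rfl⟩
    simp only [Set.mem_ofPred_eq] at hj ⊢
    rw [T.lam_vtx, if_neg (Ne.symm hj)]
  · rintro ⟨h1, h2⟩
    rw [T.mem_K] at h1
    have h3 := T.sum_lam_smul x
    have h4 := T.sum_lam x
    rw [← h3]
    rw [← Finset.add_sum_erase _ _ (Finset.mem_univ a)] at h3 h4 ⊢
    simp only [h2, zero_smul, zero_add] at h3 h4 ⊢
    refine (convex_convexHull ℝ _).sum_mem (fun i _ => h1 i) h4 ?_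
    intro i hi
    exact subset_convexHull _ _ ⟨i, by simpa using hi, rfl⟩

lemma face_p2 (hab : a ≠ b) (hac : a ≠ c) (had : a ≠ d) (hbc : b ≠ c) (hbd : b ≠ d) (hcd : c ≠ d) :
    T.face a = (fun y => T.vtx b + lin2 (T.vtx c - T.vtx b) (T.vtx d - T.vtx b) y) '' T2 := by
  have h0 : ∀ y : ℝ × ℝ, T.vtx b + lin2 (T.vtx c - T.vtx b) (T.vtx d - T.vtx b) y =
      T.vtx b + lin3 (T.vtx c - T.vtx b) (T.vtx d - T.vtx b) (T.vtx a - T.vtx b) (y, 0) := by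
    intro y; simp [lin2_apply, lin3_apply]
  simp only [h0]
  ext x
  rw [mem_face, K_p3 T a b c d hab hac had hbc hbd hcd]
  constructor
  · rintro ⟨⟨y, ⟨h1, h2, h3, h4⟩, rfl⟩, h5⟩
    obtain ⟨g1, g2, g3, g4⟩ := lam_p3 T a b c d hab hac had hbc hbd hcd y
    rw [g1] at h5
    refine ⟨y.1, ⟨h1, h2, by linarith⟩, ?_⟩
    obtain ⟨y1, y2⟩ := y
    simp only at h5 ⊢
    rw [h5]
  · rintro ⟨y, ⟨h1, h2, h3⟩, rfl⟩
    obtain ⟨g1, g2, g3, g4⟩ := lam_p3 T a b c d hab hac had hbc hbd hcd (y, 0)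
    exact ⟨⟨(y, 0), ⟨h1, h2, le_rfl, by simpa using h3⟩, rfl⟩, g1⟩

lemma lin3_inj (hab : a ≠ b) (hac : a ≠ c) (had : a ≠ d) (hbc : b ≠ c) (hbd : b ≠ d) (hcd : c ≠ d) :
    Function.Injective (lin3 (T.vtx c - T.vtx b) (T.vtx d - T.vtx b) (T.vtx a - T.vtx b)) := by
  intro y z h
  obtain ⟨g1, g2, g3, g4⟩ := lam_p3 T a b c d hab hac had hbc hbd hcd y
  obtain ⟨k1, k2, k3, k4⟩ := lam_p3 T a b c d hab hac had hbc hbd hcd z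
  rw [h] at g1 g3 g4
  ext
  · rw [← g3, k3]
  · rw [← g4, k4]
  · rw [← g1, k1]

lemma lin2_inj (hab : a ≠ b) (hac : a ≠ c) (had : a ≠ d) (hbc : b ≠ c) (hbd : b ≠ d) (hcd : c ≠ d) :
    Function.Injective (lin2 (T.vtx c - T.vtx b) (T.vtx d - T.vtx b)) := by
  intro y z h
  have : ((y, 0) : (ℝ × ℝ) × ℝ) = (z, 0) := by
    apply lin3_inj T a b c d hab hac had hbc hbd hcd
    simp only [lin3_apply]
    simp only [lin2_apply] at h
    rw [h]
  exact congrArg Prod.fst this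

end four

def favg (F : Set Vec) (g : Vec → ℝ) : ℝ := (∫ x in F, g x ∂μH[2]) / (∫ _ in F, (1:ℝ) ∂μH[2])

lemma favg_p2 (T : Tetra) (a b c d : Fin 4)
    (hab : a ≠ b) (hac : a ≠ c) (had : a ≠ d) (hbc : b ≠ c) (hbd : b ≠ d) (hcd : c ≠ d)
    (g : Vec → ℝ) :
    favg (T.face a) g = (∫ y in T2, g (T.vtx b + lin2 (T.vtx c - T.vtx b) (T.vtx d - T.vtx b) y)) / tau2 := by
  obtain ⟨k, hk, h⟩ := param_int (volume : Measure (ℝ × ℝ)) _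
    (lin2_inj T a b c d hab hac had hbc hbd hcd) (T.vtx b) 2 (by simp)
  rw [favg, face_p2 T a b c d hab hac had hbc hbd hcd, h, h, mul_div_mul_left _ _ hk.ne']
  rfl

lemma K_int (T : Tetra) (a b c d : Fin 4)
    (hab : a ≠ b) (hac : a ≠ c) (had : a ≠ d) (hbc : b ≠ c) (hbd : b ≠ d) (hcd : c ≠ d)
    (g : Vec → ℝ) :
    ∫ x in T.K, g x = (∫ _ in T.K, (1:ℝ)) / sig3 * ∫ y in S3, g (T.vtx b + lin3 (T.vtx c - T.vtx b) (T.vtx d - T.vtx b) (T.vtx a - T.vtx b) y) := by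
  have : (volume : Measure ((ℝ × ℝ) × ℝ)).IsAddHaarMeasure :=
    inferInstanceAs ((volume : Measure (ℝ × ℝ)).prod (volume : Measure ℝ)).IsAddHaarMeasure
  obtain ⟨k, hk, h⟩ := param_int (volume : Measure ((ℝ × ℝ) × ℝ)) _
    (lin3_inj T a b c d hab hac had hbc hbd hcd) (T.vtx b) 3 (by simp)
  have h3 : (volume : Measure Vec) = μH[3] := by
    rw [← hausdorffMeasure_pi_real]; simp
  rw [h3, K_p3 T a b c d hab hac had hbc hbd hcd, h, h]
  have := sig3_pos.ne'
  unfold sig3 at this ⊢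
  field_simp

lemma cs_of_quad {A B C : ℝ} (h : ∀ t : ℝ, 0 ≤ A * (t * t) + 2 * B * t + C) : B ^ 2 ≤ A * C := by
  have := discrim_le_zero h
  unfold discrim at this
  nlinarith

lemma ci {X : Type*} [TopologicalSpace X] [T2Space X] [MeasurableSpace X] [BorelSpace X] {μ : Measure X}
    [IsFiniteMeasureOnCompacts μ] {K : Set X} (hK : IsCompact K) {g : X → ℝ} (hg : Continuous g) :
    IntegrableOn g K μ := hg.continuousOn.integrableOn_compact hK

lemma cs_int {X : Type*} [TopologicalSpace X] [T2Space X] [MeasurableSpace X] [BorelSpace X] {μ : Measure X}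
    [IsFiniteMeasureOnCompacts μ] {K : Set X} (hK : IsCompact K) {f g : X → ℝ}
    (hf : Continuous f) (hg : Continuous g) :
    (∫ x in K, f x * g x ∂μ) ^ 2 ≤ (∫ x in K, f x ^ 2 ∂μ) * ∫ x in K, g x ^ 2 ∂μ := by
  apply cs_of_quad
  intro t
  have : ∫ x in K, (t * f x + g x) ^ 2 ∂μ =
      (∫ x in K, f x ^ 2 ∂μ) * (t * t) + 2 * (∫ x in K, f x * g x ∂μ) * t + ∫ x in K, g x ^ 2 ∂μ := by
    have e : ∀ x, (t * f x + g x) ^ 2 = (t * t) * f x ^ 2 + (2 * t) * (f x * g x) + g x ^ 2 := by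
      intro x; ring
    simp only [e]
    rw [integral_add (ci hK (by fun_prop)) (ci hK (by fun_prop)),
      integral_add (ci hK (by fun_prop)) (ci hK (by fun_prop)), integral_const_mul, integral_const_mul]
    ring
  rw [← this]
  exact integral_nonneg (fun x => sq_nonneg _)

lemma swap_int {X Y : Type*} [TopologicalSpace X] [T2Space X] [SecondCountableTopology X]
    [MeasurableSpace X] [BorelSpace X] [TopologicalSpace Y] [T2Space Y] [SecondCountableTopology Y]
    [MeasurableSpace Y] [BorelSpace Y]
    {μ : Measure X} [IsFiniteMeasureOnCompacts μ] [SFinite μ]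
    {ν : Measure Y} [IsFiniteMeasureOnCompacts ν] [SFinite ν]
    {K : Set X} (hK : IsCompact K) {L : Set Y} (hL : IsCompact L) {F : X → Y → ℝ}
    (hF : Continuous (fun p : X × Y => F p.1 p.2)) :
    ∫ x in K, ∫ y in L, F x y ∂ν ∂μ = ∫ y in L, ∫ x in K, F x y ∂μ ∂ν := by
  apply integral_integral_swap
  have h1 : IsFiniteMeasure (μ.restrict K) := ⟨by simpa using hK.measure_lt_top⟩
  have h2 : IsFiniteMeasure (ν.restrict L) := ⟨by simpa using hL.measure_lt_top⟩
  obtain ⟨C, hC⟩ := (hK.prod hL).exists_bound_of_continuousOn hF.continuousOn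
  refine Integrable.of_bound (C := C) hF.aestronglyMeasurable ?_
  rw [Measure.prod_restrict]
  refine ae_restrict_of_forall_mem (hK.measurableSet.prod hL.measurableSet) ?_
  intro p hp
  exact hC p hp

lemma S3_fub (F : (ℝ × ℝ) × ℝ → ℝ) (hF : Continuous F) :
    ∫ y in S3, F y = ∫ y in T2, ∫ z in (0:ℝ)..(1 - y.1 - y.2), F (y, z) := by
  rw [← integral_indicator S3_closed.measurableSet, ← integral_indicator T2_closed.measurableSet]
  have hi : Integrable (S3.indicator F) (volume.prod volume) := by
    have : IntegrableOn F S3 := ci S3_compact hF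
    exact this.integrable_indicator S3_closed.measurableSet
  have e : (∫ y, S3.indicator F y) = ∫ y, S3.indicator F y ∂((volume : Measure (ℝ × ℝ)).prod volume) := rfl
  rw [e, integral_prod _ hi]
  congr 1
  ext y
  by_cases hy : y ∈ T2
  · rw [Set.indicator_of_mem hy]
    obtain ⟨h1, h2, h3⟩ := hy
    rw [intervalIntegral.integral_of_le (by linarith), ← integral_Icc_eq_integral_Ioc,
      ← integral_indicator measurableSet_Icc]
    congr 1
    ext z
    by_cases hz : z ∈ Set.Icc 0 (1 - y.1 - y.2)
    · rw [Set.indicator_of_mem hz, Set.indicator_of_mem]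
      exact ⟨h1, h2, hz.1, by have := hz.2; simp only; linarith⟩
    · rw [Set.indicator_of_notMem hz, Set.indicator_of_notMem]
      rintro ⟨-, -, h4, h5⟩
      exact hz ⟨h4, by simp only at h5; linarith⟩
  · rw [Set.indicator_of_notMem hy]
    rw [integral_eq_zero_of_ae]
    filter_upwards with z
    rw [Set.indicator_of_notMem]
    · rfl
    · rintro ⟨h1, h2, h3, h4⟩
      exact hy ⟨h1, h2, by simp only at h3 h4; linarith⟩

def vol (T : Tetra) : ℝ := ∫ _ in T.K, (1:ℝ)

lemma K_compact (T : Tetra) : IsCompact T.K := (Set.finite_range T.vtx).isCompact_convexHull ℝ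

lemma cent_int (T : Tetra) : (∑ a, (1/4:ℝ) • T.vtx a) ∈ interior T.K := by
  rw [T.mem_interior]
  intro a
  have h : (∑ b, (1/4:ℝ) • T.vtx b) = T.vtx a + ∑ b, (1/4:ℝ) • (T.vtx b - T.vtx a) := by
    simp only [Fin.sum_univ_four]
    module
  rw [h, T.lam_add, ← T.lin_eq, map_sum]
  simp only [T.lin_eq, dot3_smul, T.gl_sub, T.lam_vtx]
  simp [Finset.sum_sub_distrib, mul_sub]

lemma vol_pos (T : Tetra) : 0 < vol T := by
  simp only [vol, integral_const, smul_eq_mul, mul_one, Measure.real, Measure.restrict_apply_univ]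
  refine ENNReal.toReal_pos ?_ (K_compact T).measure_lt_top.ne
  exact (Measure.measure_pos_of_nonempty_interior _ ⟨_, cent_int T⟩).ne'

lemma base_ftc (T : Tetra) (a b : Fin 4) (g : Vec → ℝ) (hg : ContDiff ℝ 1 g) :
    ∫ x in T.K, fderiv ℝ g x (T.vtx a - T.vtx b) =
      vol T * (tau2 / sig3) * (favg (T.face b) g - favg (T.face a) g) := by
  by_cases hab : a = b
  · subst hab; simp
  obtain ⟨c, d, hac, had, hbc, hbd, hcd⟩ := fin4_others a b hab
  have hcont := hg.continuous
  have hfc : Continuous (fun x => fderiv ℝ g x) := hg.continuous_fderiv (by norm_num)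
  rw [K_int T a b c d hab hac had hbc hbd hcd, favg_p2 T a b c d hab hac had hbc hbd hcd,
    favg_p2 T b a c d (Ne.symm hab) hbc hbd hac had hcd, S3_fub _ (by fun_prop)]
  have key : ∀ y : ℝ × ℝ, ∫ z in (0:ℝ)..(1 - y.1 - y.2), fderiv ℝ g (T.vtx b + lin3 (T.vtx c - T.vtx b) (T.vtx d - T.vtx b) (T.vtx a - T.vtx b) (y, z)) (T.vtx a - T.vtx b)
      = g (T.vtx a + lin2 (T.vtx c - T.vtx a) (T.vtx d - T.vtx a) y)
        - g (T.vtx b + lin2 (T.vtx c - T.vtx b) (T.vtx d - T.vtx b) y) := by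
    intro y
    have hd : ∀ z : ℝ, HasDerivAt (fun z : ℝ => g (T.vtx b + lin3 (T.vtx c - T.vtx b) (T.vtx d - T.vtx b) (T.vtx a - T.vtx b) (y, z)))
        (fderiv ℝ g (T.vtx b + lin3 (T.vtx c - T.vtx b) (T.vtx d - T.vtx b) (T.vtx a - T.vtx b) (y, z)) (T.vtx a - T.vtx b)) z := by
      intro z
      have h1 := (hg.differentiable (by norm_num)
        (T.vtx b + lin3 (T.vtx c - T.vtx b) (T.vtx d - T.vtx b) (T.vtx a - T.vtx b) (y, z))).hasFDerivAt
      have h2 : HasDerivAt (fun z : ℝ => T.vtx b + lin3 (T.vtx c - T.vtx b) (T.vtx d - T.vtx b) (T.vtx a - T.vtx b) (y, z)) (T.vtx a - T.vtx b) z := by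
        simp only [lin3_apply]
        have := ((hasDerivAt_id z).smul_const (T.vtx a - T.vtx b)).const_add
          (T.vtx b + (y.1 • (T.vtx c - T.vtx b) + y.2 • (T.vtx d - T.vtx b)))
        simp only [one_smul, id] at this
        refine this.congr_of_eventuallyEq (Filter.Eventually.of_forall fun z => ?_)
        simp only; abel
      exact h1.comp_hasDerivAt z h2
    rw [intervalIntegral.integral_eq_sub_of_hasDerivAt (fun z _ => hd z)]
    · congr 2
      · simp only [lin3_apply, lin2_apply]; module
      · simp only [lin3_apply, lin2_apply]; module
    · apply Continuous.intervalIntegrable; fun_prop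
  simp only [key]
  rw [integral_sub (ci T2_compact (by fun_prop)) (ci T2_compact (by fun_prop))]
  have h1 := tau2_pos.ne'
  have h2 := sig3_pos.ne'
  unfold vol
  field_simp

lemma fin4_three (a : Fin 4) : ∃ b c d : Fin 4, a ≠ b ∧ a ≠ c ∧ a ≠ d ∧ b ≠ c ∧ b ≠ d ∧ c ≠ d := by
  revert a; decide

lemma favg_rep (T : Tetra) (a : Fin 4) : ∃ Ψ : ℝ × ℝ → Vec, Continuous Ψ ∧
    (∀ y ∈ T2, Ψ y ∈ T.face a) ∧ ∀ g : Vec → ℝ, favg (T.face a) g = (∫ y in T2, g (Ψ y)) / tau2 := by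
  obtain ⟨b, c, d, hab, hac, had, hbc, hbd, hcd⟩ := fin4_three a
  refine ⟨fun y => T.vtx b + lin2 (T.vtx c - T.vtx b) (T.vtx d - T.vtx b) y, by fun_prop, ?_,
    favg_p2 T a b c d hab hac had hbc hbd hcd⟩
  intro y hy
  rw [face_p2 T a b c d hab hac had hbc hbd hcd]
  exact ⟨y, hy, rfl⟩

lemma favg_congr (T : Tetra) (a : Fin 4) {f g : Vec → ℝ} (h : ∀ x ∈ T.face a, f x = g x) :
    favg (T.face a) f = favg (T.face a) g := by
  obtain ⟨Ψ, h1, h2, h3⟩ := favg_rep T a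
  rw [h3, h3]
  congr 1
  exact setIntegral_congr_fun T2_closed.measurableSet (fun y hy => h _ (h2 y hy))

lemma favg_const (T : Tetra) (a : Fin 4) (c : ℝ) : favg (T.face a) (fun _ => c) = c := by
  obtain ⟨Ψ, h1, h2, h3⟩ := favg_rep T a
  have e : ∫ _ in T2, c = c * tau2 := by
    unfold tau2
    rw [← integral_const_mul]; simp
  rw [h3, e]
  field_simp [tau2_pos.ne']

lemma favg_add (T : Tetra) (a : Fin 4) {f g : Vec → ℝ} (hf : Continuous f) (hg : Continuous g) :
    favg (T.face a) (fun x => f x + g x) = favg (T.face a) f + favg (T.face a) g := by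
  obtain ⟨Ψ, h1, h2, h3⟩ := favg_rep T a
  rw [h3, h3, h3, integral_add (ci T2_compact (by fun_prop)) (ci T2_compact (by fun_prop)), add_div]

lemma favg_sub (T : Tetra) (a : Fin 4) {f g : Vec → ℝ} (hf : Continuous f) (hg : Continuous g) :
    favg (T.face a) (fun x => f x - g x) = favg (T.face a) f - favg (T.face a) g := by
  obtain ⟨Ψ, h1, h2, h3⟩ := favg_rep T a
  rw [h3, h3, h3, integral_sub (ci T2_compact (by fun_prop)) (ci T2_compact (by fun_prop)), sub_div]

lemma favg_mul (T : Tetra) (a : Fin 4) (c : ℝ) (f : Vec → ℝ) :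
    favg (T.face a) (fun x => c * f x) = c * favg (T.face a) f := by
  obtain ⟨Ψ, h1, h2, h3⟩ := favg_rep T a
  rw [h3, h3, integral_const_mul, mul_div_assoc]

lemma favg_sum {ι : Type*} (T : Tetra) (a : Fin 4) (s : Finset ι) {f : ι → Vec → ℝ}
    (hf : ∀ i, Continuous (f i)) :
    favg (T.face a) (fun x => ∑ i ∈ s, f i x) = ∑ i ∈ s, favg (T.face a) (f i) := by
  obtain ⟨Ψ, h1, h2, h3⟩ := favg_rep T a
  simp only [h3]
  rw [integral_finsetSum, Finset.sum_div]
  intro i _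
  have := hf i
  exact ci T2_compact (by fun_prop)

lemma favg_nonneg (T : Tetra) (a : Fin 4) {f : Vec → ℝ} (hf : ∀ x, 0 ≤ f x) :
    0 ≤ favg (T.face a) f := by
  obtain ⟨Ψ, h1, h2, h3⟩ := favg_rep T a
  rw [h3]
  exact div_nonneg (integral_nonneg (fun y => hf _)) tau2_pos.le

lemma favg_cs (T : Tetra) (a : Fin 4) {f g : Vec → ℝ} (hf : Continuous f) (hg : Continuous g) :
    (favg (T.face a) (fun x => f x * g x)) ^ 2 ≤
      favg (T.face a) (fun x => f x ^ 2) * favg (T.face a) (fun x => g x ^ 2) := by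
  obtain ⟨Ψ, h1, h2, h3⟩ := favg_rep T a
  rw [h3, h3, h3, div_pow, div_mul_div_comm, ← sq]
  have := cs_int (μ := volume) T2_compact (hf.comp h1) (hg.comp h1)
  simp only [Function.comp] at this
  gcongr

lemma favg_var (T : Tetra) (a : Fin 4) {f : Vec → ℝ} (hf : Continuous f) (c : ℝ) :
    favg (T.face a) (fun x => (f x - favg (T.face a) f) ^ 2) ≤ favg (T.face a) (fun x => (f x - c) ^ 2) := by
  have key : ∀ c : ℝ, favg (T.face a) (fun x => (f x - c) ^ 2) =
      favg (T.face a) (fun x => f x ^ 2) - 2 * c * favg (T.face a) f + c ^ 2 := by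
    intro c
    have e : (fun x => (f x - c) ^ 2) = fun x => (f x ^ 2 - (2 * c) * f x) + c ^ 2 := by
      ext x; ring
    rw [e, favg_add T a (by fun_prop) (by fun_prop), favg_sub T a (by fun_prop) (by fun_prop),
      favg_mul, favg_const]
  rw [key, key]
  nlinarith [sq_nonneg (favg (T.face a) f - c)]

lemma lam_contDiff (T : Tetra) (a : Fin 4) : ContDiff ℝ (⊤ : ℕ∞) (T.lam a) := by
  have : T.lam a = fun x => T.lam a 0 + dot3 (T.gl a) x := by ext x; exact T.lam_eq a x
  rw [this]; unfold dot3; fun_prop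

lemma lam_hasFDeriv (T : Tetra) (a : Fin 4) (x y : Vec) :
    fderiv ℝ (T.lam a) x y = dot3 (T.gl a) y := by
  have h : T.lam a = fun x => T.lam a 0 + (T.bas.coord a).linear.toContinuousLinearMap x := by
    ext x; rw [T.lam_eq a x, LinearMap.coe_toContinuousLinearMap', T.lin_eq]
  have h2 : HasFDerivAt (T.lam a) ((T.bas.coord a).linear.toContinuousLinearMap) x := by
    rw [h]; exact (ContinuousLinearMap.hasFDerivAt _).const_add _
  rw [h2.fderiv, LinearMap.coe_toContinuousLinearMap', T.lin_eq]

lemma cone0 (T : Tetra) (a : Fin 4) (g : Vec → ℝ) (hg : ContDiff ℝ 1 g) :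
    ∫ x in T.K, (3 * g x + fderiv ℝ g x (x - T.vtx a)) =
      vol T * (tau2 / sig3) * favg (T.face a) g := by
  have hgc := hg.continuous
  have hfc : Continuous (fun x => fderiv ℝ g x) := hg.continuous_fderiv (by norm_num)
  have hl : ∀ b, Continuous (T.lam b) := fun b => (lam_contDiff T b).continuous
  have hl1 : ∀ b, ContDiff ℝ 1 (T.lam b) := fun b => (lam_contDiff T b).of_le (by norm_cast)
  have hbf : ∀ b, ∫ x in T.K, fderiv ℝ (fun x => T.lam b x * g x) x (T.vtx b - T.vtx a) =
      vol T * (tau2 / sig3) * (if b = a then 0 else favg (T.face a) (fun x => T.lam b x * g x)) := by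
    intro b
    rw [base_ftc T b a _ ((hl1 b).mul hg)]
    split_ifs with h
    · subst h; simp
    · congr 1
      have : favg (T.face b) (fun x => T.lam b x * g x) = favg (T.face b) (fun x => 0) := by
        apply favg_congr
        intro x hx
        rw [((mem_face T b x).1 hx).2, zero_mul]
      rw [this, favg_const, sub_zero]
  have hfd : ∀ b x y, fderiv ℝ (fun x => T.lam b x * g x) x y =
      T.lam b x * fderiv ℝ g x y + g x * dot3 (T.gl b) y := by
    intro b x y
    rw [fderiv_fun_mul ((hl1 b).differentiable (by norm_num) x) (hg.differentiable (by norm_num) x)]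
    simp [lam_hasFDeriv]
  have hs : ∀ x, 3 * g x + fderiv ℝ g x (x - T.vtx a) =
      ∑ b, fderiv ℝ (fun x => T.lam b x * g x) x (T.vtx b - T.vtx a) := by
    intro x
    simp only [hfd, Finset.sum_add_distrib, T.gl_sub, T.lam_vtx]
    have e1 : x - T.vtx a = ∑ b, T.lam b x • (T.vtx b - T.vtx a) := by
      simp only [smul_sub, Finset.sum_sub_distrib, T.sum_lam_smul, ← Finset.sum_smul, T.sum_lam, one_smul]
    conv_lhs => rw [e1, map_sum]
    simp only [map_smul, smul_eq_mul]
    rw [add_comm, ← Finset.mul_sum, Finset.sum_sub_distrib]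
    simp
    ring
  simp only [hs]
  rw [integral_finsetSum]
  · simp only [hbf, ← Finset.mul_sum]
    congr 1
    have : ∀ b, (if b = a then 0 else favg (T.face a) (fun x => T.lam b x * g x)) =
        favg (T.face a) (fun x => T.lam b x * g x) := by
      intro b
      split_ifs with h
      · subst h
        have : favg (T.face b) (fun x => T.lam b x * g x) = favg (T.face b) (fun x => 0) := by
          apply favg_congr
          intro x hx
          rw [((mem_face T b x).1 hx).2, zero_mul]
        rw [this, favg_const]
      · rfl
    simp only [this]
    rw [← favg_sum T a _ (f := fun b x => T.lam b x * g x) (fun b => (hl b).mul hgc)]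
    apply favg_congr
    intro x _
    rw [← Finset.sum_mul, T.sum_lam, one_mul]
  · intro b _
    simp only [hfd]
    have := hl b
    exact ci (K_compact T) (by fun_prop)

lemma tau_sig (T : Tetra) : tau2 / sig3 = 3 := by
  have := cone0 T 0 (fun _ => 1) contDiff_const
  rw [favg_const] at this
  simp only [fderiv_fun_const, Pi.zero_apply, ContinuousLinearMap.zero_apply, add_zero] at this
  rw [integral_const_mul] at this
  have hv := vol_pos T
  unfold vol at *
  have h2 : (∫ _ in T.K, (1:ℝ)) * (tau2 / sig3 - 3) = 0 := by linarith
  rcases mul_eq_zero.1 h2 with h | h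
  · exact absurd h hv.ne'
  · linarith

lemma cone (T : Tetra) (a : Fin 4) (g : Vec → ℝ) (hg : ContDiff ℝ 1 g) :
    3 * vol T * favg (T.face a) g = ∫ x in T.K, (3 * g x + fderiv ℝ g x (x - T.vtx a)) := by
  rw [cone0 T a g hg, tau_sig T]; ring

/-- scaled inward normals -/
def nu (T : Tetra) (a : Fin 4) : Vec := fun i => 3 * vol T * T.gl a i

lemma gl_sum (T : Tetra) (i : Fin 3) : ∑ b, T.gl b i = 0 := by
  have h1 := T.sum_lam 0
  have h2 := T.sum_lam (Pi.single i 1)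
  have h3 : ∀ b, T.lam b (Pi.single i 1) = T.lam b 0 + T.gl b i := by
    intro b; rw [T.lam_eq b]; simp [dot3, Pi.single_apply]
  simp only [h3, Finset.sum_add_distrib] at h2
  linarith

lemma gl_sum_smul (T : Tetra) (i : Fin 3) : ∑ b, T.gl b i • T.vtx b = Pi.single i 1 := by
  have h1 := T.sum_lam_smul 0
  have h2 := T.sum_lam_smul (Pi.single i 1)
  have h3 : ∀ b, T.lam b (Pi.single i 1) = T.lam b 0 + T.gl b i := by
    intro b; rw [T.lam_eq b]; simp [dot3, Pi.single_apply]
  simp only [h3, add_smul, Finset.sum_add_distrib] at h2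
  rw [h1, zero_add] at h2
  exact h2

lemma div_thm (T : Tetra) (i : Fin 3) (g : Vec → ℝ) (hg : ContDiff ℝ 1 g) :
    ∫ x in T.K, pd i g x = - ∑ a, nu T a i * favg (T.face a) g := by
  have hfc : Continuous (fun x => fderiv ℝ g x) := hg.continuous_fderiv (by norm_num)
  have e : ∀ x, pd i g x = ∑ b, T.gl b i * fderiv ℝ g x (T.vtx b - T.vtx 0) := by
    intro x
    have : (Pi.single i 1 : Vec) = ∑ b, T.gl b i • (T.vtx b - T.vtx 0) := by
      simp only [smul_sub, Finset.sum_sub_distrib, gl_sum_smul, ← Finset.sum_smul, gl_sum]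
      simp
    rw [pd, this, map_sum]
    simp
  simp only [e]
  rw [integral_finsetSum]
  · simp only [integral_const_mul, base_ftc T _ _ g hg, tau_sig T]
    have : ∀ b, T.gl b i * (vol T * 3 * (favg (T.face 0) g - favg (T.face b) g)) =
        vol T * 3 * favg (T.face 0) g * T.gl b i - nu T b i * favg (T.face b) g := by
      intro b; simp only [nu]; ring
    simp only [this, Finset.sum_sub_distrib, ← Finset.mul_sum, gl_sum]
    ring
  · intro b _
    exact ci (K_compact T) (by fun_prop)

lemma fd_eq (g : Vec → ℝ) (x y : Vec) : fderiv ℝ g x y = ∑ i, y i * pd i g x := by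
  have : y = ∑ i, y i • (Pi.single i (1:ℝ) : Vec) := by
    ext j; simp [Finset.sum_apply, Pi.single_apply]
  conv_lhs => rw [this, map_sum]
  simp [pd]

lemma fd_sq (g : Vec → ℝ) (x y : Vec) : (fderiv ℝ g x y) ^ 2 ≤ 3 * ‖y‖ ^ 2 * nsq3 (grad3 g x) := by
  rw [fd_eq]
  have h := Finset.sum_mul_sq_le_sq_mul_sq Finset.univ (fun i => y i) (fun i => pd i g x)
  refine h.trans ?_
  have h1 : ∑ i, y i ^ 2 ≤ 3 * ‖y‖ ^ 2 := by
    have : ∀ i, y i ^ 2 ≤ ‖y‖ ^ 2 := fun i => by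
      rw [← sq_abs]; have := norm_le_pi_norm y i; rw [Real.norm_eq_abs] at this
      gcongr
    calc ∑ i, y i ^ 2 ≤ ∑ _i : Fin 3, ‖y‖ ^ 2 := Finset.sum_le_sum fun i _ => this i
      _ = _ := by simp
  have h2 : nsq3 (grad3 g x) = ∑ i, pd i g x ^ 2 := by simp [nsq3, dot3, grad3, sq]
  rw [h2]
  have : 0 ≤ ∑ i, pd i g x ^ 2 := Finset.sum_nonneg fun i _ => sq_nonneg _
  gcongr

lemma nsq3_nonneg (v : Vec) : 0 ≤ nsq3 v := by
  unfold nsq3 dot3; exact Finset.sum_nonneg fun i _ => mul_self_nonneg _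

lemma pd_cont {g : Vec → ℝ} (hg : ContDiff ℝ 1 g) (i : Fin 3) : Continuous (pd i g) := by
  have hfc : Continuous (fun x => fderiv ℝ g x) := hg.continuous_fderiv (by norm_num)
  unfold pd; fun_prop

lemma q_cont {g : Vec → ℝ} (hg : ContDiff ℝ 1 g) : Continuous (fun x => nsq3 (grad3 g x)) := by
  have := pd_cont hg
  unfold nsq3 dot3 grad3
  exact continuous_finsetSum _ fun i _ => (this i).mul (this i)

lemma K_convex (T : Tetra) : Convex ℝ T.K := convex_convexHull _ _

lemma scale_int (T : Tetra) {q : Vec → ℝ} (hq : Continuous q) (h0 : ∀ x, 0 ≤ q x) {y : Vec}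
    (hy : y ∈ T.K) {θ : ℝ} (h1 : 0 ≤ θ) (h2 : θ ≤ 1/2) :
    ∫ x in T.K, q (x + θ • (y - x)) ≤ 8 * ∫ x in T.K, q x := by
  have hK := (K_compact T).measurableSet
  have hi : Integrable (T.K.indicator q) := (ci (μ := volume) (K_compact T) hq).integrable_indicator hK
  have e : ∫ x, T.K.indicator q ((1 - θ) • x + θ • y) = ((1 - θ) ^ 3)⁻¹ * ∫ x in T.K, q x := by
    have := Measure.integral_comp_smul (volume : Measure Vec) (fun z => T.K.indicator q (z + θ • y)) (1 - θ)
    rw [this, integral_add_right_eq_self, integral_indicator hK]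
    simp only [Module.finrank_fintype_fun_eq_card, Fintype.card_fin, smul_eq_mul]
    rw [abs_of_nonneg (inv_nonneg.2 (pow_nonneg (by linarith) _))]
  have hB : 0 ≤ ∫ x in T.K, q x := integral_nonneg fun x => h0 x
  have h3 : ((1 - θ) ^ 3)⁻¹ ≤ 8 := by
    rw [inv_le_comm₀ (by have : 0 < 1 - θ := by linarith
                         positivity) (by norm_num)]
    have : (1/2 : ℝ) ^ 3 ≤ (1 - θ) ^ 3 := by gcongr; linarith
    norm_num at this ⊢; linarith
  calc ∫ x in T.K, q (x + θ • (y - x)) = ∫ x, T.K.indicator (fun x => q (x + θ • (y - x))) x :=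
        (integral_indicator hK).symm
    _ ≤ ∫ x, T.K.indicator q ((1 - θ) • x + θ • y) := by
        apply integral_mono
        · exact (ci (μ := volume) (K_compact T) (by fun_prop)).integrable_indicator hK
        · exact (hi.comp_add_right (θ • y)).comp_smul (R := 1 - θ) (by intro h; linarith)
        · intro x
          by_cases hx : x ∈ T.K
          · have e1 : x + θ • (y - x) = (1 - θ) • x + θ • y := by module
            have : (1 - θ) • x + θ • y ∈ T.K := K_convex T hx hy (by linarith) h1 (by ring)
            simp only [Set.indicator_of_mem hx, Set.indicator_of_mem this, e1]
            exact le_rfl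
          · simp only [Set.indicator_of_notMem hx]
            exact Set.indicator_nonneg (fun _ _ => h0 _) _
    _ = _ := e
    _ ≤ _ := by gcongr

lemma half_bound (T : Tetra) {g : Vec → ℝ} (hg : ContDiff ℝ 1 g) {y : Vec} (hy : y ∈ T.K) :
    ∫ x in T.K, (g x - g (x + (1/2:ℝ) • (y - x))) ^ 2 ≤
      6 * Metric.diam T.K ^ 2 * ∫ x in T.K, nsq3 (grad3 g x) := by
  set h := Metric.diam T.K
  set q := fun x => nsq3 (grad3 g x) with hqdef
  have hq := q_cont hg
  have hgc := hg.continuous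
  have hfc : Continuous (fun x => fderiv ℝ g x) := hg.continuous_fderiv (by norm_num)
  have pt : ∀ x ∈ T.K, (g x - g (x + (1/2:ℝ) • (y - x))) ^ 2 ≤
      (3 / 4 * h ^ 2) * ∫ t in Set.Icc (0:ℝ) 1, q (x + (t/2) • (y - x)) := by
    intro x hx
    have hd : ∀ t : ℝ, HasDerivAt (fun t : ℝ => g (x + (t/2) • (y - x)))
        (fderiv ℝ g (x + (t/2) • (y - x)) ((1/2:ℝ) • (y - x))) t := by
      intro t
      have h1 := (hg.differentiable (by norm_num) (x + (t/2) • (y - x))).hasFDerivAt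
      have h2 : HasDerivAt (fun t : ℝ => x + (t/2) • (y - x)) ((1/2:ℝ) • (y - x)) t :=
        (((hasDerivAt_id t).div_const 2).smul_const (y - x)).const_add x
      exact h1.comp_hasDerivAt t h2
    have hint := intervalIntegral.integral_eq_sub_of_hasDerivAt (a := 0) (b := 1) (fun t _ => hd t)
      (by apply Continuous.intervalIntegrable; fun_prop)
    rw [intervalIntegral.integral_of_le (by norm_num), ← integral_Icc_eq_integral_Ioc] at hint
    simp only [zero_div, zero_smul, add_zero] at hint
    have cs := cs_int (μ := volume) (K := Set.Icc (0:ℝ) 1) isCompact_Icc (f := fun _ => 1)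
      (g := fun t => fderiv ℝ g (x + (t/2) • (y - x)) ((1/2:ℝ) • (y - x))) (by fun_prop) (by fun_prop)
    simp only [one_mul, hint] at cs
    have e1 : ∫ _ in Set.Icc (0:ℝ) 1, (1:ℝ) ^ 2 = 1 := by simp
    rw [e1, one_mul] at cs
    calc _ = (g (x + (1/2:ℝ) • (y - x)) - g x) ^ 2 := by ring
      _ ≤ _ := cs
      _ ≤ ∫ t in Set.Icc (0:ℝ) 1, (3 / 4 * h ^ 2) * q (x + (t/2) • (y - x)) := by
        apply integral_mono
        · exact ci isCompact_Icc (by fun_prop)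
        · exact ci isCompact_Icc (by fun_prop)
        · intro t
          refine (fd_sq g _ _).trans ?_
          have hn : ‖(1/2:ℝ) • (y - x)‖ ≤ 1/2 * h := by
            rw [norm_smul]
            have : ‖y - x‖ ≤ h := by
              rw [← dist_eq_norm]
              exact Metric.dist_le_diam_of_mem (K_compact T).isBounded hy hx
            norm_num; linarith
          have : 3 * ‖(1/2:ℝ) • (y - x)‖ ^ 2 ≤ 3 / 4 * h ^ 2 := by
            have := pow_le_pow_left₀ (norm_nonneg _) hn 2
            nlinarith
          exact mul_le_mul_of_nonneg_right this (nsq3_nonneg _)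
      _ = _ := integral_const_mul _ _
  have hc2 : Continuous (fun p : Vec × ℝ => q (p.1 + (p.2/2) • (y - p.1))) := by fun_prop
  have hsw := swap_int (μ := volume) (ν := volume) (K_compact T) (isCompact_Icc (a := (0:ℝ)) (b := 1))
    (F := fun x t => q (x + (t/2) • (y - x))) hc2
  have hB : 0 ≤ ∫ x in T.K, q x := integral_nonneg fun x => nsq3_nonneg _
  have hcx : Continuous (fun x => ∫ t in Set.Icc (0:ℝ) 1, q (x + (t/2) • (y - x))) :=
    continuous_parametric_integral_of_continuous (f := fun x t => q (x + (t/2) • (y - x))) hc2 isCompact_Icc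
  have hct : Continuous (fun t : ℝ => ∫ x in T.K, q (x + (t/2) • (y - x))) := by
    refine continuous_parametric_integral_of_continuous (f := fun (t:ℝ) x => q (x + (t/2) • (y - x))) ?_ (K_compact T)
    fun_prop
  calc _ ≤ ∫ x in T.K, (3 / 4 * h ^ 2) * ∫ t in Set.Icc (0:ℝ) 1, q (x + (t/2) • (y - x)) := by
        apply setIntegral_mono_on (ci (K_compact T) (by fun_prop)) (ci (K_compact T) (by fun_prop))
          (K_compact T).measurableSet pt
    _ = (3 / 4 * h ^ 2) * ∫ t in Set.Icc (0:ℝ) 1, ∫ x in T.K, q (x + (t/2) • (y - x)) := by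
        rw [integral_const_mul, hsw]
    _ ≤ (3 / 4 * h ^ 2) * ∫ t in Set.Icc (0:ℝ) 1, 8 * ∫ x in T.K, q x := by
        refine mul_le_mul_of_nonneg_left ?_ (by positivity)
        apply setIntegral_mono_on (ci isCompact_Icc hct) (ci isCompact_Icc (by fun_prop)) measurableSet_Icc
        intro t ht
        exact scale_int T hq (fun x => nsq3_nonneg _) hy (by linarith [ht.1]) (by linarith [ht.2])
    _ = _ := by simp; ring

def kavg (T : Tetra) (g : Vec → ℝ) : ℝ := (∫ x in T.K, g x) / vol T

lemma kvar (T : Tetra) {g : Vec → ℝ} (hg : Continuous g) (c : ℝ) :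
    ∫ x in T.K, (g x - c) ^ 2 = (∫ x in T.K, g x ^ 2) - 2 * c * (∫ x in T.K, g x) + c ^ 2 * vol T := by
  have e : (fun x => (g x - c) ^ 2) = fun x => (g x ^ 2 - (2 * c) * g x) + c ^ 2 * 1 := by
    ext x; ring
  rw [e, integral_add (ci (K_compact T) (by fun_prop)) (ci (K_compact T) (by fun_prop)),
    integral_sub (ci (K_compact T) (by fun_prop)) (ci (K_compact T) (by fun_prop)),
    integral_const_mul, integral_const_mul, vol]

lemma kvar_avg (T : Tetra) {g : Vec → ℝ} (hg : Continuous g) :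
    ∫ x in T.K, (g x - kavg T g) ^ 2 ≤ ∫ x in T.K, g x ^ 2 := by
  rw [kvar T hg]
  have : (∫ x in T.K, g x) = kavg T g * vol T := by
    unfold kavg; field_simp [(vol_pos T).ne']
  rw [this]
  nlinarith [mul_nonneg (sq_nonneg (kavg T g)) (vol_pos T).le]

lemma poincare (T : Tetra) {g : Vec → ℝ} (hg : ContDiff ℝ 1 g) :
    ∫ x in T.K, (g x - kavg T g) ^ 2 ≤ 12 * Metric.diam T.K ^ 2 * ∫ x in T.K, nsq3 (grad3 g x) := by
  have hgc := hg.continuous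
  have hK := K_compact T
  set B := 6 * Metric.diam T.K ^ 2 * ∫ x in T.K, nsq3 (grad3 g x) with hB
  have c1 : Continuous (fun p : Vec × Vec => (g p.1 - g (p.1 + (1/2:ℝ) • (p.2 - p.1))) ^ 2) := by fun_prop
  have i1 : ∫ y in T.K, ∫ x in T.K, (g x - g (x + (1/2:ℝ) • (y - x))) ^ 2 ≤ B * vol T := by
    have e : B * vol T = ∫ y in T.K, B * 1 := by rw [integral_const_mul]; rfl
    rw [e]
    refine setIntegral_mono_on (ci hK ?_) (ci hK (by fun_prop)) hK.measurableSet
      (fun y hy => by rw [mul_one]; exact half_bound T hg hy)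
    refine continuous_parametric_integral_of_continuous
      (f := fun y x => (g x - g (x + (1/2:ℝ) • (y - x))) ^ 2) ?_ hK
    fun_prop
  have i2 : ∫ y in T.K, ∫ x in T.K, (g y - g (x + (1/2:ℝ) • (y - x))) ^ 2 ≤ B * vol T := by
    have e : ∫ y in T.K, ∫ x in T.K, (g y - g (x + (1/2:ℝ) • (y - x))) ^ 2 =
       ∫ x in T.K, ∫ y in T.K, (g y - g (x + (1/2:ℝ) • (y - x))) ^ 2 :=
      swap_int (μ := volume) (ν := volume) hK hK (by fun_prop)
    rw [e]
    have e4 : ∀ x y : Vec, x + (1/2:ℝ) • (y - x) = y + (1/2:ℝ) • (x - y) := by intro x y; module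
    have e5 : ∀ x : Vec, ∫ y in T.K, (g y - g (x + (1/2:ℝ) • (y - x))) ^ 2 =
        ∫ y in T.K, (g y - g (y + (1/2:ℝ) • (x - y))) ^ 2 := by
      intro x
      refine integral_congr_ae (Filter.Eventually.of_forall fun y => ?_)
      simp only
      rw [e4 x y]
    rw [integral_congr_ae (Filter.Eventually.of_forall e5)]
    exact i1
  have m : ∫ y in T.K, ∫ x in T.K, (g x - g y) ^ 2 ≤ 2 * (B * vol T) + 2 * (B * vol T) := by
    have p1 : Continuous fun y => ∫ x in T.K, (g x - g (x + (1/2:ℝ) • (y - x))) ^ 2 :=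
      continuous_parametric_integral_of_continuous
        (f := fun y x => (g x - g (x + (1/2:ℝ) • (y - x))) ^ 2) (by fun_prop) hK
    have p2 : Continuous fun y => ∫ x in T.K, (g y - g (x + (1/2:ℝ) • (y - x))) ^ 2 :=
      continuous_parametric_integral_of_continuous
        (f := fun y x => (g y - g (x + (1/2:ℝ) • (y - x))) ^ 2) (by fun_prop) hK
    have p3 : Continuous fun y => ∫ x in T.K, (g x - g y) ^ 2 :=
      continuous_parametric_integral_of_continuous
        (f := fun y x => (g x - g y) ^ 2) (by fun_prop) hK
    calc _ ≤ ∫ y in T.K, (2 * (∫ x in T.K, (g x - g (x + (1/2:ℝ) • (y - x))) ^ 2) +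
            2 * ∫ x in T.K, (g y - g (x + (1/2:ℝ) • (y - x))) ^ 2) := by
          refine integral_mono (ci hK p3) (ci hK (by fun_prop)) ?_
          intro y
          simp only
          rw [← integral_const_mul, ← integral_const_mul, ← integral_add (ci hK (by fun_prop)) (ci hK (by fun_prop))]
          refine integral_mono (ci hK (by fun_prop)) (ci hK (by fun_prop)) ?_
          intro x
          simp only
          nlinarith [sq_nonneg (g x + g y - 2 * g (x + (1/2:ℝ) • (y - x)))]
      _ ≤ _ := by
          rw [integral_add (ci hK (by fun_prop)) (ci hK (by fun_prop)), integral_const_mul, integral_const_mul]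
          gcongr
  have e2 : ∫ y in T.K, ∫ x in T.K, (g x - g y) ^ 2 = 2 * vol T * ∫ x in T.K, (g x - kavg T g) ^ 2 := by
    simp only [kvar T hgc]
    rw [integral_add (ci hK (by fun_prop)) (ci hK (by fun_prop)),
      integral_sub (ci hK (by fun_prop)) (ci hK (by fun_prop)), integral_mul_const, integral_mul_const,
      integral_const_mul]
    have e3 : ∫ _ in T.K, (∫ x in T.K, g x ^ 2) = (∫ x in T.K, g x ^ 2) * vol T := by
      unfold vol; rw [← integral_const_mul, mul_one]
    have : (∫ x in T.K, g x) = kavg T g * vol T := by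
      unfold kavg; field_simp [(vol_pos T).ne']
    rw [e3, this]
    ring
  rw [e2] at m
  have hv := vol_pos T
  have : vol T * (∫ x in T.K, (g x - kavg T g) ^ 2) ≤ vol T * (2 * B) := by linarith
  have := le_of_mul_le_mul_left this hv
  rw [hB] at this; linarith

lemma trace_sq (T : Tetra) (a : Fin 4) {g : Vec → ℝ} (hg : ContDiff ℝ 1 g) :
    3 * vol T * favg (T.face a) (fun x => g x ^ 2) ≤ 3 * (∫ x in T.K, g x ^ 2) +
      4 * Metric.diam T.K * Real.sqrt (∫ x in T.K, g x ^ 2) * Real.sqrt (∫ x in T.K, nsq3 (grad3 g x)) := by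
  have hgc := hg.continuous
  have hfc : Continuous (fun x => fderiv ℝ g x) := hg.continuous_fderiv (by norm_num)
  have hK := K_compact T
  have hq := q_cont hg
  rw [cone T a (fun x => g x ^ 2) (hg.pow 2)]
  have fd : ∀ x y, fderiv ℝ (fun x => g x ^ 2) x y = 2 * (g x * fderiv ℝ g x y) := by
    intro x y
    rw [fderiv_fun_pow 2 (hg.differentiable (by norm_num) x)]
    simp; ring
  simp only [fd]
  rw [integral_add (ci hK (by fun_prop)) (ci hK (by fun_prop)), integral_const_mul, integral_const_mul]
  have cs := cs_int (μ := volume) hK (f := g) (g := fun x => fderiv ℝ g x (x - T.vtx a)) hgc (by fun_prop)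
  set A := ∫ x in T.K, g x ^ 2
  set B := ∫ x in T.K, nsq3 (grad3 g x)
  have hA : 0 ≤ A := integral_nonneg fun x => sq_nonneg _
  have hB : 0 ≤ B := integral_nonneg fun x => nsq3_nonneg _
  set h := Metric.diam T.K
  have hh : 0 ≤ h := Metric.diam_nonneg
  have b2 : ∫ x in T.K, (fderiv ℝ g x (x - T.vtx a)) ^ 2 ≤ 3 * h ^ 2 * B := by
    rw [← integral_const_mul]
    refine setIntegral_mono_on (ci hK (by fun_prop)) (ci hK (by fun_prop)) hK.measurableSet ?_
    intro x hx
    refine (fd_sq g _ _).trans ?_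
    have : ‖x - T.vtx a‖ ≤ h := by
      rw [← dist_eq_norm]
      exact Metric.dist_le_diam_of_mem hK.isBounded hx (subset_convexHull _ _ ⟨a, rfl⟩)
    have h0 := nsq3_nonneg (grad3 g x)
    gcongr
  have b3 : (∫ x in T.K, g x * fderiv ℝ g x (x - T.vtx a)) ^ 2 ≤ (2 * h * Real.sqrt A * Real.sqrt B) ^ 2 := by
    have : (2 * h * Real.sqrt A * Real.sqrt B) ^ 2 = 4 * h ^ 2 * A * B := by
      rw [mul_pow, mul_pow, Real.sq_sqrt hA, Real.sq_sqrt hB]; ring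
    rw [this]
    refine cs.trans ?_
    have := mul_le_mul_of_nonneg_left b2 hA
    nlinarith [mul_nonneg (mul_nonneg hA hB) (sq_nonneg h)]
  have := abs_le_of_sq_le_sq' b3 (by positivity)
  linarith [this.2]

lemma diam_pos (T : Tetra) : 0 < Metric.diam T.K := by
  have h : T.vtx 0 ≠ T.vtx 1 := fun h => by
    have := T.indep.injective h; exact absurd this (by decide)
  refine (dist_pos.2 h).trans_le (Metric.dist_le_diam_of_mem (K_compact T).isBounded ?_ ?_)
  · exact subset_convexHull _ _ ⟨0, rfl⟩
  · exact subset_convexHull _ _ ⟨1, rfl⟩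

lemma gl_bound (T : Tetra) {ρ : ℝ} (hρ : 0 < ρ) {x : Vec}
    (hx : Metric.ball x (ρ * Metric.diam T.K) ⊆ T.K) (a : Fin 4) (i : Fin 3) :
    |T.gl a i| ≤ (ρ * Metric.diam T.K)⁻¹ := by
  set r := ρ * Metric.diam T.K
  have hr : 0 < r := mul_pos hρ (diam_pos T)
  have hl : ∀ y ∈ T.K, 0 ≤ T.lam a y ∧ T.lam a y ≤ 1 := by
    intro y hy
    have h0 := (T.mem_K y).1 hy
    refine ⟨h0 a, ?_⟩
    rw [← T.sum_lam y]
    exact Finset.single_le_sum (fun b _ => h0 b) (Finset.mem_univ a)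
  have hp : ∀ s : ℝ, |s| < r → x + s • (Pi.single i 1 : Vec) ∈ T.K := by
    intro s hs
    apply hx
    rw [Metric.mem_ball, dist_eq_norm, add_sub_cancel_left, norm_smul]
    have : ‖(Pi.single i 1 : Vec)‖ = 1 := by rw [Pi.norm_single]; simp
    rw [this, mul_one]; exact hs
  have e : ∀ s : ℝ, T.lam a (x + s • (Pi.single i 1 : Vec)) = T.lam a x + s * T.gl a i := by
    intro s; rw [T.lam_add, dot3_smul]; simp [dot3, Pi.single_apply]
  have h1 := hl _ (hp (r/2) (by rw [abs_of_pos (by linarith)]; linarith))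
  have h2 := hl _ (hp (-(r/2)) (by rw [abs_neg, abs_of_pos (by linarith)]; linarith))
  rw [e] at h1 h2
  rw [inv_eq_one_div, le_div_iff₀ hr, ← abs_of_pos hr, ← abs_mul, abs_le]
  constructor <;> nlinarith

lemma tr1 (T : Tetra) (a : Fin 4) {g : Vec → ℝ} (hg : ContDiff ℝ 1 g) :
    3 * vol T * favg (T.face a) (fun x => (g x - kavg T g) ^ 2) ≤
      52 * Metric.diam T.K ^ 2 * (∫ x in T.K, nsq3 (grad3 g x)) ∧
    3 * vol T * favg (T.face a) (fun x => (g x - kavg T g) ^ 2) ≤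
      16 * Metric.diam T.K * (Real.sqrt (∫ x in T.K, g x ^ 2) * Real.sqrt (∫ x in T.K, nsq3 (grad3 g x))) := by
  have h1 := trace_sq T a (g := fun x => g x - kavg T g) (hg.sub contDiff_const)
  have eg : ∀ x, grad3 (fun x => g x - kavg T g) x = grad3 g x := by
    intro x; ext i; simp only [grad3, pd, fderiv_sub_const]
  simp only [eg] at h1
  have h2 := poincare T hg
  have h3 := kvar_avg T hg.continuous
  set A := ∫ x in T.K, (g x - kavg T g) ^ 2
  set B := ∫ x in T.K, nsq3 (grad3 g x)
  set L := ∫ x in T.K, g x ^ 2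
  set h := Metric.diam T.K
  have hA : 0 ≤ A := integral_nonneg fun x => sq_nonneg _
  have hB : 0 ≤ B := integral_nonneg fun x => nsq3_nonneg _
  have hh : 0 ≤ h := Metric.diam_nonneg
  have sA : Real.sqrt A ≤ 4 * h * Real.sqrt B := by
    rw [Real.sqrt_le_left (by positivity), mul_pow, Real.sq_sqrt hB]
    nlinarith [mul_nonneg (sq_nonneg h) hB]
  have sA2 : Real.sqrt A ≤ Real.sqrt L := Real.sqrt_le_sqrt h3
  have qA := Real.mul_self_sqrt hA
  have qB := Real.mul_self_sqrt hB
  have s0 := Real.sqrt_nonneg A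
  have s1 := Real.sqrt_nonneg B
  constructor
  · refine h1.trans ?_
    have : h * Real.sqrt B * Real.sqrt A ≤ h * Real.sqrt B * (4 * h * Real.sqrt B) :=
      mul_le_mul_of_nonneg_left sA (by positivity)
    have e : h * Real.sqrt B * (4 * h * Real.sqrt B) = 4 * h ^ 2 * B := by linear_combination 4 * h ^ 2 * qB
    nlinarith
  · refine h1.trans ?_
    have t1 : Real.sqrt A * (3 * Real.sqrt A + 4 * h * Real.sqrt B) ≤
        Real.sqrt L * (16 * h * Real.sqrt B) := by
      apply mul_le_mul sA2 (by linarith) (by positivity) (Real.sqrt_nonneg _)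
    nlinarith

lemma loc_bound (T : Tetra) {ρ : ℝ} (hρ : 0 < ρ) {x : Vec}
    (hx : Metric.ball x (ρ * Metric.diam T.K) ⊆ T.K) (a : Fin 4) (i : Fin 3) {j w : Vec → ℝ}
    (hj : ContDiff ℝ 1 j) (hw : ContDiff ℝ 1 w) :
    |nu T a i * favg (T.face a) (fun x => (j x - kavg T j) * (w x - favg (T.face a) w))| ≤
      64 / ρ * Real.sqrt (∫ x in T.K, nsq3 (grad3 w x)) *
        min (Metric.diam T.K * Real.sqrt (∫ x in T.K, nsq3 (grad3 j x)))
          (Real.sqrt (Metric.diam T.K * (Real.sqrt (∫ x in T.K, j x ^ 2) * Real.sqrt (∫ x in T.K, nsq3 (grad3 j x))))) := by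
  have hv := vol_pos T
  have hd := diam_pos T
  have cs := favg_cs T a (f := fun x => j x - kavg T j) (g := fun x => w x - favg (T.face a) w)
    (hj.continuous.sub continuous_const) (hw.continuous.sub continuous_const)
  have h1 := tr1 T a hj
  have h2 := (tr1 T a hw).1
  have h3 := favg_var T a hw.continuous (kavg T w)
  have hg := gl_bound T hρ hx a i
  set h := Metric.diam T.K
  set P := favg (T.face a) (fun x => (j x - kavg T j) * (w x - favg (T.face a) w))
  set Q := favg (T.face a) (fun x => (j x - kavg T j) ^ 2)
  set R := favg (T.face a) (fun x => (w x - favg (T.face a) w) ^ 2)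
  set B := ∫ x in T.K, nsq3 (grad3 j x)
  set W := ∫ x in T.K, nsq3 (grad3 w x)
  set L := ∫ x in T.K, j x ^ 2
  have hB : 0 ≤ B := integral_nonneg fun x => nsq3_nonneg _
  have hW : 0 ≤ W := integral_nonneg fun x => nsq3_nonneg _
  have hQ : 0 ≤ Q := favg_nonneg T a fun x => sq_nonneg _
  have hR : 0 ≤ R := favg_nonneg T a fun x => sq_nonneg _
  have h4 : 3 * vol T * R ≤ 52 * h ^ 2 * W :=
    (mul_le_mul_of_nonneg_left h3 (by positivity)).trans h2
  set m := min (h * Real.sqrt B) (Real.sqrt (h * (Real.sqrt L * Real.sqrt B))) with hm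
  have m0 : 0 ≤ m := le_min (by positivity) (Real.sqrt_nonneg _)
  have hQm : 3 * vol T * Q ≤ 64 * m ^ 2 := by
    rcases min_choice (h * Real.sqrt B) (Real.sqrt (h * (Real.sqrt L * Real.sqrt B))) with e | e
    · rw [hm, e, mul_pow, Real.sq_sqrt hB]
      nlinarith [h1.1, mul_nonneg (sq_nonneg h) hB]
    · rw [hm, e, Real.sq_sqrt (by positivity)]
      have : 0 ≤ h * (Real.sqrt L * Real.sqrt B) := by positivity
      nlinarith [h1.2]
  apply abs_le_of_sq_le_sq _ (by positivity)
  have en : nu T a i = 3 * vol T * T.gl a i := rfl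
  have g2 : T.gl a i ^ 2 ≤ (ρ * h)⁻¹ ^ 2 := by
    rw [← sq_abs]; exact pow_le_pow_left₀ (abs_nonneg _) hg 2
  calc (nu T a i * P) ^ 2 = T.gl a i ^ 2 * ((3 * vol T) ^ 2 * P ^ 2) := by rw [en]; ring
    _ ≤ (ρ * h)⁻¹ ^ 2 * ((3 * vol T * Q) * (3 * vol T * R)) := by
      apply mul_le_mul g2 _ (by positivity) (by positivity)
      nlinarith [mul_le_mul_of_nonneg_left cs (sq_nonneg (3 * vol T))]
    _ ≤ (ρ * h)⁻¹ ^ 2 * ((64 * m ^ 2) * (64 * h ^ 2 * W)) := by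
      apply mul_le_mul_of_nonneg_left _ (by positivity)
      apply mul_le_mul hQm _ (by positivity) (by positivity)
      nlinarith [mul_nonneg (sq_nonneg h) hW]
    _ = (64 / ρ * Real.sqrt W * m) ^ 2 := by
      rw [mul_pow, mul_pow, Real.sq_sqrt hW]; field_simp

def Shr (T S : Tetra) (a b : Fin 4) : Prop := T.vtx '' {c | c ≠ a} = S.vtx '' {c | c ≠ b}

lemma Shr.symm {T S : Tetra} {a b : Fin 4} (h : Shr T S a b) : Shr S T b a := Eq.symm h
lemma Shr.trans {T S R : Tetra} {a b c : Fin 4} (h : Shr T S a b) (h2 : Shr S R b c) : Shr T R a c :=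
  Eq.trans h h2
lemma Shr.face {T S : Tetra} {a b : Fin 4} (h : Shr T S a b) : T.face a = S.face b := by
  unfold Tetra.face; rw [h]
lemma Shr.vtx {T S : Tetra} {a b : Fin 4} (h : Shr T S a b) {c : Fin 4} (hc : c ≠ a) :
    ∃ d, d ≠ b ∧ S.vtx d = T.vtx c := by
  have : T.vtx c ∈ S.vtx '' {c | c ≠ b} := by rw [← h]; exact ⟨c, hc, rfl⟩
  exact this

/-- affine combination -/
lemma lam_comb (S T : Tetra) (b : Fin 4) (x : Vec) :
    S.lam b x = ∑ c, T.lam c x * S.lam b (T.vtx c) := by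
  have h : x = ∑ c, T.lam c x • T.vtx c := (T.sum_lam_smul x).symm
  have h2 : S.lam b x = S.lam b 0 + ∑ c, T.lam c x * dot3 (S.gl b) (T.vtx c) := by
    rw [S.lam_eq b x]
    conv_lhs => rw [h, ← S.lin_eq, map_sum]
    simp only [S.lin_eq, dot3_smul]
  rw [h2]
  have h3 : ∀ c, S.lam b (T.vtx c) = S.lam b 0 + dot3 (S.gl b) (T.vtx c) := fun c => S.lam_eq b _
  simp only [h3, mul_add, Finset.sum_add_distrib, ← Finset.sum_mul, T.sum_lam, one_mul]

lemma Shr.lam {T S : Tetra} {a b : Fin 4} (h : Shr T S a b) (x : Vec) :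
    S.lam b x = S.lam b (T.vtx a) * T.lam a x := by
  rw [lam_comb S T b x, Finset.sum_eq_single a]
  · ring
  · intro c _ hc
    obtain ⟨d, hd, e⟩ := h.vtx hc
    rw [← e, S.lam_vtx, if_neg (Ne.symm hd), mul_zero]
  · simp

lemma Shr.gl {T S : Tetra} {a b : Fin 4} (h : Shr T S a b) (i : Fin 3) :
    S.gl b i = S.lam b (T.vtx a) * T.gl a i := by
  have h1 := h.lam (Pi.single i 1)
  have h2 := h.lam 0
  have e : ∀ (T : Tetra) b, T.lam b (Pi.single i 1) = T.lam b 0 + T.gl b i := by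
    intro T b; rw [T.lam_eq b]; simp [dot3, Pi.single_apply]
  rw [e, e] at h1
  linarith

lemma lam_cont (T : Tetra) (a : Fin 4) : Continuous (T.lam a) := (lam_contDiff T a).continuous

/-- face barycenter -/
def fcent (T : Tetra) (a : Fin 4) : Vec := ∑ c, (if c = a then (0:ℝ) else 1/3) • T.vtx c

lemma lam_of_comb (T : Tetra) (w : Fin 4 → ℝ) (hw : ∑ c, w c = 1) (b : Fin 4) :
    T.lam b (∑ c, w c • T.vtx c) = w b := by
  have : T.lam b (∑ c, w c • T.vtx c) = T.lam b 0 + ∑ c, w c * dot3 (T.gl b) (T.vtx c) := by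
    rw [T.lam_eq b, ← T.lin_eq, map_sum]
    simp only [T.lin_eq, dot3_smul]
  rw [this]
  have h3 : ∀ c, dot3 (T.gl b) (T.vtx c) = (if b = c then 1 else 0) - T.lam b 0 := fun c => by
    rw [← T.lam_vtx, T.lam_eq b (T.vtx c)]; ring
  simp only [h3, mul_sub, Finset.sum_sub_distrib, ← Finset.sum_mul, hw]
  simp

lemma lam_fcent (T : Tetra) (a b : Fin 4) : T.lam b (fcent T a) = if b = a then 0 else 1/3 := by
  unfold fcent
  rw [lam_of_comb]
  rw [Fin.sum_univ_four]
  fin_cases a <;> simp <;> norm_num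

lemma Shr.neg {T S : Tetra} {a b : Fin 4} (h : Shr T S a b) (hd : interior T.K ∩ interior S.K = ∅) :
    S.lam b (T.vtx a) < 0 := by
  by_contra hk
  push Not at hk
  have hk0 : S.lam b (T.vtx a) ≠ 0 := by
    intro h0
    have := h.lam (S.vtx b)
    rw [h0, zero_mul, S.lam_vtx, if_pos rfl] at this
    exact one_ne_zero this
  have hk1 : 0 < S.lam b (T.vtx a) := lt_of_le_of_ne hk (Ne.symm hk0)
  -- positivity of S.lam at fcent T
  have hpos : ∀ c, c ≠ b → 0 < S.lam c (fcent T a) := by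
    intro c hc
    obtain ⟨d, hda, e⟩ := h.symm.vtx hc
    rw [lam_comb S T c]
    have hnn : ∀ d', 0 ≤ T.lam d' (fcent T a) * S.lam c (T.vtx d') := by
      intro d'
      by_cases hd' : d' = a
      · rw [lam_fcent, if_pos hd', zero_mul]
      · obtain ⟨c', _, e'⟩ := h.vtx hd'
        rw [lam_fcent, if_neg hd', ← e', S.lam_vtx]
        split_ifs <;> norm_num
    refine lt_of_lt_of_le ?_ (Finset.single_le_sum (fun d' _ => hnn d') (Finset.mem_univ d))
    rw [lam_fcent, if_neg hda, e, S.lam_vtx, if_pos rfl]; norm_num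
  have hline : ∀ (R : Tetra) (c : Fin 4) (t : ℝ), R.lam c (fcent T a + t • (T.vtx a - fcent T a)) =
      (1 - t) * R.lam c (fcent T a) + t * R.lam c (T.vtx a) := by
    intro R c t
    rw [R.lam_add, dot3_smul, R.gl_sub]; ring
  have hev : ∀ c, ∀ᶠ t : ℝ in nhdsWithin 0 (Set.Ioi 0), 0 < S.lam c (fcent T a + t • (T.vtx a - fcent T a)) := by
    intro c
    by_cases hc : c = b
    · subst hc
      filter_upwards [self_mem_nhdsWithin] with t ht
      rw [hline, h.lam (fcent T a), lam_fcent, if_pos rfl, mul_zero, mul_zero, zero_add]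
      exact mul_pos ht hk1
    · apply Filter.Eventually.filter_mono nhdsWithin_le_nhds
      have hcont : Continuous (fun t : ℝ => S.lam c (fcent T a + t • (T.vtx a - fcent T a))) := by
        have := lam_cont S c; fun_prop
      apply hcont.continuousAt.eventually
      simp only [zero_smul, add_zero]
      exact lt_mem_nhds (hpos c hc)
  have hev2 := Filter.eventually_all.2 hev
  have hev3 : ∀ᶠ t : ℝ in nhdsWithin 0 (Set.Ioi 0), t < 1 :=
    Filter.Eventually.filter_mono nhdsWithin_le_nhds (gt_mem_nhds one_pos)
  obtain ⟨t, h1, h2, h3⟩ := (hev2.and (hev3.and self_mem_nhdsWithin)).exists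
  have : fcent T a + t • (T.vtx a - fcent T a) ∈ interior T.K ∩ interior S.K := by
    refine ⟨(T.mem_interior _).2 fun c => ?_, (S.mem_interior _).2 h1⟩
    rw [hline, lam_fcent, T.lam_vtx]
    have h3' : 0 < t := h3
    split_ifs with g1
    · simpa using h3'
    · linarith
  rw [hd] at this
  exact this

lemma Shr.vol {T S : Tetra} {a b : Fin 4} (h : Shr T S a b) :
    vol T = |S.lam b (T.vtx a)| * vol S := by
  set d := T.vtx a - S.vtx b with hdd
  let Mx : Matrix (Fin 3) (Fin 3) ℝ := fun i j => (if i = j then 1 else 0) + d i * S.gl b j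
  let L : Vec →ₗ[ℝ] Vec := Matrix.toLin' Mx
  have hL : ∀ y, L y = y + dot3 (S.gl b) y • d := by
    intro y; ext i
    have e0 : L y = Mx.mulVec y := Matrix.toLin'_apply Mx y
    rw [e0]
    simp only [Mx, Matrix.mulVec, dotProduct, dot3, Fin.sum_univ_three, Pi.add_apply,
      Pi.smul_apply, smul_eq_mul]
    fin_cases i <;> simp <;> ring
  have hdet : LinearMap.det L = S.lam b (T.vtx a) := by
    have e1 : dot3 (S.gl b) d = S.lam b (T.vtx a) - 1 := by
      rw [hdd, S.gl_sub, S.lam_vtx, if_pos rfl]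
    rw [LinearMap.det_toLin']
    have : S.lam b (T.vtx a) = 1 + dot3 (S.gl b) d := by rw [e1]; ring
    rw [this, Matrix.det_fin_three]
    simp [Mx, dot3, Fin.sum_univ_three]
    ring
  let Φ : Vec →ᵃ[ℝ] Vec := L.toAffineMap + AffineMap.const ℝ Vec (S.lam b 0 • d)
  have hΦ : ∀ y, Φ y = y + S.lam b y • d := by
    intro y
    have : Φ y = L y + S.lam b 0 • d := rfl
    rw [this, hL, S.lam_eq b y]; module
  have himg : T.K = Φ '' S.K := by
    unfold Tetra.K
    rw [AffineMap.image_convexHull]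
    congr 1
    ext x
    constructor
    · rintro ⟨c, rfl⟩
      by_cases hc : c = a
      · subst hc
        refine ⟨S.vtx b, ⟨b, rfl⟩, ?_⟩
        rw [hΦ, S.lam_vtx, if_pos rfl, one_smul, hdd]; abel
      · obtain ⟨e, he, e2⟩ := h.vtx hc
        refine ⟨S.vtx e, ⟨e, rfl⟩, ?_⟩
        rw [hΦ, S.lam_vtx, if_neg (Ne.symm he), zero_smul, add_zero, e2]
    · rintro ⟨_, ⟨c, rfl⟩, rfl⟩
      by_cases hc : c = b
      · subst hc
        refine ⟨a, ?_⟩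
        rw [hΦ, S.lam_vtx, if_pos rfl, one_smul, hdd]; abel
      · obtain ⟨e, he, e2⟩ := h.symm.vtx hc
        refine ⟨e, ?_⟩
        rw [hΦ, S.lam_vtx, if_neg (Ne.symm hc), zero_smul, add_zero, e2]
  have himg2 : T.K = (fun y => y + S.lam b 0 • d) '' (L '' S.K) := by
    rw [himg, Set.image_image]; rfl
  have hv : volume T.K = ENNReal.ofReal |S.lam b (T.vtx a)| * volume S.K := by
    rw [himg2, Set.image_add_right, measure_preimage_add_right, Measure.addHaar_image_linearMap, hdet]
  unfold _root_.vol
  simp only [integral_const, smul_eq_mul, mul_one, Measure.real, Measure.restrict_apply_univ]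
  rw [hv, ENNReal.toReal_mul, ENNReal.toReal_ofReal (abs_nonneg _)]

lemma Shr.nu {T S : Tetra} {a b : Fin 4} (h : Shr T S a b) (hd : interior T.K ∩ interior S.K = ∅)
    (i : Fin 3) : nu S b i = - nu T a i := by
  unfold _root_.nu
  rw [h.gl i, h.vol, abs_of_neg (h.neg hd)]; ring

lemma Shr.unique {T S R : Tetra} {a b c : Fin 4} (h1 : Shr T S a b) (h2 : Shr T R a c)
    (hd1 : interior T.K ∩ interior S.K = ∅) (hd2 : interior T.K ∩ interior R.K = ∅)
    (hd3 : interior S.K ∩ interior R.K = ∅) : False := by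
  have n1 := h1.neg hd1
  have n2 := h2.neg hd2
  have h3 := h1.symm.trans h2
  have n3 := h3.neg hd3
  have e1 := h1.lam (T.vtx a)
  have e2 := h3.lam (T.vtx a)
  nlinarith [mul_pos_of_neg_of_neg n1 n3]

lemma Shr.same {T S : Tetra} {a b c : Fin 4} (h1 : Shr T S a b) (h2 : Shr T S a c) : b = c := by
  by_contra hbc
  have := h1.symm.trans h2
  have : S.vtx c ∈ S.vtx '' {d | d ≠ c} := by rw [← this]; exact ⟨c, Ne.symm hbc, rfl⟩
  obtain ⟨d, hd, e⟩ := this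
  exact hd (S.indep.injective e)

lemma K_union_closed (M : Mesh) (s : Finset (Fin M.n)) : IsClosed (⋃ j ∈ s, (M.el j).K) :=
  s.finite_toSet.isClosed_biUnion fun j _ => (K_compact _).isClosed

lemma ne_ncard (a : Fin 4) : ({c | c ≠ a} : Set (Fin 4)).ncard = 3 := by
  have : ({c | c ≠ a} : Set (Fin 4)) = {a}ᶜ := by ext; simp
  rw [this, Set.ncard_compl]; simp

lemma face_cases (M : Mesh) (Ω : Set Vec) (hc : M.Covers Ω) (i : Fin M.n) (a : Fin 4) :
    (∃ j b, j ≠ i ∧ Shr (M.el i) (M.el j) a b) ∨ (M.el i).face a ⊆ frontier Ω := by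
  set T := M.el i with hT
  by_cases hA : ∃ x, (∀ c, c ≠ a → 0 < T.lam c x) ∧ T.lam a x = 0 ∧ ∃ j, j ≠ i ∧ x ∈ (M.el j).K
  · left
    obtain ⟨x, h1, h2, j, hj, hxj⟩ := hA
    obtain ⟨s, e, hse, hint⟩ := M.conform i j (Ne.symm hj)
    have hxi : x ∈ T.K := (T.mem_K x).2 fun c => by
      by_cases hc : c = a
      · rw [hc, h2]
      · exact (h1 c hc).le
    have hx : x ∈ convexHull ℝ (T.vtx '' s) := by rw [← hint]; exact ⟨hxi, hxj⟩
    have hcs : ∀ c, c ≠ a → c ∈ s := by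
      intro c hca
      by_contra hcs
      have : convexHull ℝ (T.vtx '' s) ⊆ {y | T.lam c y = 0} := by
        apply convexHull_min
        · rintro _ ⟨d, hd, rfl⟩
          show T.lam c (T.vtx d) = 0
          rw [T.lam_vtx, if_neg]; rintro rfl; exact hcs hd
        · intro y hy z hz p q _ _ hpq
          have hy' : T.lam c y = 0 := hy
          have hz' : T.lam c z = 0 := hz
          show T.lam c (p • y + q • z) = 0
          have : p • y + q • z = y + q • (z - y) := by
            have : p = 1 - q := by linarith
            rw [this]; module
          rw [this, T.lam_add, dot3_smul, T.gl_sub, hy', hz']; ring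
      have h3 : T.lam c x = 0 := this hx
      exact absurd h3 (h1 c hca).ne'
    have has : a ∉ s := by
      intro has
      have hs : s = Set.univ := by
        ext c; simp only [Set.mem_univ, iff_true]
        by_cases hc : c = a
        · rw [hc]; exact has
        · exact hcs c hc
      have hsub : T.K ⊆ (M.el j).K := by
        have : T.K = T.K ∩ (M.el j).K := by
          rw [hint, hs, Set.image_univ]; rfl
        rw [this]; exact Set.inter_subset_right
      have := M.disj i j (Ne.symm hj)
      have hm : (∑ a, (1/4:ℝ) • T.vtx a) ∈ interior T.K ∩ interior (M.el j).K :=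
        ⟨cent_int T, interior_mono hsub (cent_int T)⟩
      rw [this] at hm; exact hm
    have hs : s = {c | c ≠ a} := by
      ext c; exact ⟨fun h hca => has (hca ▸ h), hcs c⟩
    have hcard : e.ncard = 3 := by
      have h3 : s.ncard = 3 := by
        rw [hs, ne_ncard]
      have h4 := Set.ncard_image_of_injective s T.indep.injective
      have h5 := Set.ncard_image_of_injective e (M.el j).indep.injective
      rw [← h5, ← hse, h4, h3]
    have hex : ∃ b, b ∉ e := by
      by_contra hall; push Not at hall
      have : e = Set.univ := Set.eq_univ_of_forall hall
      rw [this, Set.ncard_univ] at hcard; simp at hcard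
    obtain ⟨b, hb⟩ := hex
    refine ⟨j, b, hj, ?_⟩
    have he : e = {c | c ≠ b} := by
      refine Set.eq_of_subset_of_ncard_le ?_ ?_ (Set.toFinite _)
      · intro c hc hcb; exact hb (hcb ▸ hc)
      · rw [hcard, ne_ncard]
    unfold Shr
    rw [← hs, ← he]; exact hse
  · right
    push Not at hA
    have hrel : ∀ x, (∀ c, c ≠ a → 0 < T.lam c x) → T.lam a x = 0 → x ∈ frontier Ω := by
      intro x h1 h2
      have hxi : x ∈ T.K := (T.mem_K x).2 fun c => by
        by_cases hc : c = a
        · rw [hc, h2]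
        · exact (h1 c hc).le
      have hopen : IsOpen Ω := by rw [hc.1]; exact isOpen_interior
      rw [hopen.frontier_eq, hc.2.1]
      refine ⟨Set.mem_iUnion.2 ⟨i, hxi⟩, ?_⟩
      intro hxΩ
      rw [hc.1] at hxΩ
      have hxn : x ∉ ⋃ j ∈ (Finset.univ.erase i), (M.el j).K := by
        simp only [Set.mem_iUnion, not_exists]
        intro j hj
        exact hA x h1 h2 j (Finset.ne_of_mem_erase hj)
      have hn1 : interior (⋃ i, (M.el i).K) ∈ nhds x := isOpen_interior.mem_nhds hxΩ
      have hn2 := (K_union_closed M (Finset.univ.erase i)).isOpen_compl.mem_nhds hxn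
      have : T.K ∈ nhds x := by
        filter_upwards [hn1, hn2] with y hy1 hy2
        obtain ⟨j, hj⟩ := Set.mem_iUnion.1 (interior_subset hy1)
        by_cases hji : j = i
        · rw [hT, ← hji]; exact hj
        · exact absurd (Set.mem_biUnion (Finset.mem_erase.2 ⟨hji, Finset.mem_univ _⟩) hj) hy2
      have := (T.mem_interior x).1 (mem_interior_iff_mem_nhds.2 this) a
      rw [h2] at this; exact lt_irrefl _ this
    intro y hy
    rw [mem_face] at hy
    have hy0 := (T.mem_K y).1 hy.1
    have hl : Filter.Tendsto (fun t : ℝ => y + t • (fcent T a - y)) (nhdsWithin 0 (Set.Ioi 0)) (nhds y) := by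
      have : Continuous (fun t : ℝ => y + t • (fcent T a - y)) := by fun_prop
      have h := this.tendsto 0
      rw [zero_smul, add_zero] at h
      exact h.mono_left nhdsWithin_le_nhds
    refine isClosed_frontier.mem_of_tendsto hl ?_
    have hev3 : ∀ᶠ t : ℝ in nhdsWithin 0 (Set.Ioi 0), t < 1 :=
      Filter.Eventually.filter_mono nhdsWithin_le_nhds (gt_mem_nhds one_pos)
    filter_upwards [self_mem_nhdsWithin, hev3] with t ht ht1
    have ht' : 0 < t := ht
    have e : ∀ c, T.lam c (y + t • (fcent T a - y)) = (1 - t) * T.lam c y + t * (if c = a then 0 else 1/3) := by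
      intro c; rw [T.lam_add, dot3_smul, T.gl_sub, lam_fcent]; ring
    apply hrel
    · intro c hc
      rw [e, if_neg hc]
      have := mul_nonneg (by linarith : 0 ≤ 1 - t) (hy0 c)
      linarith
    · rw [e, if_pos rfl, hy.2]; ring

lemma cancel (M : Mesh) (Ω : Set Vec) (hc : M.Covers Ω) (G : Fin M.n → Fin 4 → ℝ)
    (h1 : ∀ i j a b, i ≠ j → Shr (M.el i) (M.el j) a b → G i a + G j b = 0)
    (h2 : ∀ i a, (M.el i).face a ⊆ frontier Ω → G i a = 0) : ∑ i, ∑ a, G i a = 0 := by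
  rw [← Fintype.sum_prod_type']
  let P : Fin M.n × Fin 4 → Fin M.n × Fin 4 → Prop := fun p q => q.1 ≠ p.1 ∧ Shr (M.el p.1) (M.el q.1) p.2 q.2
  have huniq : ∀ p q r, P p q → P p r → q = r := by
    rintro ⟨i, a⟩ ⟨j, b⟩ ⟨l, c⟩ ⟨n1, s1⟩ ⟨n2, s2⟩
    simp only at n1 s1 n2 s2
    by_cases hjl : j = l
    · subst hjl; rw [s1.same s2]
    · exact (s1.unique s2 (M.disj _ _ (Ne.symm n1)) (M.disj _ _ (Ne.symm n2)) (M.disj _ _ hjl)).elim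
  have hsymm : ∀ p q, P p q → P q p := fun p q h => ⟨Ne.symm h.1, h.2.symm⟩
  let g : Fin M.n × Fin 4 → Fin M.n × Fin 4 := fun p => if h : ∃ q, P p q then h.choose else p
  have hg1 : ∀ p, (∃ q, P p q) → P p (g p) := by
    intro p h; simp only [g, dif_pos h]; exact h.choose_spec
  have hg2 : ∀ p, ¬ (∃ q, P p q) → g p = p := by
    intro p h; simp only [g, dif_neg h]
  have hz : ∀ p, ¬ (∃ q, P p q) → G p.1 p.2 = 0 := by
    intro p h
    rcases face_cases M Ω hc p.1 p.2 with ⟨j, b, hj, hs⟩ | hf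
    · exact absurd ⟨(j, b), hj, hs⟩ h
    · exact h2 _ _ hf
  refine Finset.sum_involution (fun p _ => g p) ?_ ?_ ?_ ?_
  · intro p _
    by_cases h : ∃ q, P p q
    · exact h1 _ _ _ _ (Ne.symm (hg1 p h).1) (hg1 p h).2
    · rw [hg2 p h, hz p h, add_zero]
  · intro p _ hp
    by_cases h : ∃ q, P p q
    · intro e; exact (hg1 p h).1 (by rw [e])
    · exact absurd (hz p h) hp
  · intro p _; exact Finset.mem_univ _
  · intro p _
    by_cases h : ∃ q, P p q
    · have hs := hsymm _ _ (hg1 p h)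
      exact huniq _ _ _ (hg1 (g p) ⟨p, hs⟩) hs
    · simp only [hg2 p h]

lemma PolyDeg.smooth {n : ℕ} {f : Vec → ℝ} (h : PolyDeg n f) {m : WithTop ℕ∞} : ContDiff ℝ m f := by
  obtain ⟨p, _, hp⟩ := h
  have : f = fun x => ∑ d ∈ p.support, p.coeff d * ∏ i, x i ^ d i := by
    funext x; rw [hp, MvPolynomial.eval_eq']
  rw [this]
  fun_prop

/-- polynomials of degree at most `n ≤ 3` in two variables, explicit form -/
def Qn (n : ℕ) (f : ℝ → ℝ → ℝ) : Prop :=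
  ∃ c0 c1 c2 c3 c4 c5 c6 c7 c8 c9 : ℝ,
    (n ≤ 2 → c6 = 0 ∧ c7 = 0 ∧ c8 = 0 ∧ c9 = 0) ∧ (n ≤ 1 → c3 = 0 ∧ c4 = 0 ∧ c5 = 0) ∧
    (n = 0 → c1 = 0 ∧ c2 = 0) ∧
    ∀ s t, f s t = c0 + c1 * s + c2 * t + c3 * s ^ 2 + c4 * s * t + c5 * t ^ 2 +
      c6 * s ^ 3 + c7 * s ^ 2 * t + c8 * s * t ^ 2 + c9 * t ^ 3

lemma Qn.mulaff {n : ℕ} (hn : n ≤ 2) {f : ℝ → ℝ → ℝ} (h : Qn n f) (a b c : ℝ) :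
    Qn (n + 1) (fun s t => (a + b * s + c * t) * f s t) := by
  obtain ⟨c0, c1, c2, c3, c4, c5, c6, c7, c8, c9, h3, h2, h1, hf⟩ := h
  obtain ⟨e6, e7, e8, e9⟩ := h3 hn
  refine ⟨a * c0, a * c1 + b * c0, a * c2 + c * c0, a * c3 + b * c1, a * c4 + b * c2 + c * c1,
    a * c5 + c * c2, b * c3, b * c4 + c * c3, b * c5 + c * c4, c * c5, ?_, ?_, ?_, ?_⟩
  · intro h; obtain ⟨g1, g2, g3⟩ := h2 (by omega); simp [g1, g2, g3]
  · intro h; obtain ⟨g1, g2, g3⟩ := h2 (by omega); obtain ⟨k1, k2⟩ := h1 (by omega)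
    simp [g1, g2, g3, k1, k2]
  · intro h; omega
  · intro s t; simp only [hf, e6, e7, e8, e9]; ring

lemma Qn.mono {n m : ℕ} (hnm : n ≤ m) {f : ℝ → ℝ → ℝ} (h : Qn n f) : Qn m f := by
  obtain ⟨c0, c1, c2, c3, c4, c5, c6, c7, c8, c9, h3, h2, h1, hf⟩ := h
  exact ⟨c0, c1, c2, c3, c4, c5, c6, c7, c8, c9, fun h => h3 (by omega), fun h => h2 (by omega),
    fun h => h1 (by omega), hf⟩

lemma Qn.add {n : ℕ} {f g : ℝ → ℝ → ℝ} (h : Qn n f) (h' : Qn n g) : Qn n (fun s t => f s t + g s t) := by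
  obtain ⟨c0, c1, c2, c3, c4, c5, c6, c7, c8, c9, h3, h2, h1, hf⟩ := h
  obtain ⟨d0, d1, d2, d3, d4, d5, d6, d7, d8, d9, g3, g2, g1, hg⟩ := h'
  refine ⟨c0 + d0, c1 + d1, c2 + d2, c3 + d3, c4 + d4, c5 + d5, c6 + d6, c7 + d7, c8 + d8, c9 + d9,
    ?_, ?_, ?_, ?_⟩
  · intro h; obtain ⟨a, b, c, d⟩ := h3 h; obtain ⟨a', b', c', d'⟩ := g3 h; simp [*]
  · intro h; obtain ⟨a, b, c⟩ := h2 h; obtain ⟨a', b', c'⟩ := g2 h; simp [*]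
  · intro h; obtain ⟨a, b⟩ := h1 h; obtain ⟨a', b'⟩ := g1 h; simp [*]
  · intro s t; simp only [hf, hg]; ring

lemma Qn.zero (n : ℕ) : Qn n (fun _ _ => 0) :=
  ⟨0, 0, 0, 0, 0, 0, 0, 0, 0, 0, by simp, by simp, by simp, by simp⟩

lemma Qn.mulpow {n : ℕ} (j : ℕ) (hn : n + j ≤ 3) {f : ℝ → ℝ → ℝ} (h : Qn n f) (a b c : ℝ) :
    Qn (n + j) (fun s t => (a + b * s + c * t) ^ j * f s t) := by
  induction j with
  | zero => simpa using h
  | succ j ih =>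
    have := (ih (by omega)).mulaff (by omega) a b c
    have e : (fun s t => (a + b * s + c * t) ^ (j + 1) * f s t) =
        fun s t => (a + b * s + c * t) * ((a + b * s + c * t) ^ j * f s t) := by
      funext s t; ring
    rw [e]; exact this

lemma polyQ {n : ℕ} (hn : n ≤ 3) {f : Vec → ℝ} (h : PolyDeg n f) (x0 e1 e2 : Vec) :
    Qn n (fun s t => f (x0 + s • e1 + t • e2)) := by
  obtain ⟨p, hd, hp⟩ := h
  have : (fun s t : ℝ => f (x0 + s • e1 + t • e2)) = fun s t => ∑ d ∈ p.support, p.coeff d *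
      ∏ i, (x0 + s • e1 + t • e2) i ^ d i := by
    funext s t; rw [hp, MvPolynomial.eval_eq']
  rw [this]
  have key : ∀ d ∈ p.support, Qn n (fun s t => p.coeff d * ∏ i, (x0 + s • e1 + t • e2) i ^ d i) := by
    intro d hds
    have h1 := (MvPolynomial.le_totalDegree hds).trans hd
    rw [Finsupp.sum_fintype _ _ (fun _ => rfl), Fin.sum_univ_three] at h1
    have q0 : Qn 0 (fun _ _ => p.coeff d) :=
      ⟨p.coeff d, 0, 0, 0, 0, 0, 0, 0, 0, 0, by simp, by simp, by simp, by simp⟩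
    have q1 := q0.mulpow (d 0) (by omega) (x0 0) (e1 0) (e2 0)
    have q2 := q1.mulpow (d 1) (by omega) (x0 1) (e1 1) (e2 1)
    have q3 := q2.mulpow (d 2) (by omega) (x0 2) (e1 2) (e2 2)
    have q4 := q3.mono (m := n) (by omega)
    convert q4 using 3
    simp only [Fin.prod_univ_three, Pi.add_apply, Pi.smul_apply, smul_eq_mul]
    ring
  clear this
  revert key
  generalize p.support = ss
  intro key
  induction ss using Finset.induction_on with
  | empty => simpa using Qn.zero n
  | insert d s hds ih =>
    simp only [Finset.sum_insert hds]
    exact (key d (Finset.mem_insert_self _ _)).add (ih fun d hd => key d (Finset.mem_insert_of_mem hd))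

/-- plane representation -/
def PR (k : ℕ) (z1 z2 : ℝ → ℝ → ℝ) : Prop :=
  ∃ A0 A1 A2 A3 A4 A5 B0 B1 B2 B3 B4 B5 : ℝ,
    (∀ s t, z1 s t = A0 + A1 * s + A2 * t + A3 * s ^ 2 + A4 * s * t + A5 * t ^ 2) ∧
    (∀ s t, z2 s t = B0 + B1 * s + B2 * t + B3 * s ^ 2 + B4 * s * t + B5 * t ^ 2) ∧
    (k = 1 → A3 = 0 ∧ B5 = 0 ∧ A4 = - B3 ∧ A5 = - B4)

lemma PR.sub {k : ℕ} {z1 z2 y1 y2 : ℝ → ℝ → ℝ} (h : PR k z1 z2) (h' : PR k y1 y2) :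
    PR k (fun s t => z1 s t - y1 s t) (fun s t => z2 s t - y2 s t) := by
  obtain ⟨A0, A1, A2, A3, A4, A5, B0, B1, B2, B3, B4, B5, h1, h2, h3⟩ := h
  obtain ⟨A0', A1', A2', A3', A4', A5', B0', B1', B2', B3', B4', B5', g1, g2, g3⟩ := h'
  refine ⟨A0 - A0', A1 - A1', A2 - A2', A3 - A3', A4 - A4', A5 - A5',
    B0 - B0', B1 - B1', B2 - B2', B3 - B3', B4 - B4', B5 - B5', ?_, ?_, ?_⟩
  · intro s t; simp only [h1, g1]; ring
  · intro s t; simp only [h2, g2]; ring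
  · intro hk
    obtain ⟨a, b, c, d⟩ := h3 hk
    obtain ⟨a', b', c', d'⟩ := g3 hk
    refine ⟨by linarith, by linarith, by linarith, by linarith⟩

lemma PR.zero (k : ℕ) : PR k (fun _ _ => 0) (fun _ _ => 0) :=
  ⟨0, 0, 0, 0, 0, 0, 0, 0, 0, 0, 0, 0, by simp, by simp, by simp⟩

/-- barycentric families agree with `T.lam` -/
lemma bary_eq (T : Tetra) (lam : Fin 4 → Vec → ℝ) (h : T.IsBary lam) (a : Fin 4) (x : Vec) :
    lam a x = T.lam a x := by
  obtain ⟨h1, h2⟩ := h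
  -- affine: lam a x = c0 + sum
  have lin : ∃ (c : ℝ) (g : Fin 3 → ℝ), ∀ x : Vec, lam a x = c + ∑ i, g i * x i := by
    obtain ⟨p, hd, hp⟩ := h1 a
    have : ∀ d ∈ p.support, ∃ (c : ℝ) (g : Fin 3 → ℝ), ∀ x : Vec, p.coeff d * ∏ i, x i ^ d i = c + ∑ i, g i * x i := by
      intro d hds
      have h1 := (MvPolynomial.le_totalDegree hds).trans hd
      rw [Finsupp.sum_fintype _ _ (fun _ => rfl), Fin.sum_univ_three] at h1
      have hcase : (d 0 = 0 ∧ d 1 = 0 ∧ d 2 = 0) ∨ (d 0 = 1 ∧ d 1 = 0 ∧ d 2 = 0) ∨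
        (d 0 = 0 ∧ d 1 = 1 ∧ d 2 = 0) ∨ (d 0 = 0 ∧ d 1 = 0 ∧ d 2 = 1) := by omega
      rcases hcase with ⟨g0, g1, g2⟩ | ⟨g0, g1, g2⟩ | ⟨g0, g1, g2⟩ | ⟨g0, g1, g2⟩
      · exact ⟨p.coeff d, 0, fun x => by simp [Fin.prod_univ_three, g0, g1, g2]⟩
      · exact ⟨0, ![p.coeff d, 0, 0], fun x => by simp [Fin.prod_univ_three, Fin.sum_univ_three, g0, g1, g2]⟩
      · exact ⟨0, ![0, p.coeff d, 0], fun x => by simp [Fin.prod_univ_three, Fin.sum_univ_three, g0, g1, g2]⟩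
      · exact ⟨0, ![0, 0, p.coeff d], fun x => by simp [Fin.prod_univ_three, Fin.sum_univ_three, g0, g1, g2]⟩
    choose! c g hcg using this
    refine ⟨∑ d ∈ p.support, c d, fun i => ∑ d ∈ p.support, g d i, fun x => ?_⟩
    rw [hp, MvPolynomial.eval_eq', Finset.sum_congr rfl (fun d hd => hcg d hd x), Finset.sum_add_distrib,
      Finset.sum_comm]
    simp only [Finset.sum_mul]
  obtain ⟨c, g, hcg⟩ := lin
  have hx := (T.sum_lam_smul x).symm
  have h3 : lam a x = ∑ b, T.lam b x * lam a (T.vtx b) := by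
    simp only [hcg, mul_add, Finset.sum_add_distrib, ← Finset.sum_mul, T.sum_lam, one_mul]
    congr 1
    conv_lhs => rw [hx]
    simp only [Finset.sum_apply, Pi.smul_apply, smul_eq_mul, Finset.mul_sum]
    rw [Finset.sum_comm]
    exact Finset.sum_congr rfl fun b _ => Finset.sum_congr rfl fun i _ => by ring
  rw [h3]
  simp [h2]

lemma lam_poly (T : Tetra) (a : Fin 4) (m : ℕ) : PolyDeg m (fun x => T.lam a x ^ m) := by
  refine ⟨(MvPolynomial.C (T.lam a 0) + ∑ i, MvPolynomial.C (T.gl a i) * MvPolynomial.X i) ^ m, ?_, ?_⟩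
  · refine (MvPolynomial.totalDegree_pow _ _).trans ?_
    have : (MvPolynomial.C (T.lam a 0) + ∑ i, MvPolynomial.C (T.gl a i) * MvPolynomial.X i :
        MvPolynomial (Fin 3) ℝ).totalDegree ≤ 1 := by
      refine (MvPolynomial.totalDegree_add _ _).trans (max_le (by simp) ?_)
      refine MvPolynomial.totalDegree_finsetSum_le fun i _ => ?_
      refine (MvPolynomial.totalDegree_mul _ _).trans (by simp)
    calc m * _ ≤ m * 1 := Nat.mul_le_mul_left _ this
      _ = m := mul_one m
  · intro x
    simp only [map_pow, map_add, map_sum, map_mul, MvPolynomial.eval_C, MvPolynomial.eval_X]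
    rw [T.lam_eq a x]; rfl

lemma PolyDeg.mono {n m : ℕ} (h : n ≤ m) {f : Vec → ℝ} (hf : PolyDeg n f) : PolyDeg m f := by
  obtain ⟨p, h1, h2⟩ := hf; exact ⟨p, h1.trans h, h2⟩

lemma bubble_zero {T : Tetra} {b : Vec → ℝ} (h : T.IsBubble b) (a : Fin 4) {x : Vec} (hx : T.lam a x = 0) :
    b x = 0 := by
  obtain ⟨lam, h1, h2⟩ := h
  rw [h2]; exact Finset.prod_eq_zero (Finset.mem_univ a) (by rw [bary_eq T lam h1, hx])

lemma MemW.smooth {k : ℕ} {T : Tetra} {v : Vec → Vec} (h : MemW k T v) (i : Fin 3) :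
    ContDiff ℝ (↑(⊤ : ℕ∞)) (fun x => v x i) := by
  obtain ⟨q, p, r, b, ⟨lam, hl, hb⟩, hq, hp, hr, hv⟩ := h
  have h1 : ContDiff ℝ (↑(⊤ : ℕ∞)) b := by
    have : b = fun x => ∏ i, lam i x := funext hb
    rw [this]
    exact contDiff_prod fun i _ => (hl.1 i).smooth
  have h2 : ContDiff ℝ (↑(⊤ : ℕ∞)) (fun x => grad3 q x i) := by
    unfold grad3 pd
    have : ContDiff ℝ (↑(⊤ : ℕ∞)) (fun x => fderiv ℝ q x) := by
      have := hq.smooth (m := ⊤)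
      exact this.fderiv_right (m := (↑(⊤ : ℕ∞))) le_top
    exact this.clm_apply contDiff_const
  have h3 : ∀ j, ContDiff ℝ (↑(⊤ : ℕ∞)) (fun x => p x j) := fun j => (hp j).smooth
  have h4 : ∀ j, ContDiff ℝ (↑(⊤ : ℕ∞)) (fun x => r x j) := fun j => (hr j).smooth
  have h5 : ∀ j : Fin 3, ContDiff ℝ (↑(⊤ : ℕ∞)) (fun x : Vec => x j) := fun j => by fun_prop
  have h6 : ContDiff ℝ (↑(⊤ : ℕ∞)) (fun x => cross3 x (p x) i) := by
    unfold cross3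
    fin_cases i
    · exact ((h5 1).mul (h3 2)).sub ((h5 2).mul (h3 1))
    · exact ((h5 2).mul (h3 0)).sub ((h5 0).mul (h3 2))
    · exact ((h5 0).mul (h3 1)).sub ((h5 1).mul (h3 0))
  have : (fun x => v x i) = fun x => grad3 q x i + cross3 x (p x) i + b x * r x i := by
    funext x; rw [hv]; rfl
  rw [this]
  exact (h2.add h6).add (h1.mul (h4 i))

lemma pr_of_W {k : ℕ} (hk : k = 1 ∨ k = 2) {S : Tetra} {v : Vec → Vec} (h : MemW k S v) (b : Fin 4)
    (x0 e1 e2 : Vec) (hpl : ∀ s t : ℝ, S.lam b (x0 + s • e1 + t • e2) = 0) :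
    PR k (fun s t => dot3 (v (x0 + s • e1 + t • e2)) e1) (fun s t => dot3 (v (x0 + s • e1 + t • e2)) e2) := by
  obtain ⟨q, p, r, bb, hb, hq, hp, hr, hv⟩ := h
  obtain ⟨c0, c1, c2, c3, c4, c5, c6, c7, c8, c9, h3, h2, h1, hf⟩ := polyQ (by omega) hq x0 e1 e2
  have hpp : ∀ j, ∃ α β γ : ℝ, ∀ s t : ℝ, p (x0 + s • e1 + t • e2) j = α + β * s + γ * t := by
    intro j
    obtain ⟨c0, c1, c2, c3, c4, c5, c6, c7, c8, c9, h3, h2, h1, hf⟩ := polyQ (by omega) (hp j) x0 e1 e2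
    obtain ⟨e6, e7, e8, e9⟩ := h3 (by norm_num)
    obtain ⟨e3, e4, e5⟩ := h2 le_rfl
    exact ⟨c0, c1, c2, fun s t => by have := hf s t; simp only [e3, e4, e5, e6, e7, e8, e9] at this; linarith⟩
  choose α β γ hαβγ using hpp
  have hqd : Differentiable ℝ q := (hq.smooth (m := 1)).differentiable (by norm_num)
  have hg1 : ∀ s t : ℝ, dot3 (grad3 q (x0 + s • e1 + t • e2)) e1 =
      c1 + 2 * c3 * s + c4 * t + 3 * c6 * s ^ 2 + 2 * c7 * s * t + c8 * t ^ 2 := by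
    intro s t
    have hd1 : HasDerivAt (fun s => q (x0 + s • e1 + t • e2)) (fderiv ℝ q (x0 + s • e1 + t • e2) e1) s := by
      have hline : HasDerivAt (fun s : ℝ => x0 + s • e1 + t • e2) e1 s := by
        have := (((hasDerivAt_id s).smul_const e1).const_add x0).add_const (t • e2)
        simpa using this
      exact (hqd _).hasFDerivAt.comp_hasDerivAt s hline
    have hd2 : HasDerivAt (fun s => q (x0 + s • e1 + t • e2))
        (c1 + 2 * c3 * s + c4 * t + 3 * c6 * s ^ 2 + 2 * c7 * s * t + c8 * t ^ 2) s := by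
      have : (fun s => q (x0 + s • e1 + t • e2)) = fun s => c0 + c1 * s + c2 * t + c3 * s ^ 2 + c4 * s * t + c5 * t ^ 2 +
          c6 * s ^ 3 + c7 * s ^ 2 * t + c8 * s * t ^ 2 + c9 * t ^ 3 := by funext s; exact hf s t
      rw [this]
      have i := hasDerivAt_id s
      have i2 := (hasDerivAt_pow 2 s)
      have i3 := (hasDerivAt_pow 3 s)
      have hh := (((((((((hasDerivAt_const s c0).add (i.const_mul c1)).add_const (c2 * t)).add (i2.const_mul c3)).add
        ((i.const_mul c4).mul_const t)).add_const (c5 * t ^ 2)).add (i3.const_mul c6)).add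
        ((i2.const_mul c7).mul_const t)).add ((i.const_mul c8).mul_const (t ^ 2))).add_const (c9 * t ^ 3)
      refine HasDerivAt.congr_deriv hh ?_
      push_cast; ring
    rw [← hd1.unique hd2, fd_eq]
    simp [dot3, grad3, mul_comm]
  have hg2 : ∀ s t : ℝ, dot3 (grad3 q (x0 + s • e1 + t • e2)) e2 =
      c2 + c4 * s + 2 * c5 * t + c7 * s ^ 2 + 2 * c8 * s * t + 3 * c9 * t ^ 2 := by
    intro s t
    have hd1 : HasDerivAt (fun t => q (x0 + s • e1 + t • e2)) (fderiv ℝ q (x0 + s • e1 + t • e2) e2) t := by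
      have hline : HasDerivAt (fun t : ℝ => x0 + s • e1 + t • e2) e2 t := by
        have := ((hasDerivAt_id t).smul_const e2).const_add (x0 + s • e1)
        simpa using this
      exact (hqd _).hasFDerivAt.comp_hasDerivAt t hline
    have hd2 : HasDerivAt (fun t => q (x0 + s • e1 + t • e2))
        (c2 + c4 * s + 2 * c5 * t + c7 * s ^ 2 + 2 * c8 * s * t + 3 * c9 * t ^ 2) t := by
      have : (fun t => q (x0 + s • e1 + t • e2)) = fun t => (c0 + c1 * s + c3 * s ^ 2 + c6 * s ^ 3) + c2 * t + (c4 * s) * t + c5 * t ^ 2 +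
          (c7 * s ^ 2) * t + (c8 * s) * t ^ 2 + c9 * t ^ 3 := by funext t; have := hf s t; simp only at this; rw [this]; ring
      rw [this]
      have i := hasDerivAt_id t
      have i2 := (hasDerivAt_pow 2 t)
      have i3 := (hasDerivAt_pow 3 t)
      have hh := ((((((hasDerivAt_const t (c0 + c1 * s + c3 * s ^ 2 + c6 * s ^ 3)).add (i.const_mul c2)).add (i.const_mul (c4 * s))).add
        (i2.const_mul c5)).add (i.const_mul (c7 * s ^ 2))).add (i2.const_mul (c8 * s))).add (i3.const_mul c9)
      refine HasDerivAt.congr_deriv hh ?_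
      push_cast; ring
    rw [← hd1.unique hd2, fd_eq]
    simp [dot3, grad3, mul_comm]
  have hvv : ∀ (s t : ℝ) (e : Vec), dot3 (v (x0 + s • e1 + t • e2)) e = dot3 (grad3 q (x0 + s • e1 + t • e2)) e +
      dot3 (cross3 (x0 + s • e1 + t • e2) (p (x0 + s • e1 + t • e2))) e := by
    intro s t e
    rw [hv, bubble_zero hb b (hpl s t), zero_smul, add_zero, dot3_comm, dot3_add, dot3_comm e, dot3_comm e]
  have hx : ∀ (s t : ℝ) (e y : Vec), dot3 (cross3 (x0 + s • e1 + t • e2) y) e =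
      dot3 y (cross3 e x0) + s * dot3 y (cross3 e e1) + t * dot3 y (cross3 e e2) := by
    intro s t e y
    simp only [dot3, cross3, Fin.sum_univ_three, Pi.add_apply, Pi.smul_apply, smul_eq_mul, Matrix.cons_val_zero,
      Matrix.cons_val_one, Matrix.cons_val]
    ring
  have hp3 : ∀ (s t : ℝ) (X : Vec), dot3 (p (x0 + s • e1 + t • e2)) X = dot3 α X + dot3 β X * s + dot3 γ X * t := by
    intro s t X
    simp only [dot3, hαβγ, Fin.sum_univ_three]; ring
  have hself : ∀ (e y : Vec), dot3 y (cross3 e e) = 0 := by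
    intro e y
    simp only [dot3, cross3, Fin.sum_univ_three, Matrix.cons_val_zero, Matrix.cons_val_one, Matrix.cons_val]; ring
  have hanti : ∀ (y : Vec), dot3 y (cross3 e2 e1) = - dot3 y (cross3 e1 e2) := by
    intro y
    simp only [dot3, cross3, Fin.sum_univ_three, Matrix.cons_val_zero, Matrix.cons_val_one, Matrix.cons_val]; ring
  set N := cross3 e1 e2
  set X := cross3 e1 x0
  set Y := cross3 e2 x0
  refine ⟨c1 + dot3 α X, 2 * c3 + dot3 β X, c4 + dot3 γ X + dot3 α N, 3 * c6, 2 * c7 + dot3 β N, c8 + dot3 γ N,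
    c2 + dot3 α Y, c4 + dot3 β Y - dot3 α N, 2 * c5 + dot3 γ Y, c7 - dot3 β N, 2 * c8 - dot3 γ N, 3 * c9, ?_, ?_, ?_⟩
  · intro s t
    simp only [hvv, hg1, hx, hself, hp3]
    ring
  · intro s t
    simp only [hvv, hg2, hx, hself, hanti, hp3]
    ring
  · intro hk1
    obtain ⟨e6, e7, e8, e9⟩ := h3 (by omega)
    rw [e6, e7, e8, e9]
    refine ⟨by ring, by ring, by ring, by ring⟩

lemma T2_fub (F : ℝ → ℝ → ℝ) (hF : Continuous (fun y : ℝ × ℝ => F y.1 y.2)) :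
    ∫ y in T2, F y.1 y.2 = ∫ s in (0:ℝ)..1, ∫ t in (0:ℝ)..(1 - s), F s t := by
  rw [← integral_indicator T2_closed.measurableSet]
  have hi : Integrable (T2.indicator (fun y : ℝ × ℝ => F y.1 y.2)) (volume.prod volume) := by
    have : IntegrableOn (fun y : ℝ × ℝ => F y.1 y.2) T2 := ci T2_compact hF
    exact this.integrable_indicator T2_closed.measurableSet
  have e : (∫ y, T2.indicator (fun y : ℝ × ℝ => F y.1 y.2) y) =
    ∫ y, T2.indicator (fun y : ℝ × ℝ => F y.1 y.2) y ∂((volume : Measure ℝ).prod volume) := rfl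
  rw [e, integral_prod _ hi, intervalIntegral.integral_of_le zero_le_one, ← integral_Icc_eq_integral_Ioc,
    ← integral_indicator measurableSet_Icc]
  congr 1
  funext s
  by_cases hs : s ∈ Set.Icc (0:ℝ) 1
  · rw [Set.indicator_of_mem hs, intervalIntegral.integral_of_le (by linarith [hs.2]), ← integral_Icc_eq_integral_Ioc,
      ← integral_indicator measurableSet_Icc]
    congr 1; funext t
    by_cases ht : t ∈ Set.Icc 0 (1 - s)
    · rw [Set.indicator_of_mem ht, Set.indicator_of_mem]
      exact ⟨hs.1, ht.1, by have := ht.2; simp only; linarith⟩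
    · rw [Set.indicator_of_notMem ht, Set.indicator_of_notMem]
      rintro ⟨h1, h2, h3⟩; simp only at h2 h3
      exact ht ⟨h2, by linarith⟩
  · rw [Set.indicator_of_notMem hs]
    have : ∀ t, T2.indicator (fun y : ℝ × ℝ => F y.1 y.2) (s, t) = 0 := by
      intro t; rw [Set.indicator_of_notMem]
      rintro ⟨h1, h2, h3⟩; simp only at h1 h2 h3
      exact hs ⟨h1, by linarith⟩
    simp [this]

lemma int_poly4 (c0 c1 c2 c3 : ℝ) (s : ℝ) :
    ∫ t in (0:ℝ)..s, (c0 + c1 * t + c2 * t ^ 2 + c3 * t ^ 3) = c0 * s + c1 * s ^ 2 / 2 + c2 * s ^ 3 / 3 + c3 * s ^ 4 / 4 := by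
  have h : ∀ t ∈ Set.uIcc (0:ℝ) s, HasDerivAt (fun t => c0 * t + c1 * t ^ 2 / 2 + c2 * t ^ 3 / 3 + c3 * t ^ 4 / 4)
      (c0 + c1 * t + c2 * t ^ 2 + c3 * t ^ 3) t := by
    intro t _
    have hh := ((((hasDerivAt_id t).const_mul c0).add (((hasDerivAt_pow 2 t).const_mul c1).div_const 2)).add
      (((hasDerivAt_pow 3 t).const_mul c2).div_const 3)).add (((hasDerivAt_pow 4 t).const_mul c3).div_const 4)
    refine HasDerivAt.congr_deriv hh ?_
    push_cast; ring
  rw [intervalIntegral.integral_eq_sub_of_hasDerivAt h (by apply Continuous.intervalIntegrable; fun_prop)]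
  ring

/-- quadratic with vanishing moments up to order 2 -/
lemma quad_mom {a b c : ℝ} (h0 : ∫ t in (0:ℝ)..1, (a + b * t + c * t ^ 2) * t ^ 0 = 0)
    (h1 : ∫ t in (0:ℝ)..1, (a + b * t + c * t ^ 2) * t ^ 1 = 0)
    (h2 : c = 0 ∨ ∫ t in (0:ℝ)..1, (a + b * t + c * t ^ 2) * t ^ 2 = 0) : a = 0 ∧ b = 0 ∧ c = 0 := by
  have g0 := int_poly4 a b c 0 1
  have g1 := int_poly4 0 a b c 1
  have e0 : ∀ t : ℝ, (a + b * t + c * t ^ 2) * t ^ 0 = a + b * t + c * t ^ 2 + 0 * t ^ 3 := fun t => by ring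
  have e1 : ∀ t : ℝ, (a + b * t + c * t ^ 2) * t ^ 1 = 0 + a * t + b * t ^ 2 + c * t ^ 3 := fun t => by ring
  simp only [e0] at h0; simp only [e1] at h1
  rw [g0] at h0; rw [g1] at h1
  rcases h2 with h2 | h2
  · subst h2
    refine ⟨by linarith, by linarith, rfl⟩
  · have h : ∀ t ∈ Set.uIcc (0:ℝ) 1, HasDerivAt (fun t => a * t ^ 3 / 3 + b * t ^ 4 / 4 + c * t ^ 5 / 5)
        ((a + b * t + c * t ^ 2) * t ^ 2) t := by
      intro t _
      have hh := ((((hasDerivAt_pow 3 t).const_mul a).div_const 3).add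
        (((hasDerivAt_pow 4 t).const_mul b).div_const 4)).add (((hasDerivAt_pow 5 t).const_mul c).div_const 5)
      refine HasDerivAt.congr_deriv hh ?_
      push_cast; ring
    rw [intervalIntegral.integral_eq_sub_of_hasDerivAt h (by apply Continuous.intervalIntegrable; fun_prop)] at h2
    refine ⟨by linarith, by linarith, by linarith⟩

lemma unisolv {k : ℕ} (hk : k = 1 ∨ k = 2) {z1 z2 : ℝ → ℝ → ℝ} (h : PR k z1 z2)
    (h1 : ∀ m ≤ k, ∫ τ in (0:ℝ)..1, z1 τ 0 * τ ^ m = 0)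
    (h2 : ∀ m ≤ k, ∫ τ in (0:ℝ)..1, z2 0 τ * τ ^ m = 0)
    (h3 : ∀ m ≤ k, ∫ τ in (0:ℝ)..1, (z2 (1 - τ) τ - z1 (1 - τ) τ) * τ ^ m = 0)
    (h4 : ∫ y in T2, z1 y.1 y.2 = 0) (h5 : ∫ y in T2, z2 y.1 y.2 = 0)
    (h6 : k = 2 → ∫ y in T2, (y.1 * z1 y.1 y.2 + y.2 * z2 y.1 y.2) = 0) :
    (∀ s t, z1 s t = 0) ∧ ∀ s t, z2 s t = 0 := by
  obtain ⟨A0, A1, A2, A3, A4, A5, B0, B1, B2, B3, B4, B5, hz1, hz2, hc⟩ := h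
  have k1 : 1 ≤ k := by omega
  have r1 : ∀ τ, z1 τ 0 = A0 + A1 * τ + A3 * τ ^ 2 := fun τ => by rw [hz1]; ring
  have r2 : ∀ τ, z2 0 τ = B0 + B2 * τ + B5 * τ ^ 2 := fun τ => by rw [hz2]; ring
  have r3 : ∀ τ, z2 (1 - τ) τ - z1 (1 - τ) τ = (B0 + B1 + B3 - A0 - A1 - A3) +
      (- B1 + B2 - 2 * B3 + B4 + A1 - A2 + 2 * A3 - A4) * τ + (B3 - B4 + B5 - A3 + A4 - A5) * τ ^ 2 := fun τ => by
    rw [hz1, hz2]; ring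
  simp only [r1] at h1; simp only [r2] at h2; simp only [r3] at h3
  obtain ⟨a0, a1, a3⟩ := quad_mom (h1 0 (by omega)) (h1 1 k1) (by
    rcases hk with hk | hk
    · left; exact (hc hk).1
    · right; exact h1 2 (by omega))
  obtain ⟨b0, b2, b5⟩ := quad_mom (h2 0 (by omega)) (h2 1 k1) (by
    rcases hk with hk | hk
    · left; exact (hc hk).2.1
    · right; exact h2 2 (by omega))
  obtain ⟨d0, d1, d2⟩ := quad_mom (h3 0 (by omega)) (h3 1 k1) (by
    rcases hk with hk | hk
    · left; obtain ⟨p1, p2, p3, p4⟩ := hc hk; linarith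
    · right; exact h3 2 (by omega))
  subst a0 a1 a3 b0 b2 b5
  have eA5 : A5 = - A2 := by linarith
  have eB3 : B3 = - B1 := by linarith
  subst eA5 eB3
  have m4 : A2 / 12 + A4 / 24 = 0 := by
    rw [T2_fub _ (by simp only [hz1]; fun_prop)] at h4
    have : ∀ s, ∫ t in (0:ℝ)..(1 - s), z1 s t = A2 / 6 + (A4/2) * s + (- A2/2 - A4) * s ^ 2 + (A2/3 + A4/2) * s^3 := by
      intro s
      have e : ∀ t, z1 s t = 0 + (A2 + A4 * s) * t + (- A2) * t ^ 2 + 0 * t ^ 3 := fun t => by rw [hz1]; ring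
      simp only [e]; rw [int_poly4]; ring
    simp only [this] at h4
    rw [int_poly4] at h4
    linarith
  have m5 : B1 / 12 + B4 / 24 = 0 := by
    rw [T2_fub _ (by simp only [hz2]; fun_prop)] at h5
    have : ∀ s, ∫ t in (0:ℝ)..(1 - s), z2 s t = 0 + (B1 + B4 / 2) * s + (- 2 * B1 - B4) * s ^ 2 + (B1 + B4 / 2) * s^3 := by
      intro s
      have e : ∀ t, z2 s t = (B1 * s - B1 * s ^ 2) + (B4 * s) * t + 0 * t ^ 2 + 0 * t ^ 3 := fun t => by rw [hz2]; ring
      simp only [e]; rw [int_poly4]; ring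
    simp only [this] at h5
    rw [int_poly4] at h5
    linarith
  have eA4 : A4 = - 2 * A2 := by linarith
  have eB4 : B4 = - 2 * B1 := by linarith
  have eB1 : B1 = A2 := by linarith
  subst eA4 eB4 eB1
  have hA : B1 = 0 := by
    rcases hk with hk | hk
    · obtain ⟨p1, p2, p3, p4⟩ := hc hk; linarith
    · have h6 := h6 hk
      rw [T2_fub (fun s t => s * z1 s t + t * z2 s t) (by simp only [hz1, hz2]; fun_prop)] at h6
      have : ∀ s, ∫ t in (0:ℝ)..(1 - s), (s * z1 s t + t * z2 s t) =
          (- 1/2 * B1) * s ^ 2 + B1 * s ^ 3 + (- 1/2 * B1) * s ^ 4 := by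
        intro s
        have e : ∀ t, s * z1 s t + t * z2 s t = 0 + (2 * B1 * s - 3 * B1 * s ^ 2) * t + (- 3 * B1 * s) * t ^ 2 + 0 * t ^ 3 :=
          fun t => by rw [hz1, hz2]; ring
        simp only [e]; rw [int_poly4]; ring
      simp only [this] at h6
      have h : ∀ t ∈ Set.uIcc (0:ℝ) 1, HasDerivAt (fun t => (- 1/2 * B1) * t ^ 3 / 3 + B1 * t ^ 4 / 4 + (- 1/2 * B1) * t ^ 5 / 5)
          ((- 1/2 * B1) * t ^ 2 + B1 * t ^ 3 + (- 1/2 * B1) * t ^ 4) t := by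
        intro t _
        have hh := ((((hasDerivAt_pow 3 t).const_mul (- 1/2 * B1)).div_const 3).add
          (((hasDerivAt_pow 4 t).const_mul B1).div_const 4)).add (((hasDerivAt_pow 5 t).const_mul (- 1/2 * B1)).div_const 5)
        refine HasDerivAt.congr_deriv hh ?_
        push_cast; ring
      rw [intervalIntegral.integral_eq_sub_of_hasDerivAt h (by apply Continuous.intervalIntegrable; fun_prop)] at h6
      linarith
  subst hA
  exact ⟨fun s t => by rw [hz1]; ring, fun s t => by rw [hz2]; ring⟩

lemma edge_form (T : Tetra) (b c : Fin 4) (hbc : b ≠ c) : ∃ κ : ℝ, 0 < κ ∧ ∀ (v : Vec → Vec) (q : Vec → ℝ),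
    edgeMoment T b c v q = κ * ∫ τ in (0:ℝ)..1, dot3 (v (T.vtx b + τ • (T.vtx c - T.vtx b))) (T.vtx c - T.vtx b) *
      q (T.vtx b + τ • (T.vtx c - T.vtx b)) := by
  have hne : T.vtx c - T.vtx b ≠ 0 := by
    intro h; exact hbc (T.indep.injective (sub_eq_zero.1 h)).symm
  set e := T.vtx c - T.vtx b with he
  have hinj : Function.Injective ((ContinuousLinearMap.id ℝ ℝ).smulRight e) := by
    intro x y h
    simpa using smul_left_injective ℝ hne h
  obtain ⟨κ, hκ, hp⟩ := param_int (volume : Measure ℝ) ((ContinuousLinearMap.id ℝ ℝ).smulRight e) hinj (T.vtx b) 1 (by simp)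
  have hen : 0 < enorm3 e := by
    unfold enorm3
    apply Real.sqrt_pos.2
    rcases lt_or_eq_of_le (nsq3_nonneg e) with h | h
    · exact h
    · exfalso; apply hne
      have h' : dot3 e e = 0 := h.symm
      simp only [dot3] at h'
      rw [Finset.sum_eq_zero_iff_of_nonneg (fun i _ => mul_self_nonneg _)] at h'
      funext i; simpa using h' i (Finset.mem_univ i)
  refine ⟨κ * (enorm3 e)⁻¹, by positivity, ?_⟩
  intro v q
  unfold edgeMoment Tetra.tangent Tetra.edge normalize3
  rw [segment_eq_image', ← he]
  have := hp (Set.Icc 0 1) (fun x => dot3 (v x) ((enorm3 e)⁻¹ • e) * q x)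
  simp only [ContinuousLinearMap.smulRight_apply, ContinuousLinearMap.id_apply] at this
  rw [this, intervalIntegral.integral_of_le zero_le_one, ← integral_Icc_eq_integral_Ioc, mul_assoc,
    ← integral_const_mul (enorm3 e)⁻¹]
  congr 2; funext τ
  rw [dot3_smul]; ring

lemma sAb_ne (a : Fin 4) : a ≠ a.succAbove 0 ∧ a ≠ a.succAbove 1 ∧ a ≠ a.succAbove 2 ∧ a.succAbove 0 ≠ a.succAbove 1 ∧
   a.succAbove 0 ≠ a.succAbove 2 ∧ a.succAbove 1 ≠ a.succAbove 2 := by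
  revert a; decide

def fx0 (T : Tetra) (a : Fin 4) : Vec := T.vtx (a.succAbove 0)
def fe1 (T : Tetra) (a : Fin 4) : Vec := T.vtx (a.succAbove 1) - T.vtx (a.succAbove 0)
def fe2 (T : Tetra) (a : Fin 4) : Vec := T.vtx (a.succAbove 2) - T.vtx (a.succAbove 0)
def fP (T : Tetra) (a : Fin 4) (y : ℝ × ℝ) : Vec := fx0 T a + lin2 (fe1 T a) (fe2 T a) y

lemma fP_eq (T : Tetra) (a : Fin 4) (y : ℝ × ℝ) : fP T a y = fx0 T a + y.1 • fe1 T a + y.2 • fe2 T a := by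
  unfold fP; rw [lin2_apply]; rw [add_assoc]

lemma fP_lam (T : Tetra) (a : Fin 4) (y : ℝ × ℝ) : T.lam a (fP T a y) = 0 ∧
    T.lam (a.succAbove 0) (fP T a y) = 1 - y.1 - y.2 ∧ T.lam (a.succAbove 1) (fP T a y) = y.1 ∧
    T.lam (a.succAbove 2) (fP T a y) = y.2 := by
  obtain ⟨h1, h2, h3, h4, h5, h6⟩ := sAb_ne a
  have := lam_p3 T a (a.succAbove 0) (a.succAbove 1) (a.succAbove 2) h1 h2 h3 h4 h5 h6 (y, 0)
  have e : fP T a y = T.vtx (a.succAbove 0) + lin3 (T.vtx (a.succAbove 1) - T.vtx (a.succAbove 0))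
    (T.vtx (a.succAbove 2) - T.vtx (a.succAbove 0)) (T.vtx a - T.vtx (a.succAbove 0)) (y, 0) := by
    simp [fP, lin2_apply, lin3_apply, fx0, fe1, fe2]
  rw [e]; simpa using this

lemma fP_surj (T : Tetra) (a : Fin 4) (x : Vec) (hx : T.lam a x = 0) : ∃ y, x = fP T a y := by
  obtain ⟨h1, h2, h3, h4, h5, h6⟩ := sAb_ne a
  have := eq_p3 T a (a.succAbove 0) (a.succAbove 1) (a.succAbove 2) h1 h2 h3 h4 h5 h6 x
  refine ⟨(T.lam (a.succAbove 1) x, T.lam (a.succAbove 2) x), ?_⟩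
  rw [hx] at this
  refine this.trans ?_
  simp [fP, lin2_apply, lin3_apply, fx0, fe1, fe2]

lemma fP_cont (T : Tetra) (a : Fin 4) : Continuous (fP T a) := by
  unfold fP; fun_prop

lemma face_form (T : Tetra) (a : Fin 4) : ∃ κ : ℝ, 0 < κ ∧ ∀ (v q : Vec → Vec),
    faceTanMoment T a v q = κ * ∫ y in T2, dot3 (cross3 (v (fP T a y)) (T.outNormal a)) (q (fP T a y)) := by
  obtain ⟨h1, h2, h3, h4, h5, h6⟩ := sAb_ne a
  obtain ⟨κ, hκ, hp⟩ := param_int (volume : Measure (ℝ × ℝ)) _ (lin2_inj T a _ _ _ h1 h2 h3 h4 h5 h6) (fx0 T a) 2 (by simp)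
  refine ⟨κ, hκ, fun v q => ?_⟩
  unfold faceTanMoment
  rw [face_p2 T a _ _ _ h1 h2 h3 h4 h5 h6]
  exact hp T2 (fun x => dot3 (cross3 (v x) (T.outNormal a)) (q x))

lemma nsq3_pos {v : Vec} (h : v ≠ 0) : 0 < dot3 v v := by
  rcases lt_or_eq_of_le (nsq3_nonneg v) with h' | h'
  · exact h'
  · exfalso; apply h
    have h'' : dot3 v v = 0 := h'.symm
    simp only [dot3] at h''
    rw [Finset.sum_eq_zero_iff_of_nonneg (fun i _ => mul_self_nonneg _)] at h''
    funext i; simpa using h'' i (Finset.mem_univ i)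

lemma N_pos (T : Tetra) (a : Fin 4) : 0 < dot3 (cross3 (fe1 T a) (fe2 T a)) (cross3 (fe1 T a) (fe2 T a)) := by
  obtain ⟨h1, h2, h3, h4, h5, h6⟩ := sAb_ne a
  have hi : Function.Injective (lin2 (fe1 T a) (fe2 T a)) := lin2_inj T a _ _ _ h1 h2 h3 h4 h5 h6
  set e1 := fe1 T a
  set e2 := fe2 T a
  have he1 : e1 ≠ 0 := by
    intro h
    have := @hi (1, 0) (0, 0) (by simp [lin2_apply, h])
    simp at this
  have p1 := nsq3_pos he1
  have hw : lin2 e1 e2 (- dot3 e1 e2, dot3 e1 e1) ≠ 0 := by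
    intro h
    have := @hi (- dot3 e1 e2, dot3 e1 e1) 0 (by rw [h, map_zero])
    have := congrArg Prod.snd this
    simp only [Prod.snd_zero] at this
    linarith
  have p2 := nsq3_pos hw
  have id : dot3 (lin2 e1 e2 (- dot3 e1 e2, dot3 e1 e1)) (lin2 e1 e2 (- dot3 e1 e2, dot3 e1 e1)) =
      dot3 e1 e1 * dot3 (cross3 e1 e2) (cross3 e1 e2) := by
    simp [lin2_apply, dot3, cross3, Fin.sum_univ_three]; ring
  rw [id] at p2
  exact (pos_iff_pos_of_mul_pos p2).1 p1

lemma outN (T : Tetra) (a : Fin 4) : ∃ κ : ℝ, κ ≠ 0 ∧ T.outNormal a = κ • cross3 (fe1 T a) (fe2 T a) := by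
  have h := N_pos T a
  have h2 : 0 < enorm3 (cross3 (fe1 T a) (fe2 T a)) := Real.sqrt_pos.2 h
  refine ⟨(if 0 < dot3 (cross3 (fe1 T a) (fe2 T a)) (T.vtx a - fx0 T a) then (-1 : ℝ) else 1) * (enorm3 (cross3 (fe1 T a) (fe2 T a)))⁻¹, ?_, ?_⟩
  · apply mul_ne_zero
    · split_ifs <;> norm_num
    · positivity
  · rw [mul_smul]; rfl

lemma outN_facts (T : Tetra) (a : Fin 4) : dot3 (fe1 T a) (T.outNormal a) = 0 ∧ dot3 (fe2 T a) (T.outNormal a) = 0 ∧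
    0 < dot3 (T.outNormal a) (T.outNormal a) := by
  obtain ⟨κ, hκ, h⟩ := outN T a
  have hp := N_pos T a
  rw [h]
  refine ⟨?_, ?_, ?_⟩
  · simp [dot3, cross3, Fin.sum_univ_three]; ring
  · simp [dot3, cross3, Fin.sum_univ_three]; ring
  · rw [dot3_smul, dot3_comm, dot3_smul, ← mul_assoc]
    have : 0 < κ * κ := mul_self_pos.2 hκ
    positivity

lemma tan_zero {k : ℕ} (hk : k = 1 ∨ k = 2) (T : Tetra) (a : Fin 4) (w : Vec → Vec)
    (hPR : PR k (fun s t => dot3 (w (fx0 T a + s • fe1 T a + t • fe2 T a)) (fe1 T a))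
      (fun s t => dot3 (w (fx0 T a + s • fe1 T a + t • fe2 T a)) (fe2 T a)))
    (he : ∀ c d, c ≠ a → d ≠ a → c ≠ d → ∀ q, PolyDeg k q → edgeMoment T c d w q = 0)
    (hf : ∀ q, MemRM k (T.outNormal a) q → faceTanMoment T a w q = 0) (x : Vec) (hx : T.lam a x = 0) :
    dot3 (w x) (fe1 T a) = 0 ∧ dot3 (w x) (fe2 T a) = 0 := by
  obtain ⟨h1, h2, h3, h4, h5, h6⟩ := sAb_ne a
  obtain ⟨n1, n2, n3⟩ := outN_facts T a
  obtain ⟨κ, hκ, hF⟩ := face_form T a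
  have hedge : ∀ b c, b ≠ a → c ≠ a → b ≠ c → ∀ m ≤ k, ∫ τ in (0:ℝ)..1, dot3 (w (T.vtx b + τ • (T.vtx c - T.vtx b))) (T.vtx c - T.vtx b) *
      τ ^ m = 0 := by
    intro b c hb hc hbc m hm
    obtain ⟨κ, hκ, hE⟩ := edge_form T b c hbc
    have := he b c hb hc hbc _ ((lam_poly T c m).mono hm)
    rw [hE] at this
    have := (mul_eq_zero.1 this).resolve_left hκ.ne'
    rw [← this]
    congr 1; funext τ
    congr 2
    have : T.vtx b + τ • (T.vtx c - T.vtx b) = T.vtx b + τ • (T.vtx c - T.vtx b) := rfl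
    rw [T.lam_add, dot3_smul, T.gl_sub, T.lam_vtx, T.lam_vtx, if_pos rfl, if_neg (Ne.symm hbc)]
    ring
  have hface : ∀ q, MemRM k (T.outNormal a) q → ∀ g : ℝ × ℝ → ℝ, (∃ C : ℝ, C ≠ 0 ∧ ∀ y, C * g y =
      dot3 (cross3 (w (fP T a y)) (T.outNormal a)) (q (fP T a y))) → ∫ y in T2, g y = 0 := by
    rintro q hq g ⟨C, hC, hg⟩
    have := hf q hq
    rw [hF] at this
    have := (mul_eq_zero.1 this).resolve_left hκ.ne'
    simp only [← hg] at this
    rw [integral_const_mul] at this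
    exact (mul_eq_zero.1 this).resolve_left hC
  set n := T.outNormal a with hn
  have hq : ∀ e, dot3 e n = 0 → ∀ v, dot3 n n * dot3 v e = dot3 (cross3 v n) (cross3 e n) := by
    intro e hen v
    have : dot3 (cross3 v n) (cross3 e n) = dot3 n n * dot3 v e - dot3 v n * dot3 e n := by
      simp [dot3, cross3, Fin.sum_univ_three]; ring
    rw [this, hen]; ring
  have hperp : ∀ e, dot3 (cross3 e n) n = 0 := by
    intro e; simp [dot3, cross3, Fin.sum_univ_three]; ring
  have key := unisolv hk hPR ?_ ?_ ?_ ?_ ?_ ?_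
  · obtain ⟨y, rfl⟩ := fP_surj T a x hx
    rw [fP_eq]
    exact ⟨key.1 y.1 y.2, key.2 y.1 y.2⟩
  · intro m hm
    have := hedge (a.succAbove 0) (a.succAbove 1) h1.symm h2.symm h4 m hm
    simpa [fx0, fe1] using this
  · intro m hm
    have := hedge (a.succAbove 0) (a.succAbove 2) h1.symm h3.symm h5 m hm
    simpa [fx0, fe2] using this
  · intro m hm
    have := hedge (a.succAbove 1) (a.succAbove 2) h2.symm h3.symm h6 m hm
    rw [← this]
    congr 1; funext τ
    congr 1
    have e : T.vtx (a.succAbove 1) + τ • (T.vtx (a.succAbove 2) - T.vtx (a.succAbove 1)) =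
      fx0 T a + (1 - τ) • fe1 T a + τ • fe2 T a := by
      simp only [fx0, fe1, fe2]; module
    have e' : T.vtx (a.succAbove 2) - T.vtx (a.succAbove 1) = fe2 T a - fe1 T a := by
      simp only [fe1, fe2]; abel
    rw [e, e', dot3_sub]
  · refine hface (fun _ => cross3 (fe1 T a) n) ⟨cross3 (fe1 T a) n, 0, hperp _, fun _ => rfl, by simp⟩ _
      ⟨dot3 n n, n3.ne', fun y => ?_⟩
    rw [← fP_eq]; exact hq _ n1 _
  · refine hface (fun _ => cross3 (fe2 T a) n) ⟨cross3 (fe2 T a) n, 0, hperp _, fun _ => rfl, by simp⟩ _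
      ⟨dot3 n n, n3.ne', fun y => ?_⟩
    rw [← fP_eq]; exact hq _ n2 _
  · intro hk2
    refine hface (fun x => cross3 (fx0 T a) n + (1:ℝ) • cross3 n x) ⟨cross3 (fx0 T a) n, 1, hperp _, by omega, fun x => rfl⟩ _
      ⟨- dot3 n n, by linarith [n3] , fun y => ?_⟩
    rw [← fP_eq]
    have e : cross3 (fx0 T a) n + (1:ℝ) • cross3 n (fP T a y) = (- y.1) • cross3 (fe1 T a) n + (- y.2) • cross3 (fe2 T a) n := by
      rw [fP_eq]
      funext i
      fin_cases i <;> simp [cross3] <;> ring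
    rw [e, dot3_add, dot3_smul, dot3_smul, ← hq _ n1, ← hq _ n2]
    ring

lemma par_N (u e1 e2 : Vec) (h1 : dot3 u e1 = 0) (h2 : dot3 u e2 = 0) (i : Fin 3) :
    dot3 (cross3 e1 e2) (cross3 e1 e2) * u i = dot3 u (cross3 e1 e2) * cross3 e1 e2 i := by
  have key : dot3 (cross3 e1 e2) (cross3 e1 e2) * u i - dot3 u (cross3 e1 e2) * cross3 e1 e2 i =
    dot3 u e2 * cross3 (cross3 e1 e2) e1 i - dot3 u e1 * cross3 (cross3 e1 e2) e2 i := by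
    fin_cases i <;> simp [dot3, cross3, Fin.sum_univ_three] <;> ring
  rw [h1, h2] at key; linarith

lemma triple_zero (u w e1 e2 ψ : Vec) (hN : 0 < dot3 (cross3 e1 e2) (cross3 e1 e2))
    (h1 : dot3 u e1 = 0) (h2 : dot3 u e2 = 0) (h3 : dot3 w e1 = 0) (h4 : dot3 w e2 = 0) :
    dot3 u (cross3 w ψ) = 0 := by
  have pu := par_N u e1 e2 h1 h2
  have pw := par_N w e1 e2 h3 h4
  set N := cross3 e1 e2
  have : dot3 N N * (dot3 N N * dot3 u (cross3 w ψ)) = 0 := by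
    have e : dot3 N N * (dot3 N N * dot3 u (cross3 w ψ)) =
      dot3 (fun i => dot3 N N * u i) (cross3 (fun i => dot3 N N * w i) ψ) := by
      simp [dot3, cross3, Fin.sum_univ_three]; ring
    rw [e]
    simp only [pu, pw]
    simp [dot3, cross3, Fin.sum_univ_three]; ring
  rcases mul_eq_zero.1 this with h | h
  · linarith
  · exact (mul_eq_zero.1 h).resolve_left hN.ne'

lemma pd_sub {f g : Vec → ℝ} (hf : ContDiff ℝ 1 f) (hg : ContDiff ℝ 1 g) (i : Fin 3) (x : Vec) :
    pd i (fun y => f y - g y) x = pd i f x - pd i g x := by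
  unfold pd
  rw [fderiv_fun_sub (hf.differentiable (by norm_num) x) (hg.differentiable (by norm_num) x)]; rfl

lemma curl_sub {v w : Vec → Vec} (hv : ∀ i, ContDiff ℝ 1 fun x => v x i) (hw : ∀ i, ContDiff ℝ 1 fun x => w x i) (x : Vec) :
    curl3 (fun x => v x - w x) x = curl3 v x - curl3 w x := by
  have := fun i j => pd_sub (hv j) (hw j) i x
  funext i
  fin_cases i <;> simp [curl3, this] <;> ring

lemma curl_cont {w : Vec → Vec} (hw : ∀ i, ContDiff ℝ 1 fun x => w x i) (i : Fin 3) : Continuous (fun x => curl3 w x i) := by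
  have := fun j l => pd_cont (hw l) j
  fin_cases i
  · exact (this 1 2).sub (this 2 1)
  · exact (this 2 0).sub (this 0 2)
  · exact (this 0 1).sub (this 1 0)

lemma curl_N {w : Vec → Vec} (hw : ∀ i, ContDiff ℝ 1 fun x => w x i) (e1 e2 x : Vec)
    (h1 : ∀ s : ℝ, dot3 (w (x + s • e1)) e2 = 0) (h2 : ∀ s : ℝ, dot3 (w (x + s • e2)) e1 = 0) :
    dot3 (curl3 w x) (cross3 e1 e2) = 0 := by
  have D : ∀ e e' : Vec, (∀ s : ℝ, dot3 (w (x + s • e)) e' = 0) → ∑ i, (∑ j, e j * pd j (fun y => w y i) x) * e' i = 0 := by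
    intro e e' h
    have hd : HasDerivAt (fun s : ℝ => dot3 (w (x + s • e)) e') (∑ i, (∑ j, e j * pd j (fun y => w y i) x) * e' i) 0 := by
      unfold dot3
      refine HasDerivAt.fun_sum fun i _ => ?_
      refine HasDerivAt.mul_const ?_ _
      have hl : HasDerivAt (fun s : ℝ => x + s • e) e 0 := by
        simpa using ((hasDerivAt_id (0:ℝ)).smul_const e).const_add x
      have hf : HasFDerivAt (fun y => w y i) (fderiv ℝ (fun y => w y i) x) (x + (0:ℝ) • e) := by
        simpa using ((hw i).differentiable (by norm_num) x).hasFDerivAt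
      have := hf.comp_hasDerivAt (0:ℝ) hl
      rw [fd_eq] at this
      exact this
    simp only [h] at hd
    exact hd.unique (hasDerivAt_const _ _)
  have d1 := D _ _ h1
  have d2 := D _ _ h2
  simp only [Fin.sum_univ_three] at d1 d2
  simp [dot3, cross3, curl3, Fin.sum_univ_three]
  linear_combination d1 - d2

lemma curl_favg_zero (T : Tetra) (a : Fin 4) (w : Vec → Vec) (hw : ∀ i, ContDiff ℝ 1 fun x => w x i)
    (hz : ∀ x, T.lam a x = 0 → dot3 (w x) (fe1 T a) = 0 ∧ dot3 (w x) (fe2 T a) = 0)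
    (hf : ∀ q, MemRT (T.outNormal a) q → faceTanMoment T a (curl3 w) q = 0) (i : Fin 3) :
    favg (T.face a) (fun x => curl3 w x i) = 0 := by
  obtain ⟨h1, h2, h3, h4, h5, h6⟩ := sAb_ne a
  obtain ⟨n1, n2, n3⟩ := outN_facts T a
  obtain ⟨κ, hκ, hF⟩ := face_form T a
  obtain ⟨κ', hκ', hn⟩ := outN T a
  rw [favg_p2 T a _ _ _ h1 h2 h3 h4 h5 h6]
  change (∫ y in T2, curl3 w (fP T a y) i) / tau2 = 0
  set n := T.outNormal a
  have hcN : ∀ y, dot3 (curl3 w (fP T a y)) n = 0 := by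
    intro y
    rw [hn, dot3_smul, curl_N hw, mul_zero]
    · intro s
      have : fP T a y + s • fe1 T a = fP T a (y.1 + s, y.2) := by rw [fP_eq, fP_eq]; module
      rw [this]; exact (hz _ (fP_lam T a _).1).2
    · intro s
      have : fP T a y + s • fe2 T a = fP T a (y.1, y.2 + s) := by rw [fP_eq, fP_eq]; module
      rw [this]; exact (hz _ (fP_lam T a _).1).1
  have hint : ∀ j, IntegrableOn (fun y => curl3 w (fP T a y) j) T2 := fun j =>
    ci T2_compact ((curl_cont hw j).comp (fP_cont T a))
  set m : Vec := fun j => ∫ y in T2, curl3 w (fP T a y) j with hm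
  have hlin : ∀ u : Vec, ∫ y in T2, dot3 (curl3 w (fP T a y)) u = dot3 m u := by
    intro u
    unfold dot3
    rw [integral_finsetSum _ (fun j _ => (hint j).mul_const _)]
    refine Finset.sum_congr rfl fun j _ => ?_
    rw [integral_mul_const]
  have mn : dot3 m n = 0 := by
    rw [← hlin]; simp only [hcN]; simp
  have t := hf (fun _ => cross3 m n) ⟨cross3 m n, 0, by simp [dot3, cross3, Fin.sum_univ_three]; ring, by simp⟩
  rw [hF] at t
  have t := (mul_eq_zero.1 t).resolve_left hκ.ne'
  have e : ∀ y, dot3 (cross3 (curl3 w (fP T a y)) n) (cross3 m n) = dot3 (curl3 w (fP T a y)) (dot3 n n • m) := by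
    intro y
    have : dot3 (cross3 (curl3 w (fP T a y)) n) (cross3 m n) =
      dot3 (curl3 w (fP T a y)) (dot3 n n • m) - dot3 (curl3 w (fP T a y)) n * dot3 m n := by
      simp [dot3, cross3, Fin.sum_univ_three]; ring
    rw [this, mn]; ring
  simp only [e] at t
  rw [hlin, dot3_smul] at t
  have t := (mul_eq_zero.1 t).resolve_left n3.ne'
  have m0 : m = 0 := by
    by_contra h
    have := nsq3_pos h
    linarith
  have : (∫ y in T2, curl3 w (fP T a y) i) = 0 := congrFun m0 i
  rw [this, zero_div]

lemma vec_cont {v : Vec → Vec} (hv : ∀ i, ContDiff ℝ 1 fun x => v x i) : Continuous v :=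
  continuous_pi fun i => (hv i).continuous

lemma dot3_cont {X : Type*} [TopologicalSpace X] {f g : X → Vec} (hf : Continuous f) (hg : Continuous g) : Continuous fun x => dot3 (f x) (g x) := by
  unfold dot3
  exact continuous_finsetSum _ fun i _ => ((continuous_apply i).comp hf).mul ((continuous_apply i).comp hg)
lemma cross3_cont {X : Type*} [TopologicalSpace X] {f g : X → Vec} (hf : Continuous f) (hg : Continuous g) : Continuous fun x => cross3 (f x) (g x) := by
  have h1 := fun i => (continuous_apply i).comp hf
  have h2 := fun i => (continuous_apply i).comp hg
  refine continuous_pi fun i => ?_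
  fin_cases i
  · exact ((h1 1).mul (h2 2)).sub ((h1 2).mul (h2 1))
  · exact ((h1 2).mul (h2 0)).sub ((h1 0).mul (h2 2))
  · exact ((h1 0).mul (h2 1)).sub ((h1 1).mul (h2 0))

lemma sub_dot3 (u v w : Vec) : dot3 (u - v) w = dot3 u w - dot3 v w := by
  simp [dot3, Fin.sum_univ_three]; ring
lemma sub_cross3 (u v w : Vec) : cross3 (u - v) w = cross3 u w - cross3 v w := by
  funext i; fin_cases i <;> simp [cross3] <;> ring

lemma edge_sub (T : Tetra) (b c : Fin 4) (hbc : b ≠ c) {v w : Vec → Vec} (hv : Continuous v) (hw : Continuous w) {q : Vec → ℝ}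
    (hq : Continuous q) : edgeMoment T b c (fun x => v x - w x) q = edgeMoment T b c v q - edgeMoment T b c w q := by
  obtain ⟨κ, hκ, h⟩ := edge_form T b c hbc
  rw [h, h, h, ← mul_sub, ← intervalIntegral.integral_sub]
  · congr 2; funext τ; rw [sub_dot3]; ring
  · apply Continuous.intervalIntegrable
    exact (dot3_cont (hv.comp (by fun_prop)) continuous_const).mul (hq.comp (by fun_prop))
  · apply Continuous.intervalIntegrable
    exact (dot3_cont (hw.comp (by fun_prop)) continuous_const).mul (hq.comp (by fun_prop))

lemma face_sub (T : Tetra) (a : Fin 4) {v w q : Vec → Vec} (hv : Continuous v) (hw : Continuous w)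
    (hq : Continuous q) : faceTanMoment T a (fun x => v x - w x) q = faceTanMoment T a v q - faceTanMoment T a w q := by
  obtain ⟨κ, hκ, h⟩ := face_form T a
  have hP := fP_cont T a
  rw [h, h, h, ← mul_sub, ← integral_sub]
  · congr 2; funext τ; rw [sub_cross3, sub_dot3]
  · exact ci T2_compact (dot3_cont (cross3_cont (hv.comp hP) continuous_const) (hq.comp hP))
  · exact ci T2_compact (dot3_cont (cross3_cont (hw.comp hP) continuous_const) (hq.comp hP))

lemma MemRM.cont {k : ℕ} {n : Vec} {q : Vec → Vec} (h : MemRM k n q) : Continuous q := by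
  obtain ⟨a, c, _, _, h⟩ := h
  have : q = fun x => a + c • cross3 n x := funext h
  rw [this]
  have := cross3_cont (X := Vec) (f := fun _ => n) (g := fun x => x) continuous_const continuous_id
  fun_prop
lemma MemRT.cont {n : Vec} {q : Vec → Vec} (h : MemRT n q) : Continuous q := by
  obtain ⟨a, c, _, h⟩ := h
  have : q = fun x => a + c • (x - dot3 x n • n) := funext h
  rw [this]
  have := dot3_cont (X := Vec) (f := fun x => x) (g := fun _ => n) continuous_id continuous_const
  fun_prop

lemma MemW.c1 {k : ℕ} {T : Tetra} {v : Vec → Vec} (h : MemW k T v) (i : Fin 3) : ContDiff ℝ 1 (fun x => v x i) :=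
  (h.smooth i).of_le (by exact_mod_cast le_top)

lemma edge_sub_face (T : Tetra) (a c d : Fin 4) (hc : c ≠ a) (hd : d ≠ a) : T.edge c d ⊆ T.face a :=
  (convex_convexHull ℝ _).segment_subset (subset_convexHull _ _ ⟨c, hc, rfl⟩) (subset_convexHull _ _ ⟨d, hd, rfl⟩)

lemma tan_bd {k : ℕ} (hk : k = 1 ∨ k = 2) {M : Mesh} {Ω : Set Vec} {v : DiscVF M} (hv : MemWh0 k M Ω v)
    (i : Fin M.n) (a : Fin 4) (hb : (M.el i).face a ⊆ frontier Ω) :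
    (∀ x, (M.el i).lam a x = 0 → dot3 (v i x) (fe1 (M.el i) a) = 0 ∧ dot3 (v i x) (fe2 (M.el i) a) = 0) ∧
    ∀ α, favg ((M.el i).face a) (fun x => curl3 (v i) x α) = 0 := by
  obtain ⟨⟨hW, hE, hRM, hRT, hE0, hRM0⟩, hRT0⟩ := hv
  have h := tan_zero hk (M.el i) a (v i) (pr_of_W hk (hW i) a _ _ _ (fun s t => by
      have := (fP_lam (M.el i) a (s, t)).1; rwa [fP_eq] at this))
    (fun c d hc hd hcd q hq => hE0 i c d ((edge_sub_face _ a c d hc hd).trans hb) q hq) (fun q hq => hRM0 i a hb q hq)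
  exact ⟨h, curl_favg_zero _ a _ (hW i).c1 h (fun q hq => hRT0 i a hb q hq)⟩

lemma tan_in {k : ℕ} (hk : k = 1 ∨ k = 2) {M : Mesh} {Ω : Set Vec} {v : DiscVF M} (hv : MemWh0 k M Ω v)
    (i j : Fin M.n) (a b : Fin 4) (hij : i ≠ j) (hs : Shr (M.el i) (M.el j) a b) :
    (∀ x, (M.el i).lam a x = 0 → dot3 (v i x - v j x) (fe1 (M.el i) a) = 0 ∧ dot3 (v i x - v j x) (fe2 (M.el i) a) = 0) ∧
    ∀ α, favg ((M.el i).face a) (fun x => curl3 (v i) x α) = favg ((M.el i).face a) (fun x => curl3 (v j) x α) := by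
  obtain ⟨⟨hW, hE, hRM, hRT, hE0, hRM0⟩, hRT0⟩ := hv
  have hpl : ∀ s t : ℝ, (M.el i).lam a (fx0 (M.el i) a + s • fe1 (M.el i) a + t • fe2 (M.el i) a) = 0 := fun s t => by
      have := (fP_lam (M.el i) a (s, t)).1; rwa [fP_eq] at this
  have p1 := pr_of_W hk (hW i) a _ _ _ hpl
  have p2 := pr_of_W hk (hW j) b (fx0 (M.el i) a) (fe1 (M.el i) a) (fe2 (M.el i) a)
    (fun s t => by rw [hs.lam, hpl, mul_zero])
  have p := p1.sub p2
  have ci1 := vec_cont (hW i).c1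
  have cj1 := vec_cont (hW j).c1
  have h := tan_zero hk (M.el i) a (fun x => v i x - v j x) (by simpa only [sub_dot3] using p)
    (fun c d hc hd hcd q hq => by
      rw [edge_sub _ _ _ hcd ci1 cj1 (hq.smooth (m := 0)).continuous, sub_eq_zero]
      obtain ⟨c', _, e1⟩ := hs.vtx hc
      obtain ⟨d', _, e2⟩ := hs.vtx hd
      exact hE i j c d c' d' hij (by unfold Tetra.edge; rw [e1, e2]) q hq)
    (fun q hq => by
      rw [face_sub _ _ ci1 cj1 hq.cont, sub_eq_zero]
      exact hRM i j a b hij hs.face q hq)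
  refine ⟨h, fun α => ?_⟩
  have g := curl_favg_zero (M.el i) a (fun x => v i x - v j x) (fun l => ((hW i).c1 l).sub ((hW j).c1 l)) h
    (fun q hq => by
      have e : curl3 (fun x => v i x - v j x) = fun x => curl3 (v i) x - curl3 (v j) x :=
        funext fun x => curl_sub (hW i).c1 (hW j).c1 x
      rw [e, face_sub _ _ (continuous_pi (curl_cont (hW i).c1)) (continuous_pi (curl_cont (hW j).c1)) hq.cont, sub_eq_zero]
      exact hRT i j a b hij hs.face q hq) α
  simp only [curl_sub (hW i).c1 (hW j).c1] at g
  have := favg_sub (M.el i) a (curl_cont (hW i).c1 α) (curl_cont (hW j).c1 α)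
  simp only [Pi.sub_apply] at g
  rw [this] at g
  linarith

lemma pd_mul {f g : Vec → ℝ} (hf : ContDiff ℝ 1 f) (hg : ContDiff ℝ 1 g) (i : Fin 3) (x : Vec) :
    pd i (fun y => f y * g y) x = f x * pd i g x + pd i f x * g x := by
  unfold pd
  rw [fderiv_fun_mul (hf.differentiable (by norm_num) x) (hg.differentiable (by norm_num) x)]
  simp [mul_comm]

lemma nu_perp (T : Tetra) (a : Fin 4) : dot3 (nu T a) (fe1 T a) = 0 ∧ dot3 (nu T a) (fe2 T a) = 0 := by
  obtain ⟨h1, h2, h3, h4, h5, h6⟩ := sAb_ne a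
  have e : nu T a = (3 * vol T) • T.gl a := rfl
  refine ⟨?_, ?_⟩
  · rw [e, dot3_comm, dot3_smul, dot3_comm]; unfold fe1
    rw [T.gl_sub, T.lam_vtx, T.lam_vtx, if_neg h2, if_neg h1]; ring
  · rw [e, dot3_comm, dot3_smul, dot3_comm]; unfold fe2
    rw [T.gl_sub, T.lam_vtx, T.lam_vtx, if_neg h3, if_neg h1]; ring

lemma div_vec (T : Tetra) (G : Vec → Vec) (hG : ∀ i, ContDiff ℝ 1 fun x => G x i) :
    ∫ x in T.K, ∑ i, pd i (fun y => G y i) x = - ∑ a, favg (T.face a) (fun x => dot3 (nu T a) (G x)) := by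
  rw [integral_finsetSum _ (fun i _ => ci (K_compact T) (pd_cont (hG i) i))]
  simp only [div_thm T _ _ (hG _)]
  rw [Finset.sum_neg_distrib, Finset.sum_comm]
  congr 1
  refine Finset.sum_congr rfl fun a _ => ?_
  unfold dot3
  rw [favg_sum T a Finset.univ (f := fun i x => nu T a i * G x i) (fun i => by have := (hG i).continuous; fun_prop)]
  refine Finset.sum_congr rfl fun i _ => ?_
  rw [favg_mul]

lemma cross_c1 {v ψ : Vec → Vec} (hv : ∀ i, ContDiff ℝ 1 fun x => v x i) (hψ : ∀ i, ContDiff ℝ 1 fun x => ψ x i)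
    (i : Fin 3) : ContDiff ℝ 1 fun x => cross3 (v x) (ψ x) i := by
  fin_cases i
  · exact ((hv 1).mul (hψ 2)).sub ((hv 2).mul (hψ 1))
  · exact ((hv 2).mul (hψ 0)).sub ((hv 0).mul (hψ 2))
  · exact ((hv 0).mul (hψ 1)).sub ((hv 1).mul (hψ 0))

lemma div_cross {v ψ : Vec → Vec} (hv : ∀ i, ContDiff ℝ 1 fun x => v x i) (hψ : ∀ i, ContDiff ℝ 1 fun x => ψ x i) (x : Vec) :
    ∑ i, pd i (fun y => cross3 (v y) (ψ y) i) x = dot3 (curl3 v x) (ψ x) - dot3 (v x) (curl3 ψ x) := by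
  have h : ∀ i j l : Fin 3, pd i (fun y => v y j * ψ y l - v y l * ψ y j) x =
      (v x j * pd i (fun y => ψ y l) x + pd i (fun y => v y j) x * ψ x l) -
      (v x l * pd i (fun y => ψ y j) x + pd i (fun y => v y l) x * ψ x j) := by
    intro i j l
    rw [pd_sub ((hv j).mul (hψ l)) ((hv l).mul (hψ j)), pd_mul (hv j) (hψ l), pd_mul (hv l) (hψ j)]
  rw [Fin.sum_univ_three]
  have e0 := h 0 1 2
  have e1 := h 1 2 0
  have e2 := h 2 0 1
  simp only [cross3, Matrix.cons_val_zero, Matrix.cons_val_one, Matrix.cons_val] at *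
  rw [e0, e1, e2]
  simp [dot3, curl3, Fin.sum_univ_three]
  ring

lemma conf {k : ℕ} (hk : k = 1 ∨ k = 2) {M : Mesh} {Ω : Set Vec} (hc : M.Covers Ω) {v : DiscVF M} (hv : MemWh0 k M Ω v)
    {ψ : Vec → Vec} (hψ : ∀ i, ContDiff ℝ 1 fun x => ψ x i) :
    ∑ i, ∫ x in (M.el i).K, (dot3 (curl3 (v i) x) (ψ x) - dot3 (v i x) (curl3 ψ x)) = 0 := by
  have hW := hv.1.1
  have hcp := fun i => vec_cont (hW i).c1
  have hcψ := vec_cont hψ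
  simp only [← div_cross (hW _).c1 hψ]
  have : ∀ i, ∫ x in (M.el i).K, ∑ l, pd l (fun y => cross3 (v i y) (ψ y) l) x =
    - ∑ a, favg ((M.el i).face a) (fun x => dot3 (nu (M.el i) a) (cross3 (v i x) (ψ x))) := fun i =>
    div_vec _ (fun y => cross3 (v i y) (ψ y)) (cross_c1 (hW i).c1 hψ)
  simp only [this]
  rw [Finset.sum_neg_distrib, neg_eq_zero]
  refine cancel M Ω hc _ ?_ ?_
  · intro i j a b hij hs
    rw [← hs.face, ← favg_add _ _ (dot3_cont continuous_const (cross3_cont (hcp i) hcψ)) (dot3_cont continuous_const (cross3_cont (hcp j) hcψ))]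
    rw [favg_congr (M.el i) a (g := fun _ => 0), favg_const]
    intro x hx
    have hx := ((mem_face _ _ _).1 hx).2
    have ht := (tan_in hk hv i j a b hij hs).1 x hx
    have hn : nu (M.el j) b = - nu (M.el i) a := funext fun l => hs.nu (M.disj i j hij) l
    have z := triple_zero (nu (M.el i) a) _ _ _ (ψ x) (N_pos (M.el i) a) (nu_perp _ a).1 (nu_perp _ a).2 ht.1 ht.2
    rw [hn]
    rw [sub_cross3, dot3_sub] at z
    rw [dot3_comm (-_)]
    have : dot3 (cross3 (v j x) (ψ x)) (- nu (M.el i) a) = - dot3 (nu (M.el i) a) (cross3 (v j x) (ψ x)) := by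
      rw [dot3_comm (nu _ _), ← neg_one_smul ℝ, dot3_smul]; ring
    rw [this]; linarith
  · intro i a hb
    rw [favg_congr (M.el i) a (g := fun _ => 0), favg_const]
    intro x hx
    have hx := ((mem_face _ _ _).1 hx).2
    have ht := (tan_bd hk hv i a hb).1 x hx
    exact triple_zero (nu (M.el i) a) _ _ _ (ψ x) (N_pos (M.el i) a) (nu_perp _ a).1 (nu_perp _ a).2 ht.1 ht.2

/-- scalar broken integration by parts -/
lemma cons_id {M : Mesh} {Ω : Set Vec} (hc : M.Covers Ω) {w : Fin M.n → Vec → ℝ} (hw : ∀ i, ContDiff ℝ 1 (w i))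
    (h1 : ∀ i j a b, i ≠ j → Shr (M.el i) (M.el j) a b → favg ((M.el i).face a) (w i) = favg ((M.el i).face a) (w j))
    (h2 : ∀ i a, (M.el i).face a ⊆ frontier Ω → favg ((M.el i).face a) (w i) = 0)
    {g : Vec → ℝ} (hg : ContDiff ℝ 1 g) (b : Fin 3) :
    ∑ i, ∫ x in (M.el i).K, (g x * pd b (w i) x + pd b g x * w i x) =
    - ∑ i, ∑ a, nu (M.el i) a b * favg ((M.el i).face a) (fun x => (g x - kavg (M.el i) g) * (w i x - favg ((M.el i).face a) (w i))) := by
  have hcan : ∑ i, ∑ a, nu (M.el i) a b * (favg ((M.el i).face a) g * favg ((M.el i).face a) (w i)) = 0 := by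
    refine cancel M Ω hc _ ?_ ?_
    · intro i j a c hij hs
      rw [hs.nu (M.disj i j hij), ← hs.face, h1 i j a c hij hs]; ring
    · intro i a hb
      rw [h2 i a hb]; ring
  have e : ∀ i a, favg ((M.el i).face a) (fun x => (g x - kavg (M.el i) g) * (w i x - favg ((M.el i).face a) (w i))) =
      favg ((M.el i).face a) (fun x => g x * w i x) - favg ((M.el i).face a) g * favg ((M.el i).face a) (w i) := by
    intro i a
    set W := favg ((M.el i).face a) (w i) with hW
    set κ := kavg (M.el i) g
    have hgc := hg.continuous
    have hwc := (hw i).continuous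
    have : (fun x => (g x - κ) * (w i x - W)) = fun x => (g x * w i x - W * g x) - (κ * w i x - κ * W) := by
      funext x; ring
    rw [this, favg_sub _ _ (by fun_prop) (by fun_prop), favg_sub _ _ (by fun_prop) (by fun_prop),
      favg_sub _ _ (by fun_prop) (by fun_prop), favg_mul, favg_mul, favg_const, ← hW]
    ring
  simp only [e]
  simp only [mul_sub, Finset.sum_sub_distrib, hcan, sub_zero]
  rw [← Finset.sum_neg_distrib]
  refine Finset.sum_congr rfl fun i _ => ?_
  rw [← div_thm _ b _ (hg.mul (hw i))]
  congr 1; funext x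
  exact (pd_mul hg (hw i) b x).symm

lemma diam_le_h (M : Mesh) (i : Fin M.n) : Metric.diam (M.el i).K ≤ M.hsize :=
  le_ciSup (f := fun i => Metric.diam (M.el i).K) (Set.finite_range _).bddAbove i

lemma int_nn (K : Set Vec) {f : Vec → ℝ} (h : ∀ x, 0 ≤ f x) : 0 ≤ ∫ x in K, f x := integral_nonneg h

/-- Global bounds of the broken integration by parts residual. -/
lemma cons_bound {ρ : ℝ} (hρ : 0 < ρ) {M : Mesh} {Ω : Set Vec} (hc : M.Covers Ω) (hs : Mesh.ShapeReg ρ M)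
    {w : Fin M.n → Vec → ℝ} (hw : ∀ i, ContDiff ℝ 1 (w i))
    (h1 : ∀ i j a b, i ≠ j → Shr (M.el i) (M.el j) a b → favg ((M.el i).face a) (w i) = favg ((M.el i).face a) (w j))
    (h2 : ∀ i a, (M.el i).face a ⊆ frontier Ω → favg ((M.el i).face a) (w i) = 0)
    {g : Vec → ℝ} (hg : ContDiff ℝ 1 g) (b : Fin 3) :
    (∑ i, ∫ x in (M.el i).K, (g x * pd b (w i) x + pd b g x * w i x) ≤
      256 / ρ * M.hsize * (√(∑ i, ∫ x in (M.el i).K, nsq3 (grad3 (w i) x)) * √(∑ i, ∫ x in (M.el i).K, nsq3 (grad3 g x)))) ∧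
    (∑ i, ∫ x in (M.el i).K, (g x * pd b (w i) x + pd b g x * w i x) ≤
      256 / ρ * √M.hsize * (√(∑ i, ∫ x in (M.el i).K, nsq3 (grad3 (w i) x)) *
        √(√(∑ i, ∫ x in (M.el i).K, g x ^ 2) * √(∑ i, ∫ x in (M.el i).K, nsq3 (grad3 g x))))) := by
  set W := fun i => ∫ x in (M.el i).K, nsq3 (grad3 (w i) x) with hW
  set D := fun i => ∫ x in (M.el i).K, nsq3 (grad3 g x) with hD
  set G := fun i => ∫ x in (M.el i).K, g x ^ 2 with hG
  have W0 : ∀ i, 0 ≤ W i := fun i => int_nn _ fun x => nsq3_nonneg _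
  have D0 : ∀ i, 0 ≤ D i := fun i => int_nn _ fun x => nsq3_nonneg _
  have G0 : ∀ i, 0 ≤ G i := fun i => int_nn _ fun x => sq_nonneg _
  have key : ∑ i, ∫ x in (M.el i).K, (g x * pd b (w i) x + pd b g x * w i x) ≤
      ∑ i, 256 / ρ * (√(W i) * min (Metric.diam (M.el i).K * √(D i)) (√(Metric.diam (M.el i).K * (√(G i) * √(D i))))) := by
    rw [cons_id hc hw h1 h2 hg b]
    refine (le_abs_self _).trans ?_
    rw [abs_neg]
    refine (Finset.abs_sum_le_sum_abs _ _).trans (Finset.sum_le_sum fun i _ => ?_)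
    refine (Finset.abs_sum_le_sum_abs _ _).trans ?_
    obtain ⟨x, hx⟩ := hs i
    refine (Finset.sum_le_sum fun a _ => loc_bound (M.el i) hρ hx a b hg (hw i)).trans ?_
    simp only [Finset.sum_const, Finset.card_univ, Fintype.card_fin, nsmul_eq_mul]
    apply le_of_eq
    push_cast
    ring
  have c0 : 0 ≤ 256 / ρ := by positivity
  have hh : 0 ≤ M.hsize := Metric.diam_nonneg.trans (diam_le_h M ⟨0, M.npos⟩)
  constructor
  · refine key.trans ?_
    rw [← Finset.mul_sum, mul_assoc]
    refine mul_le_mul_of_nonneg_left ?_ c0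
    refine le_trans ?_ (mul_le_mul_of_nonneg_left (Real.sum_sqrt_mul_sqrt_le Finset.univ W0 D0) hh)
    rw [Finset.mul_sum]
    refine Finset.sum_le_sum fun i _ => ?_
    have := mul_le_mul_of_nonneg_right (diam_le_h M i) (Real.sqrt_nonneg (D i))
    have := mul_le_mul_of_nonneg_left ((min_le_left _ (√(Metric.diam (M.el i).K * (√(G i) * √(D i))))).trans this) (Real.sqrt_nonneg (W i))
    linarith
  · refine key.trans ?_
    rw [← Finset.mul_sum, mul_assoc]
    refine mul_le_mul_of_nonneg_left ?_ c0
    have s1 := Real.sum_sqrt_mul_sqrt_le Finset.univ W0 (fun i => mul_nonneg (Real.sqrt_nonneg (G i)) (Real.sqrt_nonneg (D i)))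
    have s2 := Real.sqrt_le_sqrt (Real.sum_sqrt_mul_sqrt_le Finset.univ G0 D0)
    refine le_trans ?_ (mul_le_mul_of_nonneg_left (s1.trans (mul_le_mul_of_nonneg_left s2 (Real.sqrt_nonneg _))) (Real.sqrt_nonneg _))
    rw [Finset.mul_sum]
    refine Finset.sum_le_sum fun i _ => ?_
    have := mul_le_mul_of_nonneg_right (Real.sqrt_le_sqrt (diam_le_h M i)) (Real.sqrt_nonneg (√(G i) * √(D i)))
    rw [← Real.sqrt_mul Metric.diam_nonneg] at this
    have := mul_le_mul_of_nonneg_left ((min_le_right (Metric.diam (M.el i).K * √(D i)) _).trans this) (Real.sqrt_nonneg (W i))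
    linarith

/-! ### element integrals versus integrals over the domain -/

lemma el_sub {M : Mesh} {Ω : Set Vec} (hc : M.Covers Ω) (i : Fin M.n) : (M.el i).K ⊆ closure Ω := by
  rw [hc.2.1]; exact Set.subset_iUnion (fun i => (M.el i).K) i

lemma cl_ae {Ω : Set Vec} (hconv : Convex ℝ Ω) : (closure Ω : Set Vec) =ᵐ[volume] Ω :=
  closure_ae_eq_of_null_frontier (hconv.addHaar_frontier volume)

lemma intOn_el {M : Mesh} {Ω : Set Vec} (hc : M.Covers Ω) (hconv : Convex ℝ Ω) {F : Vec → ℝ} (hF : IntegrableOn F Ω)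
    (i : Fin M.n) : IntegrableOn F (M.el i).K :=
  (hF.congr_set_ae (cl_ae hconv)).mono_set (el_sub hc i)

lemma sum_el {M : Mesh} {Ω : Set Vec} (hc : M.Covers Ω) (hconv : Convex ℝ Ω) {F : Vec → ℝ} (hF : IntegrableOn F Ω) :
    ∑ i, ∫ x in (M.el i).K, F x = ∫ x in Ω, F x := by
  have h := hF.congr_set_ae (cl_ae hconv)
  rw [hc.2.1] at h
  rw [← setIntegral_congr_set (cl_ae hconv), hc.2.1, integral_iUnion_ae _ _ h, tsum_fintype]
  · exact fun i => (K_compact _).measurableSet.nullMeasurableSet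
  · intro i j hij
    have hz : volume (frontier (M.el i).K ∪ frontier (M.el j).K) = 0 :=
      measure_union_null ((K_convex _).addHaar_frontier volume) ((K_convex _).addHaar_frontier volume)
    refine measure_mono_null ?_ hz
    rintro x ⟨hx, hy⟩
    by_cases h1 : x ∈ interior (M.el i).K
    · by_cases h2 : x ∈ interior (M.el j).K
      · have : x ∈ interior (M.el i).K ∩ interior (M.el j).K := ⟨h1, h2⟩
        rw [M.disj i j hij] at this; exact this.elim
      · exact Or.inr ⟨subset_closure hy, h2⟩
    · exact Or.inl ⟨subset_closure hx, h1⟩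

/-- mollification after a shrinking towards `x0` -/
def Rm (η : Vec → ℝ) (x0 : Vec) (t : ℝ) (F : Vec → ℝ) (x : Vec) : ℝ :=
  ∫ z, η z * F ((1 - t) • x + t • (x0 - z))

lemma arg_eq {t : ℝ} (ht : t ≠ 0) (x x0 z : Vec) :
    (1 - t) • x + t • (x0 - z) = t • (((1 - t) / t) • x + x0 - z) := by
  funext i; simp; field_simp; ring

lemma rm_conv (η : Vec → ℝ) (x0 : Vec) {t : ℝ} (ht : t ≠ 0) (F : Vec → ℝ) :
    Rm η x0 t F = fun x => convolution η (fun z => F (t • z)) (ContinuousLinearMap.lsmul ℝ ℝ) volume (((1 - t) / t) • x + x0) := by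
  funext x
  rw [convolution_lsmul]
  unfold Rm
  congr 1; funext z
  rw [smul_eq_mul]
  congr 2
  exact arg_eq ht x x0 z

lemma rm_c1 {η : Vec → ℝ} (hη : TestS η) (x0 : Vec) {t : ℝ} (ht : t ≠ 0) {F : Vec → ℝ} (hF : Integrable F) :
    ContDiff ℝ 1 (Rm η x0 t F) := by
  rw [rm_conv η x0 ht F]
  have h := HasCompactSupport.contDiff_convolution_left (n := 1) (ContinuousLinearMap.lsmul ℝ ℝ) hη.2
    (hη.1.of_le (by exact_mod_cast le_top)) (hF.comp_smul ht).locallyIntegrable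
  exact h.comp (f := fun x : Vec => ((1 - t) / t) • x + x0) (by fun_prop)

lemma rm_pd {η : Vec → ℝ} (hη : TestS η) (x0 : Vec) {t : ℝ} (ht : t ≠ 0) {F : Vec → ℝ} (hF : Integrable F) (i : Fin 3) (x : Vec) :
    pd i (Rm η x0 t F) x = (1 - t) / t * ∫ z, pd i η z * F ((1 - t) • x + t • (x0 - z)) := by
  have hη1 : ContDiff ℝ 1 η := hη.1.of_le (by exact_mod_cast le_top)
  have hl := (hF.comp_smul ht).locallyIntegrable
  have h := HasCompactSupport.hasFDerivAt_convolution_left (ContinuousLinearMap.lsmul ℝ ℝ) hη.2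
    hη1 hl (((1 - t) / t) • x + x0)
  have h2 : HasFDerivAt (fun x : Vec => ((1 - t) / t) • x + x0) (((1 - t) / t) • ContinuousLinearMap.id ℝ Vec) x := by
    exact ((hasFDerivAt_id (𝕜 := ℝ) x).const_smul ((1 - t) / t)).add_const _
  have h3 := h.comp x h2
  unfold pd
  rw [rm_conv η x0 ht F]
  have h4 := h3.fderiv
  simp only [Function.comp_def] at h4
  rw [h4]
  simp only [ContinuousLinearMap.comp_apply, _root_.smul_apply, ContinuousLinearMap.id_apply, map_smul, smul_eq_mul]
  congr 1
  rw [convolution_def]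
  have hce := HasCompactSupport.convolutionExists_left ((ContinuousLinearMap.lsmul ℝ ℝ).precompL Vec)
    (hη.2.fderiv ℝ) (hη1.continuous_fderiv (by norm_num)) hl (((1 - t) / t) • x + x0)
  rw [ContinuousLinearMap.integral_apply hce.integrable]
  congr 1; funext z
  simp only [ContinuousLinearMap.precompL_apply, ContinuousLinearMap.lsmul_apply, smul_eq_mul]
  congr 2
  exact (arg_eq ht x x0 z).symm

lemma cov (h : Vec → ℝ) (c : Vec) (t : ℝ) : ∫ z, h (c - t • z) = |(t ^ 3)⁻¹| * ∫ y, h y := by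
  have := Measure.integral_comp_smul volume (fun y => h (c - y)) t
  rw [this, integral_sub_left_eq_self h volume c]
  simp

lemma rm_div {η : Vec → ℝ} (hη : TestS η) {Ω : Set Vec} (x0 : Vec) {t : ℝ} (ht : 0 < t) {F : Fin 3 → Vec → ℝ} {H : Vec → ℝ}
    (hF : ∀ i, Integrable (F i))
    (hW : ∀ φ, TestS φ → tsupport φ ⊆ Ω → ∫ x, H x * φ x = - ∑ i, ∫ x, F i x * pd i φ x) (x : Vec)
    (hx : ∀ z ∈ tsupport η, (1 - t) • x + t • (x0 - z) ∈ Ω) :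
    ∑ i, pd i (Rm η x0 t (F i)) x = (1 - t) * Rm η x0 t H x := by
  have ht0 := ht.ne'
  simp only [rm_pd hη x0 ht0 (hF _)]
  set c := (1 - t) • x + t • x0 with hc
  have e : ∀ z, (1 - t) • x + t • (x0 - z) = c - t • z := by intro z; rw [hc, smul_sub]; abel
  unfold Rm
  simp only [e] at hx ⊢
  set φ : Vec → ℝ := fun y => η (t⁻¹ • (c - y)) with hφ
  have hz : ∀ z, t⁻¹ • (c - (c - t • z)) = z := by
    intro z; rw [sub_sub_cancel, smul_smul, inv_mul_cancel₀ ht0, one_smul]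
  have hz2 : ∀ y, c - t • (t⁻¹ • (c - y)) = y := by
    intro y; rw [smul_smul, mul_inv_cancel₀ ht0, one_smul, sub_sub_cancel]
  have hsub : tsupport φ ⊆ (fun y => t⁻¹ • (c - y)) ⁻¹' tsupport η :=
    tsupport_comp_subset_preimage η (f := fun y => t⁻¹ • (c - y)) (by fun_prop)
  have hT : TestS φ := by
    refine ⟨hη.1.comp (f := fun y : Vec => t⁻¹ • (c - y)) (by fun_prop), ?_⟩
    refine HasCompactSupport.intro (K := (fun z => c - t • z) '' tsupport η) (hη.2.isCompact.image (by fun_prop)) ?_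
    intro y hy
    by_contra h
    exact hy ⟨t⁻¹ • (c - y), subset_tsupport _ h, hz2 y⟩
  have hS : tsupport φ ⊆ Ω := by
    intro y hy
    have := hx _ (hsub hy)
    rwa [hz2] at this
  have hpd : ∀ i y, pd i φ y = - t⁻¹ * pd i η (t⁻¹ • (c - y)) := by
    intro i y
    have h1 : HasFDerivAt (fun y : Vec => t⁻¹ • (c - y)) (t⁻¹ • (- ContinuousLinearMap.id ℝ Vec)) y := by
      exact ((hasFDerivAt_id (𝕜 := ℝ) y).const_sub c).const_smul t⁻¹
    have h2 := ((hη.1.differentiable (by simp)) (t⁻¹ • (c - y))).hasFDerivAt.comp y h1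
    unfold pd
    have := h2.fderiv
    simp only [Function.comp_def] at this
    rw [hφ, this]
    simp
  have key := hW φ hT hS
  have c1 : ∫ z, η z * H (c - t • z) = |(t ^ 3)⁻¹| * ∫ y, H y * φ y := by
    rw [← cov _ c t]
    congr 1; funext z; rw [hφ]; simp only [hz]; ring
  have c2 : ∀ i, ∫ z, pd i η z * F i (c - t • z) = |(t ^ 3)⁻¹| * (- t * ∫ y, F i y * pd i φ y) := by
    intro i
    rw [← integral_const_mul, ← cov _ c t]
    congr 1; funext z; rw [hpd]; simp only [hz]
    field_simp
  rw [c1, key]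
  simp only [c2]
  rw [← Finset.mul_sum, ← Finset.mul_sum, ← Finset.mul_sum]
  field_simp

lemma rm_int {η : Vec → ℝ} (hη : TestS η) (x0 : Vec) {t : ℝ} (ht : t ≠ 0) {F : Vec → ℝ} (hF : Integrable F) (x : Vec) :
    Integrable fun z => η z * F ((1 - t) • x + t • (x0 - z)) := by
  have h1 : Integrable fun z => F ((1 - t) • x + t • (x0 - z)) := by
    have h := (hF.comp_sub_left ((1 - t) • x + t • x0)).comp_smul ht
    refine h.congr (Filter.Eventually.of_forall fun z => ?_)
    simp only [smul_sub]; congr 1; abel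
  obtain ⟨C, hC⟩ := hη.2.exists_bound_of_continuous hη.1.continuous
  exact h1.bdd_mul (c := C) hη.1.continuous.aestronglyMeasurable (Filter.Eventually.of_forall hC)

lemma rm_jensen {η : Vec → ℝ} (hη : TestS η) (h0 : ∀ z, 0 ≤ η z) (h1 : ∫ z, η z = 1) (x0 : Vec) {t : ℝ} (ht : t ≠ 0)
    {F : Vec → ℝ} (hF : Integrable F) (hF2 : Integrable fun x => F x ^ 2) (x : Vec) :
    Rm η x0 t F x ^ 2 ≤ Rm η x0 t (fun y => F y ^ 2) x := by
  set m := Rm η x0 t F x with hm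
  have i1 := rm_int hη x0 ht hF x
  have i2 := rm_int hη x0 ht hF2 x
  have i0 : Integrable η := hη.1.continuous.integrable_of_hasCompactSupport hη.2
  have : 0 ≤ ∫ z, η z * (F ((1 - t) • x + t • (x0 - z)) - m) ^ 2 := integral_nonneg fun z => mul_nonneg (h0 z) (sq_nonneg _)
  have e : ∀ z, η z * (F ((1 - t) • x + t • (x0 - z)) - m) ^ 2 =
      (η z * F ((1 - t) • x + t • (x0 - z)) ^ 2 - (2 * m) * (η z * F ((1 - t) • x + t • (x0 - z)))) + m ^ 2 * η z := by
    intro z; ring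
  simp only [e] at this
  rw [integral_add (by exact i2.sub (i1.const_mul (2 * m))) (i0.const_mul _), integral_sub i2 (i1.const_mul _), integral_const_mul, integral_const_mul, h1] at this
  have e1 : ∫ z, η z * F ((1 - t) • x + t • (x0 - z)) = m := rfl
  rw [e1] at this
  unfold Rm
  linarith [this]

lemma rm_pair {η : Vec → ℝ} (hη : TestS η) (x0 : Vec) {t : ℝ} (ht : 0 < t) (ht1 : t < 1) {F : Vec → ℝ} (hF : Integrable F)
    {Ψ : Vec → ℝ} (hΨ : Measurable Ψ) {B : ℝ} (hB : ∀ x, ‖Ψ x‖ ≤ B) :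
    ∫ x, Rm η x0 t F x * Ψ x = ((1 - t) ^ 3)⁻¹ *
      ∫ p : Vec × Vec, (η p.1 * F p.2) * Ψ ((1 - t)⁻¹ • (p.2 - t • (x0 - p.1))) ∂(volume.prod volume) := by
  have ht0 := ht.ne'
  have hs : 0 < 1 - t := by linarith
  have hs0 := hs.ne'
  have i0 : Integrable η := hη.1.continuous.integrable_of_hasCompactSupport hη.2
  set c : Vec → Vec := fun p => (t / (1 - t)) • (p - x0) with hc
  have hcm : Measurable c := by rw [hc]; fun_prop
  set Ft : Vec → ℝ := fun z => F (t • z) with hFt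
  have iFt : Integrable Ft := hF.comp_smul ht0
  have I1 : Integrable (fun p : Vec × Vec => (η p.2 * Ft (p.1 - p.2)) * Ψ (c p.1)) (volume.prod volume) := by
    have h := Integrable.convolution_integrand (ContinuousLinearMap.lsmul ℝ ℝ) i0 iFt
    simp only [ContinuousLinearMap.lsmul_apply, smul_eq_mul] at h
    exact h.mul_bdd (c := B) (by exact (hΨ.comp (hcm.comp measurable_fst)).aestronglyMeasurable) (Filter.Eventually.of_forall fun p => hB _)
  have I2 : Integrable (fun p : Vec × Vec => (η p.1 * F p.2) * Ψ ((1 - t)⁻¹ • (p.2 - t • (x0 - p.1)))) (volume.prod volume) := by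
    refine (i0.mul_prod hF).mul_bdd (c := B) ?_ (Filter.Eventually.of_forall fun p => hB _)
    refine (hΨ.comp (g := Ψ) (f := fun p : Vec × Vec => (1 - t)⁻¹ • (p.2 - t • (x0 - p.1))) ?_).aestronglyMeasurable
    fun_prop
  set H : Vec → ℝ := fun p => ∫ z, (η z * Ft (p - z)) * Ψ (c p) with hH
  have e1 : ∫ x, Rm η x0 t F x * Ψ x = |(((1 - t) / t) ^ 3)⁻¹| * ∫ p, H p := by
    have h := Measure.integral_comp_smul volume (fun q => H (q + x0)) ((1 - t) / t)
    rw [integral_add_right_eq_self H x0] at h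
    simp only [Module.finrank_fin_fun, smul_eq_mul] at h
    rw [← h]
    congr 1; funext x
    rw [hH]
    simp only [integral_mul_const]
    congr 1
    · rw [rm_conv η x0 ht0]; rfl
    · congr 1
      rw [hc]
      simp only [add_sub_cancel_right, smul_smul]
      rw [show t / (1 - t) * ((1 - t) / t) = 1 by field_simp, one_smul]
  have e2 : ∫ p, H p = ∫ z, ∫ p, (η z * Ft (p - z)) * Ψ (c p) := by
    rw [hH]; exact integral_integral_swap I1
  have e3 : ∀ z, ∫ p, (η z * Ft (p - z)) * Ψ (c p) = |(t ^ 3)⁻¹| * ∫ y, (η z * F y) * Ψ ((1 - t)⁻¹ • (y - t • (x0 - z))) := by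
    intro z
    rw [← integral_add_right_eq_self _ z]
    have h := Measure.integral_comp_smul volume (fun y => (η z * F y) * Ψ ((1 - t)⁻¹ • (y - t • (x0 - z)))) t
    simp only [Module.finrank_fin_fun, smul_eq_mul] at h
    rw [← h]
    congr 1; funext q
    rw [add_sub_cancel_right]
    congr 2
    rw [hc]
    funext i; simp; field_simp; ring
  rw [e1, e2]
  simp only [e3]
  rw [integral_const_mul, integral_prod _ I2, ← mul_assoc]
  congr 1
  rw [abs_of_pos (by positivity), abs_of_pos (by positivity)]
  field_simp

lemma rm_tendsto {η : Vec → ℝ} (hη : TestS η) (h1 : ∫ z, η z = 1) (x0 : Vec) {F : Vec → ℝ} (hF : Integrable F)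
    {K : Set Vec} (hK : IsCompact K) (hfr : volume (frontier K) = 0) {ψ : Vec → ℝ} (hψ : Continuous ψ)
    {t : ℕ → ℝ} (ht : ∀ n, 0 < t n) (ht1 : ∀ n, t n ≤ 1 / 2) (htl : Filter.Tendsto t Filter.atTop (nhds 0)) :
    Filter.Tendsto (fun n => ∫ x in K, Rm η x0 (t n) F x * ψ x) Filter.atTop (nhds (∫ x in K, F x * ψ x)) := by
  set Ψ : Vec → ℝ := K.indicator ψ with hΨ
  have hm : Measurable Ψ := hψ.measurable.indicator hK.measurableSet
  obtain ⟨B, hB⟩ := hK.exists_bound_of_continuousOn hψ.continuousOn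
  have hB0 : ∀ x, ‖Ψ x‖ ≤ |B| := by
    intro x
    by_cases hx : x ∈ K
    · rw [hΨ, Set.indicator_of_mem hx]; exact (hB x hx).trans (le_abs_self _)
    · rw [hΨ, Set.indicator_of_notMem hx]; simp
  have i0 : Integrable η := hη.1.continuous.integrable_of_hasCompactSupport hη.2
  have conv : ∀ G : Vec → ℝ, ∫ x in K, G x * ψ x = ∫ x, G x * Ψ x := by
    intro G
    rw [← integral_indicator hK.measurableSet]
    congr 1; funext x
    by_cases hx : x ∈ K <;> simp [hΨ, hx]
  simp only [conv]
  have hlim : ∫ x, F x * Ψ x = ∫ p : Vec × Vec, (η p.1 * F p.2) * Ψ p.2 ∂(volume.prod volume) := by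
    have := integral_prod_mul (μ := (volume : Measure Vec)) (ν := (volume : Measure Vec)) η (fun y => F y * Ψ y)
    rw [h1, one_mul] at this
    rw [← this]
    congr 1; funext p; ring
  rw [hlim]
  have hp : ∀ n, ∫ x, Rm η x0 (t n) F x * Ψ x = ∫ p : Vec × Vec, ((1 - t n) ^ 3)⁻¹ *
      ((η p.1 * F p.2) * Ψ ((1 - t n)⁻¹ • (p.2 - t n • (x0 - p.1)))) ∂(volume.prod volume) := by
    intro n
    rw [integral_const_mul]
    exact rm_pair hη x0 (ht n) (by linarith [ht1 n]) hF hm hB0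
  simp only [hp]
  have hne : ∀ n, (1 : ℝ) / 2 ≤ 1 - t n := fun n => by linarith [ht1 n]
  refine tendsto_integral_of_dominated_convergence (fun p => 8 * (|B| * ‖η p.1 * F p.2‖)) ?_ ?_ ?_ ?_
  · intro n
    refine AEStronglyMeasurable.const_mul ?_ _
    refine (i0.mul_prod hF).aestronglyMeasurable.mul ?_
    refine (hm.comp (g := Ψ) (f := fun p : Vec × Vec => (1 - t n)⁻¹ • (p.2 - t n • (x0 - p.1))) ?_).aestronglyMeasurable
    fun_prop
  · exact ((i0.mul_prod hF).norm.const_mul _).const_mul _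
  · intro n
    refine Filter.Eventually.of_forall fun p => ?_
    rw [norm_mul, norm_mul _ (Ψ _)]
    have a1 : ‖((1 - t n) ^ 3)⁻¹‖ ≤ 8 := by
      have : (1 / 2 : ℝ) ^ 3 ≤ (1 - t n) ^ 3 := pow_le_pow_left₀ (by norm_num) (hne n) 3
      rw [Real.norm_eq_abs, abs_of_pos (by have := hne n; positivity)]
      rw [inv_le_comm₀ (by have := hne n; positivity) (by norm_num)]
      norm_num at this ⊢; linarith
    have a2 := hB0 ((1 - t n)⁻¹ • (p.2 - t n • (x0 - p.1)))
    rw [mul_comm |B|]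
    gcongr
  · have hae : ∀ᵐ p : Vec × Vec ∂(volume.prod volume), p.2 ∉ frontier K := by
      have : ∀ᵐ y : Vec, y ∉ frontier K := measure_eq_zero_iff_ae_notMem.1 hfr
      exact Measure.quasiMeasurePreserving_snd.ae this
    filter_upwards [hae] with p hp
    have cΨ : ContinuousAt Ψ p.2 := by
      by_cases hx : p.2 ∈ interior K
      · refine hψ.continuousAt.congr ?_
        filter_upwards [mem_interior_iff_mem_nhds.1 hx] with y hy
        rw [hΨ, Set.indicator_of_mem hy]
      · have hx2 : p.2 ∈ Kᶜ := by
          intro h; exact hp ⟨subset_closure h, hx⟩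
        refine (continuousAt_const (y := (0 : ℝ))).congr ?_
        filter_upwards [hK.isClosed.isOpen_compl.mem_nhds hx2] with y hy
        rw [hΨ, Set.indicator_of_notMem hy]
    have l1 : Filter.Tendsto (fun n => (1 - t n)⁻¹) Filter.atTop (nhds 1) := by
      have := (tendsto_const_nhds (x := (1 : ℝ))).sub htl
      simpa using this.inv₀ (by norm_num)
    have l2 : Filter.Tendsto (fun n => ((1 - t n) ^ 3)⁻¹) Filter.atTop (nhds 1) := by
      simpa using l1.pow 3
    have l3 : Filter.Tendsto (fun n => (1 - t n)⁻¹ • (p.2 - t n • (x0 - p.1))) Filter.atTop (nhds p.2) := by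
      have := l1.smul ((tendsto_const_nhds (x := p.2)).sub (htl.smul_const (x0 - p.1)))
      simpa using this
    have l4 := l2.mul ((cΨ.tendsto.comp l3).const_mul (η p.1 * F p.2))
    simpa using l4

lemma exists_eta {Ω : Set Vec} (ho : IsOpen Ω) (hconv : Convex ℝ Ω) (hne : Ω.Nonempty) :
    ∃ (x0 : Vec) (η : Vec → ℝ), TestS η ∧ (∀ z, 0 ≤ η z) ∧ ∫ z, η z = 1 ∧
      ∀ t : ℝ, 0 < t → t < 1 → ∀ x ∈ closure Ω, ∀ z ∈ tsupport η, (1 - t) • x + t • (x0 - z) ∈ Ω := by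
  obtain ⟨x0, hx0⟩ := hne
  obtain ⟨r, hr, hb⟩ := Metric.isOpen_iff.1 ho x0 hx0
  let bp : ContDiffBump (0 : Vec) := ⟨r / 4, r / 2, by positivity, by linarith⟩
  refine ⟨x0, bp.normed volume, ⟨bp.contDiff_normed, bp.hasCompactSupport_normed⟩, bp.nonneg_normed, bp.integral_normed, ?_⟩
  intro t ht ht1 x hx z hz
  rw [bp.tsupport_normed_eq] at hz
  have hz : ‖z‖ ≤ r / 2 := by simpa [bp] using hz
  have : x0 - z ∈ interior Ω := by
    rw [ho.interior_eq]; apply hb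
    simp [Metric.mem_ball, dist_eq_norm]; linarith
  have := hconv.combo_closure_interior_mem_interior hx this (a := 1 - t) (b := t) (by linarith) ht (by ring)
  exact interior_subset this

def tn (n : ℕ) : ℝ := 1 / ((n : ℝ) + 2)
lemma tn_pos (n : ℕ) : 0 < tn n := by unfold tn; positivity
lemma tn_half (n : ℕ) : tn n ≤ 1 / 2 := by
  unfold tn
  apply one_div_le_one_div_of_le (by norm_num)
  have : (0 : ℝ) ≤ n := Nat.cast_nonneg n
  linarith
lemma tn_lim : Filter.Tendsto tn Filter.atTop (nhds 0) := by
  unfold tn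
  have h := (tendsto_const_nhds (x := (1:ℝ)) (f := (Filter.atTop : Filter ℕ))).div_atTop
    (Filter.tendsto_atTop_add_const_right Filter.atTop (2 : ℝ) (tendsto_natCast_atTop_atTop (R := ℝ)))
  exact h

lemma el_fr (M : Mesh) (i : Fin M.n) : volume (frontier (M.el i).K) = 0 := (K_convex _).addHaar_frontier volume

lemma covers_open {M : Mesh} {Ω : Set Vec} (hc : M.Covers Ω) : IsOpen Ω := by
  rw [hc.1]; exact isOpen_interior

lemma scal_cons {ρ : ℝ} (hρ : 0 < ρ) {M : Mesh} {Ω : Set Vec} (hconv : Convex ℝ Ω) (hc : M.Covers Ω) (hs : Mesh.ShapeReg ρ M)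
    {w : Fin M.n → Vec → ℝ} (hw : ∀ i, ContDiff ℝ 1 (w i))
    (h1 : ∀ i j a b, i ≠ j → Shr (M.el i) (M.el j) a b → favg ((M.el i).face a) (w i) = favg ((M.el i).face a) (w j))
    (h2 : ∀ i a, (M.el i).face a ⊆ frontier Ω → favg ((M.el i).face a) (w i) = 0)
    {F : Vec → ℝ} {D : Fin 3 → Vec → ℝ} (hF : Integrable F) (hF2 : Integrable fun x => F x ^ 2)
    (hD : ∀ i, Integrable (D i)) (hD2 : ∀ i, Integrable fun x => D i x ^ 2)
    (hW : ∀ i φ, TestS φ → tsupport φ ⊆ Ω → ∫ x, D i x * φ x = - ∫ x, F x * pd i φ x) (b : Fin 3) :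
    (∑ i, ∫ x in (M.el i).K, (F x * pd b (w i) x + D b x * w i x) ≤
      256 / ρ * M.hsize * (√(∑ i, ∫ x in (M.el i).K, nsq3 (grad3 (w i) x)) * √(∑ i, ∑ j, ∫ x in (M.el i).K, D j x ^ 2))) ∧
    (∑ i, ∫ x in (M.el i).K, (F x * pd b (w i) x + D b x * w i x) ≤
      256 / ρ * √M.hsize * (√(∑ i, ∫ x in (M.el i).K, nsq3 (grad3 (w i) x)) *
        √(√(∑ i, ∫ x in (M.el i).K, F x ^ 2) * √(∑ i, ∑ j, ∫ x in (M.el i).K, D j x ^ 2)))) := by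
  obtain ⟨x0, η, hη, h0, hI, hmem⟩ := exists_eta (covers_open hc) hconv hc.2.2.nonempty
  have tp := tn_pos
  have t1 : ∀ n, tn n < 1 := fun n => by linarith [tn_half n]
  have tne : ∀ n, tn n ≠ 0 := fun n => (tp n).ne'
  have hpd : ∀ n, ∀ j, ∀ x ∈ closure Ω, pd j (Rm η x0 (tn n) F) x = (1 - tn n) * Rm η x0 (tn n) (D j) x := by
    intro n j x hx
    have h := rm_div hη (Ω := Ω) x0 (tp n) (F := fun i => if i = j then F else 0) (H := D j)
      (fun i => by split_ifs; exacts [hF, integrable_zero _ _ _]) (fun φ hφ hS => by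
        rw [hW j φ hφ hS, Finset.sum_eq_single j]
        · simp
        · intro i _ hij; simp [hij]
        · simp) x (hmem _ (tp n) (t1 n) x hx)
    rw [Finset.sum_eq_single j] at h
    · simpa using h
    · intro i _ hij
      rw [if_neg hij]
      have : Rm η x0 (tn n) 0 = fun _ => 0 := by funext y; simp [Rm]
      rw [this]; simp [pd]
    · simp
  have c1 : ∀ n, ContDiff ℝ 1 (Rm η x0 (tn n) F) := fun n => rm_c1 hη x0 (tne n) hF
  have cF : ∀ n, Continuous (Rm η x0 (tn n) F) := fun n => (c1 n).continuous
  have cD : ∀ n j, Continuous (Rm η x0 (tn n) (D j)) := fun n j => (rm_c1 hη x0 (tne n) (hD j)).continuous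
  have cF2 : ∀ n, Continuous (Rm η x0 (tn n) fun y => F y ^ 2) := fun n => (rm_c1 hη x0 (tne n) hF2).continuous
  have cD2 : ∀ n j, Continuous (Rm η x0 (tn n) fun y => D j y ^ 2) := fun n j => (rm_c1 hη x0 (tne n) (hD2 j)).continuous
  have kc := fun i => K_compact (M.el i)
  have hm := fun i => (kc i).measurableSet
  -- limit of the left-hand side
  have L : Filter.Tendsto (fun n => ∑ i, ∫ x in (M.el i).K, (Rm η x0 (tn n) F x * pd b (w i) x + pd b (Rm η x0 (tn n) F) x * w i x))
      Filter.atTop (nhds (∑ i, ∫ x in (M.el i).K, (F x * pd b (w i) x + D b x * w i x))) := by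
    refine tendsto_finsetSum _ fun i _ => ?_
    have e : ∀ n, ∫ x in (M.el i).K, (Rm η x0 (tn n) F x * pd b (w i) x + pd b (Rm η x0 (tn n) F) x * w i x) =
        (∫ x in (M.el i).K, Rm η x0 (tn n) F x * pd b (w i) x) + (1 - tn n) * ∫ x in (M.el i).K, Rm η x0 (tn n) (D b) x * w i x := by
      intro n
      rw [integral_add (by exact ci (kc i) ((cF n).mul (pd_cont (hw i) b))) (by exact ci (kc i) ((pd_cont (c1 n) b).mul (hw i).continuous)), ← integral_const_mul]
      congr 1
      refine setIntegral_congr_fun (hm i) fun x hx => ?_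
      simp only [hpd n b x (el_sub hc i hx), mul_assoc]
    simp only [e]
    rw [integral_add]
    · have l1 := rm_tendsto hη hI x0 hF (kc i) (el_fr M i) (pd_cont (hw i) b) tn_pos tn_half tn_lim
      have l2 := rm_tendsto hη hI x0 (hD b) (kc i) (el_fr M i) (hw i).continuous tn_pos tn_half tn_lim
      have l3 := l1.add (((tendsto_const_nhds (x := (1 : ℝ))).sub tn_lim).mul l2)
      simpa using l3
    · exact hF.integrableOn.mul_continuousOn (pd_cont (hw i) b).continuousOn (kc i)
    · exact (hD b).integrableOn.mul_continuousOn (hw i).continuous.continuousOn (kc i)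
  have LD : Filter.Tendsto (fun n => ∑ i, ∑ j, ∫ x in (M.el i).K, Rm η x0 (tn n) (fun y => D j y ^ 2) x)
      Filter.atTop (nhds (∑ i, ∑ j, ∫ x in (M.el i).K, D j x ^ 2)) := by
    refine tendsto_finsetSum _ fun i _ => tendsto_finsetSum _ fun j _ => ?_
    simpa using rm_tendsto hη hI x0 (hD2 j) (kc i) (el_fr M i) (continuous_const (y := (1 : ℝ))) tn_pos tn_half tn_lim
  have LF : Filter.Tendsto (fun n => ∑ i, ∫ x in (M.el i).K, Rm η x0 (tn n) (fun y => F y ^ 2) x)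
      Filter.atTop (nhds (∑ i, ∫ x in (M.el i).K, F x ^ 2)) := by
    refine tendsto_finsetSum _ fun i _ => ?_
    simpa using rm_tendsto hη hI x0 hF2 (kc i) (el_fr M i) (continuous_const (y := (1 : ℝ))) tn_pos tn_half tn_lim
  have bD : ∀ n, ∑ i, ∫ x in (M.el i).K, nsq3 (grad3 (Rm η x0 (tn n) F) x) ≤
      ∑ i, ∑ j, ∫ x in (M.el i).K, Rm η x0 (tn n) (fun y => D j y ^ 2) x := by
    intro n
    refine Finset.sum_le_sum fun i _ => ?_
    rw [← integral_finsetSum _ (fun j _ => ci (kc i) (cD2 n j))]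
    refine setIntegral_mono_on (ci (kc i) (q_cont (c1 n))) (ci (kc i) (continuous_finsetSum _ fun j _ => cD2 n j)) (hm i) fun x hx => ?_
    unfold nsq3 dot3 grad3
    refine Finset.sum_le_sum fun j _ => ?_
    rw [hpd n j x (el_sub hc i hx)]
    have hj := rm_jensen hη h0 hI x0 (tne n) (hD j) (hD2 j) x
    refine le_trans ?_ hj
    have ha := tp n
    have hb := t1 n
    have : (1 - tn n) ^ 2 ≤ 1 := by nlinarith
    nlinarith [sq_nonneg (Rm η x0 (tn n) (D j) x)]
  have bF : ∀ n, ∑ i, ∫ x in (M.el i).K, Rm η x0 (tn n) F x ^ 2 ≤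
      ∑ i, ∫ x in (M.el i).K, Rm η x0 (tn n) (fun y => F y ^ 2) x := by
    intro n
    refine Finset.sum_le_sum fun i _ => ?_
    refine setIntegral_mono_on (ci (kc i) ((cF n).pow 2)) (ci (kc i) (cF2 n)) (hm i) fun x _ => ?_
    exact rm_jensen hη h0 hI x0 (tne n) hF hF2 x
  have hh : 0 ≤ M.hsize := Metric.diam_nonneg.trans (diam_le_h M ⟨0, M.npos⟩)
  have B := fun n => cons_bound hρ hc hs hw h1 h2 (c1 n) b
  constructor
  · refine le_of_tendsto_of_tendsto' L ((LD.sqrt.const_mul _).const_mul _) fun n => (B n).1.trans ?_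
    have := Real.sqrt_le_sqrt (bD n)
    gcongr
  · refine le_of_tendsto_of_tendsto' L (((LF.sqrt.mul LD.sqrt).sqrt.const_mul _).const_mul _) fun n => (B n).2.trans ?_
    have := Real.sqrt_le_sqrt (bD n)
    have := Real.sqrt_le_sqrt (bF n)
    gcongr

lemma TestS.c1 {φ : Vec → ℝ} (h : TestS φ) : ContDiff ℝ 1 φ := h.1.of_le (by exact_mod_cast le_top)
lemma TestS.pd {φ : Vec → ℝ} (h : TestS φ) (i : Fin 3) : TestS (pd i φ) := by
  refine ⟨?_, h.2.fderiv_apply ℝ _⟩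
  have := h.1.fderiv_right (m := (⊤ : ℕ∞)) (by simp)
  exact this.clm_apply contDiff_const
lemma pd_supp (φ : Vec → ℝ) (i : Fin 3) : tsupport (pd i φ) ⊆ tsupport φ := tsupport_fderiv_apply_subset ℝ _
lemma TestS.cont {φ : Vec → ℝ} (h : TestS φ) : Continuous φ := h.1.continuous
lemma TestV.comp {φ : Vec → Vec} (h : TestV φ) (i : Fin 3) : TestS (fun x => φ x i) :=
  ⟨contDiff_pi.1 h.1 i, h.2.comp_left (g := fun v : Vec => v i) rfl⟩
lemma TestV.c1 {φ : Vec → Vec} (h : TestV φ) (i : Fin 3) : ContDiff ℝ 1 (fun x => φ x i) := (h.comp i).c1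
lemma comp_supp (φ : Vec → Vec) (i : Fin 3) : tsupport (fun x => φ x i) ⊆ tsupport φ := by
  refine closure_mono fun x hx => ?_
  simp only [Function.mem_support] at hx ⊢
  intro h; exact hx (by rw [h]; rfl)
lemma curl_supp (φ : Vec → Vec) : Function.support (curl3 φ) ⊆ tsupport φ := by
  intro x hx
  by_contra hn
  have h : ∀ i j, pd i (fun y => φ y j) x = 0 := fun i j => image_eq_zero_of_notMem_tsupport
    fun hh => hn (comp_supp φ j (pd_supp _ i hh))
  apply hx
  unfold curl3
  simp only [h]
  funext i; fin_cases i <;> simp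
lemma TestV.curl {φ : Vec → Vec} (h : TestV φ) : TestV (curl3 φ) := by
  refine ⟨contDiff_pi.2 fun i => ?_, HasCompactSupport.of_support_subset_isCompact h.2 (curl_supp φ)⟩
  have := fun i j => ((h.comp j).pd i).1
  fin_cases i
  · exact (this 1 2).sub (this 2 1)
  · exact (this 2 0).sub (this 0 2)
  · exact (this 0 1).sub (this 1 0)
lemma TestS.intb {φ : Vec → ℝ} (h : TestS φ) : Integrable φ := h.cont.integrable_of_hasCompactSupport h.2
lemma TestS.mulI {φ g : Vec → ℝ} (h : TestS φ) (hg : Continuous g) : Integrable (fun x => φ x * g x) :=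
  (h.cont.mul hg).integrable_of_hasCompactSupport h.2.mul_right

lemma ibp {φ g : Vec → ℝ} (h : TestS φ) (hg : ContDiff ℝ 1 g) (i : Fin 3) :
    ∫ x, pd i φ x * g x = - ∫ x, φ x * pd i g x := by
  have := integral_mul_fderiv_eq_neg_fderiv_mul_of_integrable (μ := volume) (f := φ) (g := g) (v := Pi.single i 1)
    ((h.pd i).mulI hg.continuous) (h.mulI (pd_cont hg i)) (h.mulI hg.continuous)
    (fun x _ => h.c1.differentiable (by norm_num) x) (fun x _ => hg.differentiable (by norm_num) x)
  unfold pd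
  rw [this, neg_neg]

lemma cross_test {φ χ : Vec → Vec} (h : TestV φ) (h' : TestV χ) (i : Fin 3) : TestS fun x => cross3 (φ x) (χ x) i := by
  have a := fun i => (h.comp i)
  have b := fun i => (h'.comp i)
  have e : ∀ i j, TestS fun x => φ x i * χ x j - φ x j * χ x i := fun i j =>
    ⟨((a i).1.mul (b j).1).sub ((a j).1.mul (b i).1), by
      have h1 : HasCompactSupport fun x => φ x i * χ x j := (a i).2.mul_right
      have h2 : HasCompactSupport fun x => φ x j * χ x i := (a j).2.mul_right
      exact h1.sub h2⟩
  fin_cases i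
  · exact e 1 2
  · exact e 2 0
  · exact e 0 1

lemma dot_test {φ : Vec → Vec} (h : TestV φ) {g : Vec → Vec} (hg : Continuous g) : Integrable fun x => dot3 (φ x) (g x) := by
  unfold dot3
  exact integrable_finsetSum _ fun i _ => (h.comp i).mulI ((continuous_apply i).comp hg)

lemma curl_ibp {φ χ : Vec → Vec} (h : TestV φ) (h' : TestV χ) :
    ∫ x, dot3 (curl3 φ x) (χ x) = ∫ x, dot3 (φ x) (curl3 χ x) := by
  rw [← sub_eq_zero, ← integral_sub (dot_test h.curl h'.1.continuous) (dot_test h h'.curl.1.continuous)]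
  simp only [← div_cross h.c1 h'.c1]
  rw [integral_finsetSum _ fun i _ => ((cross_test h h' i).pd i).intb]
  refine Finset.sum_eq_zero fun i _ => ?_
  have := ibp (cross_test h h' i) (contDiff_const (c := (1 : ℝ))) i
  simpa [pd] using this

lemma gc_test {Ω : Set Vec} {φ : Vec → Vec} (h : TestV φ) (hs : tsupport φ ⊆ Ω) :
    MemH0GC Ω φ (curl3 φ) (jac3 (curl3 φ)) := by
  have m : ∀ {ψ : Vec → Vec}, TestV ψ → MemL2V Ω ψ := fun hψ => (hψ.1.continuous.memLp_of_hasCompactSupport hψ.2).restrict Ω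
  have s1 : Function.support φ ⊆ Ω := (subset_tsupport φ).trans hs
  have s2 : Function.support (curl3 φ) ⊆ Ω := (curl_supp φ).trans hs
  have s3 : tsupport (curl3 φ) ⊆ Ω := (closure_minimal (curl_supp φ) (isClosed_tsupport φ)).trans hs
  refine ⟨⟨m h, m h.curl, ?_⟩, m h.curl, fun a b => ?_, fun a b => ?_⟩
  · unfold zextV
    rw [Set.indicator_eq_self.2 s1, Set.indicator_eq_self.2 s2]
    exact fun χ hχ => curl_ibp h hχ
  · have := (h.curl.comp a).pd b
    exact (this.cont.memLp_of_hasCompactSupport this.2).restrict Ω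
  · unfold zextS
    have e1 : Function.support (fun x => curl3 φ x a) ⊆ Ω := (subset_tsupport _).trans ((comp_supp _ a).trans s3)
    have e2 : Function.support (fun x => jac3 (curl3 φ) x a b) ⊆ Ω :=
      (subset_tsupport _).trans ((pd_supp (fun y => curl3 φ y a) b).trans ((comp_supp _ a).trans s3))
    rw [Set.indicator_eq_self.2 e1, Set.indicator_eq_self.2 e2]
    intro χ hχ
    exact ibp (h.curl.comp a) hχ.c1 b

lemma onT {Ω : Set Vec} {F φ : Vec → ℝ} (hF : IntegrableOn F Ω) (h : TestS φ) : IntegrableOn (fun x => F x * φ x) Ω := by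
  obtain ⟨C, hC⟩ := h.2.exists_bound_of_continuous h.cont
  exact hF.mul_bdd (c := C) h.cont.aestronglyMeasurable (Filter.Eventually.of_forall hC)

lemma zext_mul (Ω : Set Vec) (hm : MeasurableSet Ω) (F φ : Vec → ℝ) : ∫ x, zextS Ω F x * φ x = ∫ x in Ω, F x * φ x := by
  rw [← integral_indicator hm]
  congr 1; funext x
  unfold zextS
  by_cases hx : x ∈ Ω <;> simp [hx]

lemma wkJ {Ω : Set Vec} (hm : MeasurableSet Ω) {cu : Vec → Vec} {J : Vec → Mat} {D2 : (Fin 2 → Fin 3) → Fin 3 → Vec → ℝ}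
    (hJ : MemH01V Ω cu J) (hD : MemHiter Ω 2 cu D2) (c b i : Fin 3) {φ : Vec → ℝ} (h : TestS φ) (hs : tsupport φ ⊆ Ω) :
    ∫ x in Ω, D2 ![b, i] c x * φ x = - ∫ x in Ω, J x c b * pd i φ x := by
  have h1 := (hD ![b, i] c).1 φ h hs
  have h2 := hJ.2.2 c b (pd i φ) (h.pd i)
  rw [zext_mul Ω hm, zext_mul Ω hm] at h2
  rw [h2, neg_neg, h1]
  simp [pdIter]

lemma wk_id {Ω : Set Vec} (hm : MeasurableSet Ω) {ε : ℝ} {f u cu : Vec → Vec} {J : Vec → Mat} {D2 : (Fin 2 → Fin 3) → Fin 3 → Vec → ℝ}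
    (hu : IsQuadCurlSol Ω ε f u cu J) (hD : MemHiter Ω 2 cu D2)
    (iJ : ∀ a b, IntegrableOn (fun x => J x a b) Ω) (iD : ∀ α c, IntegrableOn (D2 α c) Ω)
    (ic : ∀ a, IntegrableOn (fun x => cu x a) Ω)
    {φ : Vec → Vec} (h : TestV φ) (hs : tsupport φ ⊆ Ω) :
    ∑ a, ∫ x in Ω, (cu x a - ε ^ 2 * ∑ b, D2 ![b, b] a x) * curl3 φ x a = ∫ x in Ω, dot3 (f x) (φ x) := by
  have hc := h.curl
  have s3 : tsupport (curl3 φ) ⊆ Ω := (closure_minimal (curl_supp φ) (isClosed_tsupport φ)).trans hs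
  rw [← hu.2.2 φ _ _ (gc_test h hs)]
  have e1 : ∫ x in Ω, dotM (J x) (jac3 (curl3 φ) x) = ∑ a, ∑ b, - ∫ x in Ω, D2 ![b, b] a x * curl3 φ x a := by
    unfold dotM jac3
    rw [integral_finsetSum _ fun a _ => integrable_finsetSum _ fun b _ => onT (iJ a b) ((hc.comp a).pd b)]
    refine Finset.sum_congr rfl fun a _ => ?_
    rw [integral_finsetSum _ fun b _ => onT (iJ a b) ((hc.comp a).pd b)]
    refine Finset.sum_congr rfl fun b _ => ?_
    rw [wkJ hm hu.1.2 hD a b b (hc.comp a) ((comp_supp _ a).trans s3), neg_neg]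
  have e2 : ∫ x in Ω, dot3 (cu x) (curl3 φ x) = ∑ a, ∫ x in Ω, cu x a * curl3 φ x a := by
    unfold dot3
    rw [integral_finsetSum _ fun a _ => onT (ic a) (hc.comp a)]
  rw [e1, e2, Finset.mul_sum, ← Finset.sum_add_distrib]
  refine Finset.sum_congr rfl fun a _ => ?_
  rw [Finset.sum_neg_distrib, ← integral_finsetSum _ fun b _ => onT (iD _ a) (hc.comp a), mul_neg, ← integral_const_mul,
    add_comm, ← sub_eq_add_neg, ← integral_sub (onT (ic a) (hc.comp a))]
  · congr 1; funext x
    rw [sub_mul, ← Finset.sum_mul, mul_assoc]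
  · exact (integrable_finsetSum _ fun b _ => onT (iD _ a) (hc.comp a)).const_mul _

lemma pd_zero' (i : Fin 3) (x : Vec) : pd i (fun _ => (0 : ℝ)) x = 0 := by simp [pd]

lemma wk_comp {Ω : Set Vec} {G H : Fin 3 → Vec → ℝ}
    (hW : ∀ φ, TestV φ → tsupport φ ⊆ Ω → ∑ a, ∫ x, G a x * curl3 φ x a = ∑ a, ∫ x, H a x * φ x a)
    (j : Fin 3) {θ : Vec → ℝ} (h : TestS θ) (hs : tsupport θ ⊆ Ω) :
    ∫ x, H j x * θ x = ∑ a, ∫ x, G a x * curl3 (fun y => Pi.single j (θ y)) x a := by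
  have hc : ContDiff ℝ (⊤ : ℕ∞) (fun y => (Pi.single j (θ y) : Vec)) := by
    refine contDiff_pi.2 fun i => ?_
    by_cases hij : i = j
    · subst hij; simpa using h.1
    · simpa [Pi.single_eq_of_ne hij] using contDiff_const
  have hsub : Function.support (fun y => (Pi.single j (θ y) : Vec)) ⊆ Function.support θ := by
    intro x hx h0
    apply hx
    simp [h0]
  have := hW _ ⟨hc, HasCompactSupport.of_support_subset_isCompact h.2 (hsub.trans (subset_tsupport θ))⟩
    ((closure_mono hsub).trans hs)
  rw [this, Finset.sum_eq_single j]
  · simp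
  · intro a _ ha; simp [Pi.single_eq_of_ne ha]
  · simp

lemma rm_curl {η : Vec → ℝ} (hη : TestS η) {Ω : Set Vec} (x0 : Vec) {t : ℝ} (ht : 0 < t) {G H : Fin 3 → Vec → ℝ}
    (hG : ∀ a, Integrable (G a))
    (hW : ∀ φ, TestV φ → tsupport φ ⊆ Ω → ∑ a, ∫ x, G a x * curl3 φ x a = ∑ a, ∫ x, H a x * φ x a)
    (x : Vec) (hx : ∀ z ∈ tsupport η, (1 - t) • x + t • (x0 - z) ∈ Ω) (j : Fin 3) :
    curl3 (fun y a => Rm η x0 t (G a) y) x j = (1 - t) * Rm η x0 t (H j) x := by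
  have hn : ∀ F, Rm η x0 t (-F) = fun y => - Rm η x0 t F y := by
    intro F; funext y; simp [Rm, integral_neg]
  have hz : Rm η x0 t 0 = fun _ => 0 := by funext y; simp [Rm]
  have hpn : ∀ i F, pd i (fun y => - Rm η x0 t F y) x = - pd i (Rm η x0 t F) x := by
    intro i F; unfold pd; rw [fderiv_fun_neg]; rfl
  fin_cases j
  · have h := rm_div hη (Ω := Ω) x0 ht (F := ![0, G 2, - G 1]) (H := H 0)
      (fun i => by fin_cases i; exacts [integrable_zero _ _ _, hG 2, (hG 1).neg]) (fun φ hφ hS => by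
        rw [wk_comp hW 0 hφ hS]
        simp [Fin.sum_univ_three, curl3, pd_zero', integral_neg]) x hx
    simp only [Fin.sum_univ_three, Matrix.cons_val_zero, Matrix.cons_val_one, Matrix.cons_val, hn, hpn, hz, pd_zero'] at h
    simp only [curl3, Fin.zero_eta, Matrix.cons_val_zero]
    linarith
  · have h := rm_div hη (Ω := Ω) x0 ht (F := ![- G 2, 0, G 0]) (H := H 1)
      (fun i => by fin_cases i; exacts [(hG 2).neg, integrable_zero _ _ _, hG 0]) (fun φ hφ hS => by
        rw [wk_comp hW 1 hφ hS]
        simp [Fin.sum_univ_three, curl3, pd_zero', integral_neg]; try ring) x hx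
    simp only [Fin.sum_univ_three, Matrix.cons_val_zero, Matrix.cons_val_one, Matrix.cons_val, hn, hpn, hz, pd_zero'] at h
    simp only [curl3, Fin.mk_one, Matrix.cons_val_one, Matrix.cons_val_zero]
    linarith
  · have h := rm_div hη (Ω := Ω) x0 ht (F := ![G 1, - G 0, 0]) (H := H 2)
      (fun i => by fin_cases i; exacts [hG 1, (hG 0).neg, integrable_zero _ _ _]) (fun φ hφ hS => by
        rw [wk_comp hW 2 hφ hS]
        simp [Fin.sum_univ_three, curl3, pd_zero', integral_neg]; try ring) x hx
    simp only [Fin.sum_univ_three, Matrix.cons_val_zero, Matrix.cons_val_one, Matrix.cons_val, hn, hpn, hz, pd_zero'] at h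
    simp only [curl3, Fin.reduceFinMk, Matrix.cons_val]
    linarith

lemma fp_id {k : ℕ} (hk : k = 1 ∨ k = 2) {M : Mesh} {Ω : Set Vec} (hconv : Convex ℝ Ω) (hc : M.Covers Ω) {v : DiscVF M} (hv : MemWh0 k M Ω v)
    {G H : Fin 3 → Vec → ℝ} (hG : ∀ a, Integrable (G a)) (hH : ∀ a, Integrable (H a))
    (hW : ∀ φ, TestV φ → tsupport φ ⊆ Ω → ∑ a, ∫ x, G a x * curl3 φ x a = ∑ a, ∫ x, H a x * φ x a) :
    ∑ i, ∑ a, ∫ x in (M.el i).K, G a x * curl3 (v i) x a = ∑ i, ∑ a, ∫ x in (M.el i).K, H a x * v i x a := by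
  obtain ⟨x0, η, hη, h0, hI, hmem⟩ := exists_eta (covers_open hc) hconv hc.2.2.nonempty
  have tp := tn_pos
  have t1 : ∀ n, tn n < 1 := fun n => by linarith [tn_half n]
  have tne : ∀ n, tn n ≠ 0 := fun n => (tp n).ne'
  have kc := fun i => K_compact (M.el i)
  have cw : ∀ i a, Continuous fun x => curl3 (v i) x a := fun i a => curl_cont (hv.1.1 i).c1 a
  have cv : ∀ i a, Continuous fun x => v i x a := fun i a => ((hv.1.1 i).c1 a).continuous
  have cG : ∀ n a, ContDiff ℝ 1 (Rm η x0 (tn n) (G a)) := fun n a => rm_c1 hη x0 (tne n) (hG a)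
  have cH : ∀ n a, ContDiff ℝ 1 (Rm η x0 (tn n) (H a)) := fun n a => rm_c1 hη x0 (tne n) (hH a)
  have l1 : Filter.Tendsto (fun n => ∑ i, ∑ a, ∫ x in (M.el i).K, Rm η x0 (tn n) (G a) x * curl3 (v i) x a) Filter.atTop
      (nhds (∑ i, ∑ a, ∫ x in (M.el i).K, G a x * curl3 (v i) x a)) :=
    tendsto_finsetSum _ fun i _ => tendsto_finsetSum _ fun a _ =>
      rm_tendsto hη hI x0 (hG a) (kc i) (el_fr M i) (cw i a) tn_pos tn_half tn_lim
  have l2 : Filter.Tendsto (fun n => ∑ i, ∑ a, ∫ x in (M.el i).K, Rm η x0 (tn n) (H a) x * v i x a) Filter.atTop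
      (nhds (∑ i, ∑ a, ∫ x in (M.el i).K, H a x * v i x a)) :=
    tendsto_finsetSum _ fun i _ => tendsto_finsetSum _ fun a _ =>
      rm_tendsto hη hI x0 (hH a) (kc i) (el_fr M i) (cv i a) tn_pos tn_half tn_lim
  have l3 := ((tendsto_const_nhds (x := (1 : ℝ))).sub tn_lim).mul l2
  rw [sub_zero, one_mul] at l3
  refine tendsto_nhds_unique l1 (l3.congr fun n => ?_)
  have h := conf hk hc hv (ψ := fun y a => Rm η x0 (tn n) (G a) y) (cG n)
  have e : ∀ i, ∫ x in (M.el i).K, (dot3 (curl3 (v i) x) (fun a => Rm η x0 (tn n) (G a) x) -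
      dot3 (v i x) (curl3 (fun y a => Rm η x0 (tn n) (G a) y) x)) =
      ∑ a, (∫ x in (M.el i).K, Rm η x0 (tn n) (G a) x * curl3 (v i) x a) -
      (1 - tn n) * ∑ a, ∫ x in (M.el i).K, Rm η x0 (tn n) (H a) x * v i x a := by
    intro i
    have i1 : ∀ a, IntegrableOn (fun x => Rm η x0 (tn n) (G a) x * curl3 (v i) x a) (M.el i).K := fun a =>
      ci (kc i) ((cG n a).continuous.mul (cw i a))
    have i2 : ∀ a, IntegrableOn (fun x => Rm η x0 (tn n) (H a) x * v i x a) (M.el i).K := fun a =>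
      ci (kc i) ((cH n a).continuous.mul (cv i a))
    rw [← integral_finsetSum _ (fun a _ => i1 a), ← integral_finsetSum _ (fun a _ => i2 a), ← integral_const_mul,
      ← integral_sub (by exact integrable_finsetSum _ fun a _ => i1 a) (by exact (integrable_finsetSum _ fun a _ => i2 a).const_mul _)]
    refine setIntegral_congr_fun (kc i).measurableSet fun x hx => ?_
    have hx' := el_sub hc i hx
    simp only [dot3, rm_curl hη x0 (tp n) hG hW x (hmem _ (tp n) (t1 n) x hx'), Finset.mul_sum]
    congr 1
    · exact Finset.sum_congr rfl fun a _ => mul_comm _ _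
    · exact Finset.sum_congr rfl fun a _ => by ring
  simp only [e, Finset.sum_sub_distrib, ← Finset.mul_sum] at h
  linarith

lemma zK {M : Mesh} {Ω : Set Vec} (hc : M.Covers Ω) (hconv : Convex ℝ Ω) (i : Fin M.n) (F : Vec → ℝ) :
    zextS Ω F =ᵐ[volume.restrict (M.el i).K] F := by
  have h0 : volume (frontier Ω) = 0 := hconv.addHaar_frontier volume
  have hm := (K_compact (M.el i)).measurableSet
  have : ∀ᵐ x ∂(volume : Measure Vec), x ∉ frontier Ω := measure_eq_zero_iff_ae_notMem.1 h0
  filter_upwards [ae_restrict_of_ae this, ae_restrict_mem hm] with x h1 h2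
  have hx := el_sub hc i h2
  have : x ∈ Ω := by
    by_contra hn
    exact h1 ⟨hx, fun h => hn (interior_subset h)⟩
  exact Set.indicator_of_mem this F

lemma vol_fin {M : Mesh} {Ω : Set Vec} (hc : M.Covers Ω) : volume Ω < ⊤ := by
  have : IsCompact (closure Ω) := by rw [hc.2.1]; exact isCompact_iUnion fun i => K_compact (M.el i)
  exact (measure_mono subset_closure).trans_lt this.measure_lt_top

lemma curl_c1 {k : ℕ} {T : Tetra} {v : Vec → Vec} (hv : MemW k T v) (a : Fin 3) : ContDiff ℝ 1 fun x => curl3 v x a := by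
  have h : ∀ i j, ContDiff ℝ 1 (pd i fun y => v y j) := fun i j =>
    (((hv.smooth j).fderiv_right (m := (⊤ : ℕ∞)) (by simp)).of_le (by exact_mod_cast le_top)).clm_apply contDiff_const
  fin_cases a
  · exact (h 1 2).sub (h 2 1)
  · exact (h 2 0).sub (h 0 2)
  · exact (h 0 1).sub (h 1 0)

lemma err_id {k : ℕ} (hk : k = 1 ∨ k = 2) {M : Mesh} {Ω : Set Vec} (hconv : Convex ℝ Ω) (hc : M.Covers Ω) {v : DiscVF M} (hv : MemWh0 k M Ω v)
    {ε : ℝ} {f u cu : Vec → Vec} {J : Vec → Mat} {D2 : (Fin 2 → Fin 3) → Fin 3 → Vec → ℝ}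
    (hu : IsQuadCurlSol Ω ε f u cu J) (hD : MemHiter Ω 2 cu D2)
    (iJ : ∀ a b, IntegrableOn (fun x => J x a b) Ω) (iD : ∀ α c, IntegrableOn (D2 α c) Ω)
    (ic : ∀ a, IntegrableOn (fun x => cu x a) Ω) (jf : ∀ a, IntegrableOn (fun x => f x a) Ω) :
    ε ^ 2 * ahC M J v + bhC M cu v - fpair M f v =
      ε ^ 2 * ∑ a, ∑ b, ∑ i, ∫ x in (M.el i).K, (zextS Ω (fun y => J y a b) x * pd b (fun y => curl3 (v i) y a) x +
        zextS Ω (D2 ![b, b] a) x * curl3 (v i) x a) := by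
  have hm : MeasurableSet Ω := (covers_open hc).measurableSet
  have kc := fun i => K_compact (M.el i)
  have c1 : ∀ i a, ContDiff ℝ 1 fun x => curl3 (v i) x a := fun i a => curl_c1 (hv.1.1 i) a
  have cw : ∀ i a, Continuous fun x => curl3 (v i) x a := fun i a => (c1 i a).continuous
  have cv : ∀ i a, Continuous fun x => v i x a := fun i a => ((hv.1.1 i).c1 a).continuous
  have im : ∀ {F g : Vec → ℝ} (i), IntegrableOn F Ω → Continuous g → IntegrableOn (fun x => F x * g x) (M.el i).K :=
    fun i hF hg => (intOn_el hc hconv hF i).mul_continuousOn hg.continuousOn (kc i)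
  have zm : ∀ (F g : Vec → ℝ) i, ∫ x in (M.el i).K, zextS Ω F x * g x = ∫ x in (M.el i).K, F x * g x := fun F g i =>
    integral_congr_ae ((zK hc hconv i F).mono fun x hx => by simp only [hx])
  have iG : ∀ a, IntegrableOn (fun x => cu x a - ε ^ 2 * ∑ b, D2 ![b, b] a x) Ω := fun a =>
    (ic a).sub ((integrable_finsetSum _ fun b _ => iD ![b, b] a).const_mul _)
  have hfp := fp_id hk hconv hc hv (G := fun a => zextS Ω fun x => cu x a - ε ^ 2 * ∑ b, D2 ![b, b] a x)
    (H := fun a => zextS Ω fun x => f x a) (fun a => (integrable_indicator_iff hm).2 (iG a))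
    (fun a => (integrable_indicator_iff hm).2 (jf a)) (fun φ hφ hs => by
      simp only [zext_mul Ω hm]
      rw [wk_id hm hu hD iJ iD ic hφ hs]
      unfold dot3
      rw [integral_finsetSum _ fun a _ => onT (jf a) (hφ.comp a)])
  simp only [zm] at hfp
  have ef : fpair M f v = ∑ i, ∑ a, ∫ x in (M.el i).K, f x a * v i x a := by
    unfold fpair dot3
    exact Finset.sum_congr rfl fun i _ => integral_finsetSum _ fun a _ => im i (jf a) (cv i a)
  have eb : bhC M cu v = ∑ i, ∑ a, ∫ x in (M.el i).K, cu x a * curl3 (v i) x a := by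
    unfold bhC dot3
    exact Finset.sum_congr rfl fun i _ => integral_finsetSum _ fun a _ => im i (ic a) (cw i a)
  have ea : ahC M J v = ∑ i, ∑ a, ∑ b, ∫ x in (M.el i).K, J x a b * pd b (fun y => curl3 (v i) y a) x := by
    unfold ahC dotM jac3
    refine Finset.sum_congr rfl fun i _ => ?_
    rw [integral_finsetSum _ fun a _ => integrable_finsetSum _ fun b _ => im i (iJ a b) (pd_cont (c1 i a) b)]
    exact Finset.sum_congr rfl fun a _ => integral_finsetSum _ fun b _ => im i (iJ a b) (pd_cont (c1 i a) b)
  have eg : ∀ i a, ∫ x in (M.el i).K, (cu x a - ε ^ 2 * ∑ b, D2 ![b, b] a x) * curl3 (v i) x a =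
      (∫ x in (M.el i).K, cu x a * curl3 (v i) x a) - ε ^ 2 * ∑ b, ∫ x in (M.el i).K, D2 ![b, b] a x * curl3 (v i) x a := by
    intro i a
    rw [← integral_finsetSum _ fun b _ => im i (iD _ a) (cw i a), ← integral_const_mul, ← integral_sub (im i (ic a) (cw i a))
      (by exact (integrable_finsetSum _ fun b _ => im i (iD _ a) (cw i a)).const_mul _)]
    congr 1; funext x
    rw [sub_mul, ← Finset.sum_mul, mul_assoc]
  have es : ∀ a b i, ∫ x in (M.el i).K, (zextS Ω (fun y => J y a b) x * pd b (fun y => curl3 (v i) y a) x +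
        zextS Ω (D2 ![b, b] a) x * curl3 (v i) x a) =
      (∫ x in (M.el i).K, J x a b * pd b (fun y => curl3 (v i) y a) x) + ∫ x in (M.el i).K, D2 ![b, b] a x * curl3 (v i) x a := by
    intro a b i
    rw [← integral_add (im i (iJ a b) (pd_cont (c1 i a) b)) (im i (iD _ a) (cw i a))]
    refine integral_congr_ae ?_
    filter_upwards [zK hc hconv i (fun y => J y a b), zK hc hconv i (D2 ![b, b] a)] with x h1 h2
    rw [h1, h2]
  rw [ef, ← hfp, ea, eb]
  simp only [eg, es, Finset.sum_sub_distrib, Finset.sum_add_distrib, ← Finset.mul_sum]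
  have sw : ∀ X : Fin 3 → Fin 3 → Fin M.n → ℝ, ∑ a, ∑ b, ∑ i, X a b i = ∑ i, ∑ a, ∑ b, X a b i := by
    intro X
    rw [Finset.sum_comm (s := (Finset.univ : Finset (Fin M.n)))]
    exact Finset.sum_congr rfl fun a _ => Finset.sum_comm
  rw [sw, sw]
  ring

/-- Consistency error of the mixed method (Lemma 4.3): for the solution
`u` of the quad-curl singular perturbation problem and any `v_h ∈ W_{h0}`,
`ε²a_h(u,v_h) + b(u,v_h) - (f,v_h) ≤ C h ε² |curl u|₂ |curl v_h|_{1,h}` and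
`ε²a_h(u,v_h) + b(u,v_h) - (f,v_h) ≤ C h^{1/2} ε² |curl u|₁^{1/2} |curl u|₂^{1/2} |curl v_h|_{1,h}`. -/
theorem statement10 (ρ ε₀ : ℝ) (hρ : 0 < ρ) (hε₀ : 0 < ε₀) (Ω : Set Vec)
    (hΩ : PolyhedralDomain Ω) (hconv : Convex ℝ Ω) :
    ∃ C > 0, ∀ k : ℕ, (k = 1 ∨ k = 2) → ∀ M : Mesh, M.Covers Ω → Mesh.ShapeReg ρ M →
      ∀ ε : ℝ, 0 < ε → ε ≤ ε₀ → ∀ f u cu J,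
        MemL2V Ω f → WkDivFree Ω f → IsQuadCurlSol Ω ε f u cu J →
        ∀ D2 : (Fin 2 → Fin 3) → Fin 3 → Vec → ℝ, MemHiter Ω 2 cu D2 →
        ∀ v, MemWh0 k M Ω v →
          (ε ^ 2 * ahC M J v + bhC M cu v - fpair M f v
             ≤ C * M.hsize * ε ^ 2 * semiIter Ω 2 D2 * semiCurl M v) ∧
          (ε ^ 2 * ahC M J v + bhC M cu v - fpair M f v
             ≤ C * Real.sqrt M.hsize * ε ^ 2 * Real.sqrt (semiJ Ω J)
                 * Real.sqrt (semiIter Ω 2 D2) * semiCurl M v) := by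
  refine ⟨9 * (256 / ρ), by positivity, ?_⟩
  intro k hk M hc hs ε hε _ f u cu J hf _ hu D2 hD v hv
  have hm : MeasurableSet Ω := (covers_open hc).measurableSet
  haveI : IsFiniteMeasure (volume.restrict Ω) := ⟨by rw [Measure.restrict_apply_univ]; exact vol_fin hc⟩
  have lJ : ∀ a b, MemLp (fun x => J x a b) 2 (volume.restrict Ω) := hu.1.2.2.1
  have lD : ∀ α c, MemLp (D2 α c) 2 (volume.restrict Ω) := fun α c => (hD α c).2
  have iJ : ∀ a b, IntegrableOn (fun x => J x a b) Ω := fun a b => (lJ a b).integrable one_le_two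
  have iD : ∀ α c, IntegrableOn (D2 α c) Ω := fun α c => (lD α c).integrable one_le_two
  have ic : ∀ a, IntegrableOn (fun x => cu x a) Ω := fun a => (hu.1.2.1.integrable one_le_two).eval a
  have jf : ∀ a, IntegrableOn (fun x => f x a) Ω := fun a => (hf.integrable one_le_two).eval a
  have zz : ∀ {F : Vec → ℝ}, IntegrableOn F Ω → Integrable (zextS Ω F) := fun h => (integrable_indicator_iff hm).2 h
  have zsq : ∀ F : Vec → ℝ, (fun x => zextS Ω F x ^ 2) = zextS Ω (fun x => F x ^ 2) := by
    intro F; funext x; unfold zextS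
    by_cases hx : x ∈ Ω <;> simp [hx]
  have zz2 : ∀ {F : Vec → ℝ}, MemLp F 2 (volume.restrict Ω) → Integrable (fun x => zextS Ω F x ^ 2) := fun {F} h => by
    rw [zsq]; exact zz h.integrable_sq
  have zs : ∀ {F : Vec → ℝ}, MemLp F 2 (volume.restrict Ω) →
      ∑ i, ∫ x in (M.el i).K, zextS Ω F x ^ 2 = ∫ x in Ω, F x ^ 2 := fun {F} h => by
    rw [← sum_el hc hconv h.integrable_sq]
    exact Finset.sum_congr rfl fun i _ => integral_congr_ae ((zK hc hconv i F).mono fun x hx => by simp only [hx])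
  have c1 : ∀ i a, ContDiff ℝ 1 fun x => curl3 (v i) x a := fun i a => curl_c1 (hv.1.1 i) a
  have kc := fun i => K_compact (M.el i)
  have hh : 0 ≤ M.hsize := Metric.diam_nonneg.trans (diam_le_h M ⟨0, M.npos⟩)
  have b1 : ∀ a, √(∑ i, ∫ x in (M.el i).K, nsq3 (grad3 (fun y => curl3 (v i) y a) x)) ≤ semiCurl M v := by
    intro a
    refine Real.sqrt_le_sqrt (Finset.sum_le_sum fun i _ => ?_)
    have e : ∀ x, nsqM (jac3 (curl3 (v i)) x) = ∑ c, nsq3 (grad3 (fun y => curl3 (v i) y c) x) := fun x => rfl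
    refine setIntegral_mono_on (ci (kc i) (q_cont (c1 i a))) ?_ (kc i).measurableSet fun x _ => ?_
    · simp only [e]
      exact ci (kc i) (continuous_finsetSum _ fun c _ => q_cont (c1 i c))
    · rw [e]
      exact Finset.single_le_sum (f := fun c => nsq3 (grad3 (fun y => curl3 (v i) y c) x)) (fun c _ => nsq3_nonneg _) (Finset.mem_univ a)
  have b2 : ∀ a b, √(∑ i, ∑ j, ∫ x in (M.el i).K, zextS Ω (D2 ![b, j] a) x ^ 2) ≤ semiIter Ω 2 D2 := by
    intro a b
    refine Real.sqrt_le_sqrt ?_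
    rw [Finset.sum_comm]
    simp only [zs (lD _ _)]
    have n0 : ∀ α c, 0 ≤ ∫ x in Ω, D2 α c x ^ 2 := fun α c => integral_nonneg fun x => sq_nonneg _
    have inj : Function.Injective (fun j : Fin 3 => (![b, j] : Fin 2 → Fin 3)) := fun j j' h => by
      simpa using congrFun h 1
    calc ∑ j, ∫ x in Ω, D2 ![b, j] a x ^ 2 ≤ ∑ j, ∑ c, ∫ x in Ω, D2 ![b, j] c x ^ 2 :=
          Finset.sum_le_sum fun j _ => Finset.single_le_sum (f := fun c => ∫ x in Ω, D2 ![b, j] c x ^ 2)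
            (fun c _ => n0 _ c) (Finset.mem_univ a)
      _ = ∑ α ∈ Finset.univ.image (fun j : Fin 3 => (![b, j] : Fin 2 → Fin 3)), ∑ c, ∫ x in Ω, D2 α c x ^ 2 :=
          (Finset.sum_image (f := fun α => ∑ c, ∫ x in Ω, D2 α c x ^ 2) inj.injOn).symm
      _ ≤ _ := Finset.sum_le_univ_sum_of_nonneg fun α => Finset.sum_nonneg fun c _ => n0 α c
  have b3 : ∀ a b, √(∑ i, ∫ x in (M.el i).K, zextS Ω (fun y => J y a b) x ^ 2) ≤ semiJ Ω J := by
    intro a b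
    refine Real.sqrt_le_sqrt ?_
    rw [zs (lJ a b)]
    have e : ∀ x, nsqM (J x) = ∑ c, ∑ d, J x c d ^ 2 := fun x => by
      unfold nsqM dotM
      simp only [pow_two]
    refine setIntegral_mono_on (lJ a b).integrable_sq ?_ hm fun x _ => ?_
    · simp only [e]
      exact integrable_finsetSum _ fun c _ => integrable_finsetSum _ fun d _ => (lJ c d).integrable_sq
    · rw [e]
      exact (Finset.single_le_sum (f := fun d => J x a d ^ 2) (fun d _ => sq_nonneg _) (Finset.mem_univ b)).trans
        (Finset.single_le_sum (f := fun c => ∑ d, J x c d ^ 2) (fun c _ => Finset.sum_nonneg fun d _ => sq_nonneg _) (Finset.mem_univ a))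
  have key := fun a b => scal_cons hρ hconv hc hs (w := fun i y => curl3 (v i) y a) (fun i => c1 i a)
    (fun i j p q hij h => (tan_in hk hv i j p q hij h).2 a) (fun i p h => (tan_bd hk hv i p h).2 a)
    (F := zextS Ω fun y => J y a b) (D := fun j => zextS Ω (D2 ![b, j] a)) (zz (iJ a b)) (zz2 (lJ a b))
    (fun j => zz (iD _ a)) (fun j => zz2 (lD _ a)) (fun j φ hφ hS => by
      rw [zext_mul Ω hm, zext_mul Ω hm]
      exact wkJ hm hu.1.2 hD a b j hφ hS) b
  have s0 : 0 ≤ semiCurl M v := Real.sqrt_nonneg _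
  have s1 : 0 ≤ semiIter Ω 2 D2 := Real.sqrt_nonneg _
  have s2 : 0 ≤ semiJ Ω J := Real.sqrt_nonneg _
  rw [err_id hk hconv hc hv hu hD iJ iD ic jf]
  have fin : ∀ B : ℝ, (∀ a b, ∑ i, ∫ x in (M.el i).K, (zextS Ω (fun y => J y a b) x * pd b (fun y => curl3 (v i) y a) x +
        zextS Ω (D2 ![b, b] a) x * curl3 (v i) x a) ≤ B) →
      ε ^ 2 * ∑ a, ∑ b, ∑ i, ∫ x in (M.el i).K, (zextS Ω (fun y => J y a b) x * pd b (fun y => curl3 (v i) y a) x +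
        zextS Ω (D2 ![b, b] a) x * curl3 (v i) x a) ≤ ε ^ 2 * (9 * B) := by
    intro B hB
    refine mul_le_mul_of_nonneg_left ?_ (sq_nonneg ε)
    refine (Finset.sum_le_sum fun a _ => Finset.sum_le_sum fun b _ => hB a b).trans (le_of_eq ?_)
    simp; ring
  constructor
  · refine (fin (256 / ρ * M.hsize * (semiCurl M v * semiIter Ω 2 D2)) fun a b => (key a b).1.trans ?_).trans (le_of_eq (by ring))
    have := b1 a
    have := b2 a b
    gcongr
  · refine (fin (256 / ρ * √M.hsize * (semiCurl M v * √(semiJ Ω J * semiIter Ω 2 D2))) fun a b => (key a b).2.trans ?_).trans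
      (le_of_eq (by rw [Real.sqrt_mul s2]; ring))
    have := b1 a
    have := b2 a b
    have := b3 a b
    gcongr
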